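/- Let f and g be two C^3 multicritical circle maps with the same irrational rotation number and the same number N of (non-flat) critical points, and let h: S^1 → S^1 be a homeomorphism conjugating f to g, i.e. h∘f = g∘h. If h maps each critical point of f to a corresponding critical point of g, then h is quasisymmetric: there exists a constant K ≥ 1 such that for all x ∈ S^1 and all t > 0, 1/K ≤ |h(x+t) − h(x)|/|h(x) − h(x−t)| ≤ K. -/

import Mathlib

open Set Filter MeasureTheory

noncomputable section

/-- The Schwarzian derivative `Sf = (f''/f')' - (1/2) (f''/f')^2`. -/
def schwarzianDeriv (f : ℝ → ℝ) (x : ℝ) : ℝ :=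
  deriv (fun y => deriv (deriv f) y / deriv f y) x
    - (1 / 2) * (deriv (deriv f) x / deriv f x) ^ 2

/-- A multicritical circle map, described through its lift `F : ℝ → ℝ` to the real line.
It is an orientation-preserving `C^3` circle homeomorphism with finitely many critical
points `c 0, …, c (N-1)`, each of non-flat power-law type: near `c i` the derivative is
pinched between two multiples of `|x - c i| ^ (s i - 1)` with `s i > 1`, the Schwarzian
derivative is negative on a punctured neighborhood of each critical point, and
`log (F')` has bounded variation (bounded by `v`) off the critical neighborhoods. -/
structure MCM where
  /-- the lift of the circle map -/
  F : ℝ → ℝ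
  smooth : ContDiff ℝ 3 F
  mono : StrictMono F
  deg1 : ∀ x, F (x + 1) = F x + 1
  /-- number of critical points -/
  N : ℕ
  N_pos : 0 < N
  /-- the critical points (one representative in `[0,1)` for each) -/
  c : Fin N → ℝ
  c_mem : ∀ i, c i ∈ Set.Ico (0 : ℝ) 1
  c_inj : Function.Injective c
  isCrit : ∀ i, deriv F (c i) = 0
  critOnly : ∀ x, deriv F x = 0 → ∃ (i : Fin N) (k : ℤ), x = c i + (k : ℝ)
  /-- neighborhoods of the critical points -/
  W : Fin N → Set ℝ
  W_open : ∀ i, IsOpen (W i)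
  c_mem_W : ∀ i, c i ∈ W i
  /-- the criticalities (power-law exponents) -/
  s : Fin N → ℝ
  s_gt_one : ∀ i, 1 < s i
  al : Fin N → ℝ
  be : Fin N → ℝ
  al_pos : ∀ i, 0 < al i
  al_lt_be : ∀ i, al i < be i
  powerLaw : ∀ i, ∀ x ∈ W i, x ≠ c i →
    al i * |x - c i| ^ (s i - 1) < deriv F x ∧
      deriv F x < be i * |x - c i| ^ (s i - 1)
  negSchwarzian : ∀ i, ∀ x ∈ W i, x ≠ c i → schwarzianDeriv F x < 0
  /-- bound for the variation of `log DF` off the critical neighborhoods -/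
  v : ℝ
  v_pos : 0 < v
  logDF_var : eVariationOn (fun x => Real.log (deriv F x))
      (Set.Icc 0 1 \ ⋃ (i) (k : ℤ), (fun y => y + (k : ℝ)) '' W i) ≤ ENNReal.ofReal v

/-- The circle map with lift `F` has rotation number `ρ`. -/
def HasRotationNumber (F : ℝ → ℝ) (ρ : ℝ) : Prop :=
  Tendsto (fun n : ℕ => F^[n] 0 / n) atTop (nhds ρ)

/-- Working data for a multicritical circle map: lift, three derivatives, critical points. -/
structure Nice where
  F : ℝ → ℝ
  d1 : ℝ → ℝ
  d2 : ℝ → ℝ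
  d3 : ℝ → ℝ
  hF : ∀ x, HasDerivAt F (d1 x) x
  hd1 : ∀ x, HasDerivAt d1 (d2 x) x
  hd2 : ∀ x, HasDerivAt d2 (d3 x) x
  cont3 : Continuous d3
  mono : StrictMono F
  deg1 : ∀ x, F (x + 1) = F x + 1
  N : ℕ
  N_pos : 0 < N
  c : Fin N → ℝ
  crit : ∀ x, d1 x = 0 ↔ ∃ (i : Fin N) (k : ℤ), x = c i + k
  pl : ∀ i, ∃ r s a b : ℝ, 0 < r ∧ 1 < s ∧ 0 < a ∧ 0 < b ∧ ∀ x, x ≠ c i → |x - c i| < r →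
    a * |x - c i| ^ (s - 1) ≤ d1 x ∧ d1 x ≤ b * |x - c i| ^ (s - 1) ∧
      2 * d3 x * d1 x < 3 * (d2 x) ^ 2
  ρ : ℝ
  irr : Irrational ρ
  rot : HasRotationNumber F ρ

namespace Nice
variable (f : Nice)

theorem contF : Continuous f.F := continuous_iff_continuousAt.2 fun x => (f.hF x).continuousAt
theorem cont1 : Continuous f.d1 := continuous_iff_continuousAt.2 fun x => (f.hd1 x).continuousAt
theorem cont2 : Continuous f.d2 := continuous_iff_continuousAt.2 fun x => (f.hd2 x).continuousAt

def lift : CircleDeg1Lift := ⟨⟨f.F, f.mono.monotone⟩, f.deg1⟩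

theorem lift_apply (x : ℝ) : f.lift x = f.F x := rfl

theorem lift_unit : IsUnit f.lift :=
  CircleDeg1Lift.isUnit_iff_bijective.2
    ⟨f.mono.injective, (CircleDeg1Lift.continuous_iff_surjective f.lift).1 f.contF⟩

def U : CircleDeg1Liftˣ := f.lift_unit.unit

theorem U_coe : (f.U : CircleDeg1Lift) = f.lift := f.lift_unit.unit_spec

theorem trans_lift : f.lift.translationNumber = f.ρ := by
  apply CircleDeg1Lift.translationNumber_eq_of_tendsto₀
  exact f.rot

/-- The `ℤ²` action generated by the lift and the unit translation. -/
def T (v : ℤ × ℤ) (x : ℝ) : ℝ := ((f.U ^ v.1 : CircleDeg1Liftˣ) : CircleDeg1Lift) x - v.2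

def val (v : ℤ × ℤ) : ℝ := v.1 * f.ρ - v.2

theorem val_add (u v : ℤ × ℤ) : f.val (u + v) = f.val u + f.val v := by
  simp [val]; ring
theorem val_sub (u v : ℤ × ℤ) : f.val (u - v) = f.val u - f.val v := by
  simp [val]; ring
theorem val_neg (v : ℤ × ℤ) : f.val (-v) = - f.val v := by
  simp [val]; ring
theorem val_zero : f.val 0 = 0 := by simp [val]
theorem val_zsmul (n : ℤ) (v : ℤ × ℤ) : f.val (n • v) = n * f.val v := by
  simp [val]; ring

theorem val_inj {u v : ℤ × ℤ} (h : f.val u = f.val v) : u = v := by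
  have h1 : ((u.1 - v.1 : ℤ) : ℝ) * f.ρ = ((u.2 - v.2 : ℤ) : ℝ) := by
    simp only [val] at h; push_cast; linarith
  have h2 : u.1 = v.1 := by
    by_contra hne
    have : (u.1 - v.1) ≠ 0 := sub_ne_zero.2 hne
    have h3 := (f.irr.intCast_mul this)
    rw [h1] at h3
    exact (Int.not_irrational _) h3
  have h4 : u.2 = v.2 := by
    rw [h2] at h1; simp at h1
    have : ((u.2 - v.2 : ℤ) : ℝ) = 0 := by push_cast; linarith
    have := Int.cast_eq_zero.1 this
    omega
  exact Prod.ext h2 h4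

theorem T_add (u v : ℤ × ℤ) (x : ℝ) : f.T (u + v) x = f.T u (f.T v x) := by
  simp only [T, Prod.fst_add, Prod.snd_add, zpow_add, Units.val_mul, CircleDeg1Lift.mul_apply,
    CircleDeg1Lift.map_sub_int]
  push_cast; ring

@[simp] theorem T_zero (x : ℝ) : f.T 0 x = x := by simp [T]

theorem T_neg_T (v : ℤ × ℤ) (x : ℝ) : f.T (-v) (f.T v x) = x := by
  rw [← T_add]; simp
theorem T_T_neg (v : ℤ × ℤ) (x : ℝ) : f.T v (f.T (-v) x) = x := by
  rw [← T_add]; simp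

theorem T_comm (u v : ℤ × ℤ) (x : ℝ) : f.T u (f.T v x) = f.T v (f.T u x) := by
  rw [← T_add, ← T_add, add_comm]

theorem T_strictMono (v : ℤ × ℤ) : StrictMono (f.T v) := by
  intro x y h
  have := (CircleDeg1Lift.toOrderIso (f.U ^ v.1)).strictMono h
  simp only [CircleDeg1Lift.coe_toOrderIso] at this
  simpa [T] using this

theorem T_lt_iff (v : ℤ × ℤ) {x y : ℝ} : f.T v x < f.T v y ↔ x < y := (f.T_strictMono v).lt_iff_lt
theorem T_le_iff (v : ℤ × ℤ) {x y : ℝ} : f.T v x ≤ f.T v y ↔ x ≤ y := (f.T_strictMono v).le_iff_le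

theorem T_cont (v : ℤ × ℤ) : Continuous (f.T v) := by
  have := (CircleDeg1Lift.toOrderIso (f.U ^ v.1)).continuous
  simp only [CircleDeg1Lift.coe_toOrderIso] at this
  exact this.sub continuous_const

theorem T_add_int (v : ℤ × ℤ) (x : ℝ) (k : ℤ) : f.T v (x + k) = f.T v x + k := by
  simp only [T, CircleDeg1Lift.map_add_int]; ring
theorem T_add_one (v : ℤ × ℤ) (x : ℝ) : f.T v (x + 1) = f.T v x + 1 := by
  simpa using f.T_add_int v x 1

theorem T_pos {v : ℤ × ℤ} (h : 0 < f.val v) (x : ℝ) : x < f.T v x := by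
  have h1 : ((v.2 : ℤ) : ℝ) < CircleDeg1Lift.translationNumber (f.U ^ v.1 : CircleDeg1Liftˣ) := by
    rw [CircleDeg1Lift.translationNumber_zpow, U_coe, trans_lift]
    simp only [val] at h; linarith
  have := CircleDeg1Lift.lt_map_of_int_lt_translationNumber _ h1 x
  simp only [T]; linarith

theorem T_mono_val {u v : ℤ × ℤ} (h : f.val u < f.val v) (x : ℝ) : f.T u x < f.T v x := by
  have h1 : 0 < f.val (v - u) := by rw [val_sub]; linarith
  have := f.T_pos h1 (f.T u x)
  rwa [← T_add, sub_add_cancel] at this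

theorem T_mono_val_le {u v : ℤ × ℤ} (h : f.val u ≤ f.val v) (x : ℝ) : f.T u x ≤ f.T v x := by
  rcases h.lt_or_eq with h | h
  · exact (f.T_mono_val h x).le
  · rw [f.val_inj h]

theorem T_neg {v : ℤ × ℤ} (h : f.val v < 0) (x : ℝ) : f.T v x < x := by
  have := f.T_mono_val (u := v) (v := 0) (by rwa [val_zero]) x
  simpa using this

theorem T_val_lt {u v : ℤ × ℤ} {x : ℝ} (h : f.T u x < f.T v x) : f.val u < f.val v := by
  by_contra hn
  exact absurd (f.T_mono_val_le (not_lt.1 hn) x) (not_le.2 h)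

theorem T_nat (i : ℕ) (p : ℤ) (x : ℝ) : f.T ((i : ℤ), p) x = f.F^[i] x - p := by
  simp only [T, zpow_natCast, Units.val_pow_eq_pow_val, U_coe, CircleDeg1Lift.coe_pow]
  rfl

theorem T_int (k : ℤ) (x : ℝ) : f.T (0, k) x = x - k := by
  simpa using f.T_nat 0 k x

theorem F_eq_T (x : ℝ) : f.F x = f.T (1, 0) x := by
  have := f.T_nat 1 0 x
  simp at this; exact this.symm

theorem iter_eq_T (i : ℕ) (x : ℝ) : f.F^[i] x = f.T ((i : ℤ), 0) x := by
  have := f.T_nat i 0 x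
  simp at this; exact this.symm

theorem iter_T (i : ℕ) (v : ℤ × ℤ) (x : ℝ) : f.F^[i] (f.T v x) = f.T v (f.F^[i] x) := by
  rw [iter_eq_T, iter_eq_T, T_comm]

theorem F_T (v : ℤ × ℤ) (x : ℝ) : f.F (f.T v x) = f.T v (f.F x) := by
  rw [F_eq_T, F_eq_T, T_comm]

theorem F_add_int (x : ℝ) (k : ℤ) : f.F (x + k) = f.F x + k := by
  rw [F_eq_T, F_eq_T, T_add_int]

theorem iter_strictMono (i : ℕ) : StrictMono (f.F^[i]) := f.mono.iterate i

theorem d1_add_int (x : ℝ) (k : ℤ) : f.d1 (x + k) = f.d1 x := by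
  have h1 : HasDerivAt (fun y => f.F (y + k)) (f.d1 (x + k)) x := by
    simpa using (f.hF (x + k)).comp_add_const x (k : ℝ)
  have h2 : HasDerivAt (fun y => f.F y + k) (f.d1 x) x := (f.hF x).add_const _
  have : (fun y => f.F (y + k)) = fun y => f.F y + k := funext fun y => f.F_add_int y k
  rw [this] at h1
  exact h1.unique h2

theorem d2_add_int (x : ℝ) (k : ℤ) : f.d2 (x + k) = f.d2 x := by
  have h1 : HasDerivAt (fun y => f.d1 (y + k)) (f.d2 (x + k)) x := by
    simpa using (f.hd1 (x + k)).comp_add_const x (k : ℝ)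
  have : (fun y => f.d1 (y + k)) = f.d1 := funext fun y => f.d1_add_int y k
  rw [this] at h1
  exact h1.unique (f.hd1 x)

theorem d3_add_int (x : ℝ) (k : ℤ) : f.d3 (x + k) = f.d3 x := by
  have h1 : HasDerivAt (fun y => f.d2 (y + k)) (f.d3 (x + k)) x := by
    simpa using (f.hd2 (x + k)).comp_add_const x (k : ℝ)
  have : (fun y => f.d2 (y + k)) = f.d2 := funext fun y => f.d2_add_int y k
  rw [this] at h1
  exact h1.unique (f.hd2 x)

theorem d1_nonneg (x : ℝ) : 0 ≤ f.d1 x := by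
  rw [← (f.hF x).deriv]; exact f.mono.monotone.deriv_nonneg

theorem d1_pos {x : ℝ} (h : f.d1 x ≠ 0) : 0 < f.d1 x := lt_of_le_of_ne (f.d1_nonneg x) h.symm

theorem exists_crit : ∃ z, f.d1 z = 0 := ⟨f.c ⟨0, f.N_pos⟩, (f.crit _).2 ⟨⟨0, f.N_pos⟩, 0, by simp⟩⟩

end Nice

/-- A continuous 1-periodic function is bounded above. -/
theorem periodic_bdd {u : ℝ → ℝ} (hc : Continuous u) (hp : ∀ x, u (x + 1) = u x) :
    ∃ C : ℝ, 0 < C ∧ ∀ x, |u x| ≤ C := by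
  obtain ⟨C, hC⟩ := (Function.Periodic.isBounded_of_continuous (c := 1) hp one_ne_zero hc).exists_norm_le
  exact ⟨max C 1, by positivity, fun x => (hC _ ⟨x, rfl⟩).trans (le_max_left _ _)⟩

/-- A continuous positive 1-periodic function is bounded below. -/
theorem periodic_pos {u : ℝ → ℝ} (hc : Continuous u) (hp : ∀ x, u (x + 1) = u x)
    (h : ∀ x, 0 < u x) : ∃ m : ℝ, 0 < m ∧ ∀ x, m ≤ u x := by
  obtain ⟨C, hC, h2⟩ := periodic_bdd (u := fun x => (u x)⁻¹)
    (hc.inv₀ fun x => (h x).ne') (fun x => by simp [hp])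
  refine ⟨C⁻¹, by positivity, fun x => ?_⟩
  have := h2 x
  rw [abs_of_pos (inv_pos.2 (h x))] at this
  rw [inv_le_comm₀ hC (h x)]; exact this

/-- A continuous 1-periodic function attains its minimum. -/
theorem periodic_min {u : ℝ → ℝ} (hc : Continuous u) (hp : ∀ x, u (x + 1) = u x) :
    ∃ x0, ∀ x, u x0 ≤ u x := by
  obtain ⟨x0, -, h0⟩ := isCompact_Icc.exists_isMinOn (nonempty_Icc.2 (zero_le_one (α := ℝ))) hc.continuousOn
  refine ⟨x0, fun x => ?_⟩
  obtain ⟨y, hy, hxy⟩ := Function.Periodic.exists_mem_Ico₀ (c := 1) hp one_pos x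
  rw [hxy]; exact h0 ⟨hy.1, hy.2.le⟩

theorem fin_lower {N : ℕ} (hN : 0 < N) (r : Fin N → ℝ) (h : ∀ i, 0 < r i) :
    ∃ m, 0 < m ∧ ∀ i, m ≤ r i := by
  have : Nonempty (Fin N) := ⟨⟨0, hN⟩⟩
  obtain ⟨i, hi⟩ := Finite.exists_min r
  exact ⟨r i, h i, hi⟩

theorem fin_upper {N : ℕ} (r : Fin N → ℝ) : ∃ m, 1 ≤ m ∧ ∀ i, r i ≤ m := by
  obtain ⟨B, hB⟩ := (Set.finite_range r).bddAbove
  exact ⟨max B 1, le_max_right _ _, fun i => (hB ⟨i, rfl⟩).trans (le_max_left _ _)⟩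

namespace Nice
variable (f : Nice)

theorem unif_aux (i : Fin f.N) : ∃ r C σ : ℝ, 0 < r ∧ 1 ≤ C ∧ 0 < σ ∧
    ∀ x, |x - f.c i| < r → (x ≠ f.c i → 0 < f.d1 x ∧ 2 * f.d3 x * f.d1 x < 3 * (f.d2 x) ^ 2) ∧
      (∀ y, |y - f.c i| < r → |y - f.c i| ≤ 2 * |x - f.c i| → f.d1 y ≤ C * f.d1 x) ∧
      (∀ y θ, 0 ≤ θ → θ ≤ 1 → |y - f.c i| ≤ θ * |x - f.c i| → f.d1 y ≤ C * θ ^ σ * f.d1 x) := by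
  obtain ⟨r, s, a, b, hr, hs, ha, hb, H⟩ := f.pl i
  have hc0 : f.d1 (f.c i) = 0 := (f.crit _).2 ⟨i, 0, by simp⟩
  have key : ∀ x y θ, |x - f.c i| < r → |y - f.c i| < r → 0 ≤ θ → |y - f.c i| ≤ θ * |x - f.c i| →
      f.d1 y ≤ (b / a) * θ ^ (s - 1) * f.d1 x := by
    intro x y θ hx hy hθ hxy
    by_cases hyc : y = f.c i
    · rw [hyc, hc0]; have := f.d1_nonneg x; positivity
    have hypos : 0 < |y - f.c i| := abs_pos.2 (sub_ne_zero.2 hyc)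
    have hxc : x ≠ f.c i := by
      rintro rfl; simp at hxy; exact hyc (by linarith [sub_eq_zero.1 hxy])
    have h1 := (H x hxc hx).1
    have h2 := (H y hyc hy).2.1
    calc f.d1 y ≤ b * |y - f.c i| ^ (s - 1) := h2
      _ ≤ b * (θ * |x - f.c i|) ^ (s - 1) := by
          gcongr
      _ = (b / a) * θ ^ (s - 1) * (a * |x - f.c i| ^ (s - 1)) := by
          rw [Real.mul_rpow hθ (abs_nonneg _)]; field_simp
      _ ≤ _ := by gcongr
  refine ⟨r, max 1 ((b / a) * 2 ^ (s - 1)), s - 1, hr, le_max_left _ _, by linarith, ?_⟩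
  intro x hx
  refine ⟨fun hxc => ⟨?_, (H x hxc hx).2.2⟩, ?_, ?_⟩
  · refine lt_of_lt_of_le ?_ (H x hxc hx).1
    have : 0 < |x - f.c i| := abs_pos.2 (sub_ne_zero.2 hxc)
    positivity
  · intro y hy hxy
    refine (key x y 2 hx hy (by norm_num) hxy).trans ?_
    have := f.d1_nonneg x
    gcongr; exact le_max_right _ _
  · intro y θ h0 h1 hxy
    have hy : |y - f.c i| < r := by
      have := abs_nonneg (x - f.c i); nlinarith
    refine (key x y θ hx hy h0 hxy).trans ?_
    have := f.d1_nonneg x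
    gcongr
    refine le_trans ?_ (le_max_right _ _)
    have : (1 : ℝ) ≤ 2 ^ (s - 1) := Real.one_le_rpow (by norm_num) (by linarith)
    have h3 : 0 < b / a := by positivity
    nlinarith

theorem unif : ∃ r C σ : ℝ, 0 < r ∧ r ≤ 1 ∧ 1 ≤ C ∧ 0 < σ ∧ ∀ z, f.d1 z = 0 →
    ∀ x, |x - z| < r → (x ≠ z → 0 < f.d1 x ∧ 2 * f.d3 x * f.d1 x < 3 * (f.d2 x) ^ 2) ∧
      (∀ y, |y - z| < r → |y - z| ≤ 2 * |x - z| → f.d1 y ≤ C * f.d1 x) ∧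
      (∀ y θ, 0 ≤ θ → θ ≤ 1 → |y - z| ≤ θ * |x - z| → f.d1 y ≤ C * θ ^ σ * f.d1 x) := by
  choose r C σ hr hC hσ H using f.unif_aux
  obtain ⟨r0, hr0, hr1⟩ := fin_lower f.N_pos r hr
  obtain ⟨σ0, hσ0, hσ1⟩ := fin_lower f.N_pos σ hσ
  obtain ⟨C0, hC0, hC1⟩ := fin_upper C
  refine ⟨min r0 1, C0, σ0, by positivity, min_le_right _ _, hC0, hσ0, ?_⟩
  intro z hz x hx
  obtain ⟨i, k, rfl⟩ := (f.crit z).1 hz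
  have e1 : ∀ y : ℝ, y - (f.c i + k) = (y + ((-k : ℤ) : ℝ)) - f.c i := by intro y; push_cast; ring
  have hlt : min r0 1 ≤ r i := (min_le_left _ _).trans (hr1 i)
  obtain ⟨A, B, D⟩ := H i (x + ((-k : ℤ) : ℝ)) (by rw [← e1]; linarith)
  simp only [d1_add_int, d2_add_int, d3_add_int] at A B D
  refine ⟨fun hne => A ?_, fun y hy hxy => ?_, fun y θ h0 h1 hxy => ?_⟩
  · intro h; apply hne; push_cast at h; linarith
  · have := B (y + ((-k : ℤ) : ℝ)) (by rw [← e1]; linarith) (by rw [← e1, ← e1]; exact hxy)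
    rw [d1_add_int] at this
    exact this.trans (mul_le_mul_of_nonneg_right (hC1 i) (f.d1_nonneg x))
  · have := D (y + ((-k : ℤ) : ℝ)) θ h0 h1 (by rw [← e1, ← e1]; exact hxy)
    rw [d1_add_int] at this
    refine this.trans (mul_le_mul_of_nonneg_right ?_ (f.d1_nonneg x))
    have h2 : θ ^ σ i ≤ θ ^ σ0 := Real.rpow_le_rpow_of_exponent_ge' h0 h1 hσ0.le (hσ1 i)
    have := Real.rpow_nonneg h0 (σ i)
    have := hC1 i
    have := hC i
    nlinarith

end Nice

/-- Mean value theorem in multiplicative form. -/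
theorem mvt {F F' : ℝ → ℝ} {a b : ℝ} (hab : a < b) (hc : ContinuousOn F (Icc a b))
    (h : ∀ x ∈ Ioo a b, HasDerivAt F (F' x) x) : ∃ p ∈ Ioo a b, F b - F a = F' p * (b - a) := by
  obtain ⟨p, hp, he⟩ := exists_hasDerivAt_eq_slope F F' hab hc h
  refine ⟨p, hp, ?_⟩
  rw [he]; field_simp [(sub_pos.2 hab).ne']

theorem mvt' {F F' : ℝ → ℝ} {a b : ℝ} (hab : a < b)
    (h : ∀ x ∈ Icc a b, HasDerivAt F (F' x) x) : ∃ p ∈ Ioo a b, F b - F a = F' p * (b - a) :=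
  mvt hab (fun x hx => (h x hx).continuousAt.continuousWithinAt) fun x hx => h x (Ioo_subset_Icc_self hx)

theorem incr {F F' : ℝ → ℝ} {a b : ℝ} (hab : a ≤ b) (hc : ContinuousOn F (Icc a b))
    (h : ∀ x ∈ Ioo a b, HasDerivAt F (F' x) x) (h0 : ∀ x ∈ Ioo a b, 0 ≤ F' x) : F a ≤ F b := by
  rcases hab.lt_or_eq with hab | rfl
  · obtain ⟨p, hp, he⟩ := mvt hab hc h
    have := mul_nonneg (h0 p hp) (sub_pos.2 hab).le
    linarith
  · exact le_rfl

/-- Chord inequality for functions with nonnegative second derivative. -/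
theorem chord {V V1 V2 : ℝ → ℝ} {a b : ℝ} (h1 : ∀ x ∈ Ioo a b, HasDerivAt V (V1 x) x)
    (h2 : ∀ x ∈ Ioo a b, HasDerivAt V1 (V2 x) x) (h3 : ∀ x ∈ Ioo a b, 0 ≤ V2 x)
    {x y z : ℝ} (hx : a < x) (hxy : x ≤ y) (hyz : y ≤ z) (hz : z < b) :
    V y * (z - x) ≤ V x * (z - y) + V z * (y - x) := by
  rcases hxy.lt_or_eq with hxy | rfl
  swap; · linarith
  rcases hyz.lt_or_eq with hyz | rfl
  swap; · linarith
  obtain ⟨p, hp, ep⟩ := mvt' hxy (fun t ht => h1 t ⟨hx.trans_le ht.1, by linarith [ht.2]⟩)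
  obtain ⟨q, hq, eq⟩ := mvt' hyz (fun t ht => h1 t ⟨by linarith [ht.1], by linarith [ht.2]⟩)
  have hpq : V1 p ≤ V1 q := by
    apply incr (F' := V2) (by linarith [hp.2, hq.1])
    · intro t ht
      exact (h2 t ⟨by linarith [ht.1, hp.1], by linarith [ht.2, hq.2]⟩).continuousAt.continuousWithinAt
    · intro t ht; exact h2 t ⟨by linarith [ht.1, hp.1], by linarith [ht.2, hq.2]⟩
    · intro t ht; exact h3 t ⟨by linarith [ht.1, hp.1], by linarith [ht.2, hq.2]⟩
  have h4 : V1 p * ((y - x) * (z - y)) ≤ V1 q * ((y - x) * (z - y)) :=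
    mul_le_mul_of_nonneg_right hpq (mul_nonneg (by linarith) (by linarith))
  have e1 : V1 p * ((y - x) * (z - y)) = (V y - V x) * (z - y) := by rw [ep]; ring
  have e2 : V1 q * ((y - x) * (z - y)) = (V z - V y) * (y - x) := by rw [eq]; ring
  linarith

/-- The cross-ratio. -/
def cr (x1 x2 x3 x4 : ℝ) : ℝ := (x2 - x1) * (x4 - x3) / ((x3 - x1) * (x4 - x2))

theorem cr_pos {x1 x2 x3 x4 : ℝ} (h12 : x1 < x2) (h23 : x2 < x3) (h34 : x3 < x4) :
    0 < cr x1 x2 x3 x4 := by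
  have a : 0 < x2 - x1 := by linarith
  have b : 0 < x4 - x3 := by linarith
  have c : 0 < x3 - x1 := by linarith
  have d : 0 < x4 - x2 := by linarith
  unfold cr; positivity

theorem cr_le_of {x1 x2 x3 x4 y1 y2 y3 y4 A B : ℝ} (h12 : x1 < x2) (h23 : x2 < x3) (h34 : x3 < x4)
    (k12 : y1 < y2) (k23 : y2 < y3) (k34 : y3 < y4) (hA : 0 ≤ A)
    (h1 : (y2 - y1) * (x3 - x1) ≤ A * (x2 - x1) * (y3 - y1))
    (h2 : (y4 - y3) * (x4 - x2) ≤ B * (x4 - x3) * (y4 - y2)) :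
    cr y1 y2 y3 y4 ≤ A * B * cr x1 x2 x3 x4 := by
  have a1 : 0 < x3 - x1 := by linarith
  have a2 : 0 < x4 - x2 := by linarith
  have a3 : 0 < y3 - y1 := by linarith
  have a4 : 0 < y4 - y2 := by linarith
  have a5 : 0 < x2 - x1 := by linarith
  have a6 : 0 < y4 - y3 := by linarith
  unfold cr
  rw [mul_div_assoc', div_le_div_iff₀ (by positivity) (by positivity)]
  have := mul_le_mul h1 h2 (by positivity) (by positivity)
  linarith

theorem chord_cr {F d V V1 V2 : ℝ → ℝ} {x1 x2 x3 x4 : ℝ} (h12 : x1 < x2) (h23 : x2 < x3)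
    (h34 : x3 < x4) (hF : ∀ x, HasDerivAt F (d x) x) (hmono : StrictMono F)
    (hd : ∀ x ∈ Ioo x1 x4, d x = 1 / (V x) ^ 2) (hV : ∀ x ∈ Ioo x1 x4, 0 < V x)
    (h1 : ∀ x ∈ Ioo x1 x4, HasDerivAt V (V1 x) x)
    (h2 : ∀ x ∈ Ioo x1 x4, HasDerivAt V1 (V2 x) x) (h3 : ∀ x ∈ Ioo x1 x4, 0 ≤ V2 x) :
    cr (F x1) (F x2) (F x3) (F x4) ≤ cr x1 x2 x3 x4 := by
  have hc : Continuous F := continuous_iff_continuousAt.2 fun x => (hF x).continuousAt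
  have hch := fun {x y z : ℝ} => chord (x := x) (y := y) (z := z) h1 h2 h3
  set p2 := V x2 with hp2
  set p3 := V x3 with hp3
  have P2 : 0 < p2 := hV x2 ⟨h12, by linarith⟩
  have P3 : 0 < p3 := hV x3 ⟨by linarith, h34⟩
  set m := (p3 - p2) / (x3 - x2) with hm
  have hMpos : 0 < x3 - x2 := by linarith
  have hmM : m * (x3 - x2) = p3 - p2 := by rw [hm]; field_simp
  set l : ℝ → ℝ := fun x => p2 + m * (x - x2) with hl
  have l2 : l x2 = p2 := by simp [hl]
  have l3 : l x3 = p3 := by simp only [hl]; linarith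
  have hlder : ∀ x, HasDerivAt l m x := by
    intro x
    exact ((((hasDerivAt_id x).sub_const x2).const_mul m).const_add p2).congr_deriv (mul_one m)
  -- derivative of the Mobius primitive
  have hPhi : ∀ s x, l s ≠ 0 → l x ≠ 0 →
      HasDerivAt (fun x => (x - s) / (l s * l x)) (1 / (l x) ^ 2) x := by
    intro s x hs hx
    have := ((hasDerivAt_id x).sub_const s).div ((hlder x).const_mul (l s)) (mul_ne_zero hs hx)
    refine this.congr_deriv ?_
    simp only [id]
    have : l x = l s + m * (x - s) := by simp only [hl]; ring
    rw [div_eq_div_iff (by positivity) (by positivity)]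
    have e : 1 * (l s * l x) - (x - s) * (l s * m) = l s * l s := by rw [this]; ring
    rw [e]; ring
  have lmul : ∀ x, l x * (x3 - x2) = p2 * (x3 - x) + p3 * (x - x2) := by
    intro x
    have : l x * (x3 - x2) = p2 * (x3 - x2) + (m * (x3 - x2)) * (x - x2) := by simp only [hl]; ring
    rw [this, hmM]; ring
  have compare_le : ∀ x ∈ Icc x2 x3, V x ≤ l x := by
    intro x hx
    have := hch h12 hx.1 hx.2 h34
    rw [← mul_le_mul_iff_left₀ hMpos, lmul]; linarith
  have compare_l : ∀ x ∈ Ioo x1 x2, l x ≤ V x := by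
    intro x hx
    have := hch hx.1 hx.2.le h23.le h34
    rw [← mul_le_mul_iff_left₀ hMpos, lmul]; linarith
  have compare_r : ∀ x ∈ Ioo x3 x4, l x ≤ V x := by
    intro x hx
    have := hch h12 h23.le hx.1.le hx.2
    rw [← mul_le_mul_iff_left₀ hMpos, lmul]; linarith
  have lpos : ∀ s t, 0 < l s → 0 < l t → ∀ x ∈ Icc s t, 0 < l x := by
    intro s t hs ht x hx
    rcases (hx.1.trans hx.2).lt_or_eq with hst | hst
    · have e : l x * (t - s) = l s * (t - x) + l t * (x - s) := by simp only [hl]; ring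
      have q1 := mul_nonneg hs.le (sub_nonneg.2 hx.2)
      have q2 := mul_nonneg ht.le (sub_nonneg.2 hx.1)
      have : 0 < l s * (t - x) + l t * (x - s) := by
        rcases hx.1.lt_or_eq with hh | hh
        · have := mul_pos ht (sub_pos.2 hh); linarith
        · subst hh; have := mul_pos hs (sub_pos.2 hst); linarith
      rw [← e] at this
      exact pos_of_mul_pos_left this (by linarith)
    · have : x = s := le_antisymm (by linarith [hx.2]) hx.1
      rwa [this]
  have inv_cmp : ∀ u w : ℝ, 0 < u → u ≤ w → 1 / w ^ 2 ≤ 1 / u ^ 2 := by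
    intro u w hu hw; gcongr
  -- middle
  have PM : 0 < l x2 ∧ 0 < l x3 := by rw [l2, l3]; exact ⟨P2, P3⟩
  have FM : (x3 - x2) / (p2 * p3) ≤ F x3 - F x2 := by
    have := incr (F := fun x => F x - (x - x2) / (l x2 * l x)) (F' := fun x => d x - 1 / (l x) ^ 2)
      h23.le ?_ ?_ ?_
    · simp only [sub_self, zero_div, sub_zero, l2, l3] at this; linarith
    · intro x hx
      have hx0 := (lpos _ _ PM.1 PM.2 x hx)
      exact ((hF x).sub (hPhi x2 x PM.1.ne' hx0.ne')).continuousAt.continuousWithinAt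
    · intro x hx
      have hx0 := (lpos _ _ PM.1 PM.2 x (Ioo_subset_Icc_self hx))
      exact ((hF x).sub (hPhi x2 x PM.1.ne' hx0.ne'))
    · intro x hx
      have hx' : x ∈ Ioo x1 x4 := ⟨by linarith [hx.1], by linarith [hx.2]⟩
      have := inv_cmp _ _ (hV x hx') (compare_le x (Ioo_subset_Icc_self hx))
      rw [hd x hx']; linarith
  -- left
  have FL : 0 < l x1 → F x2 - F x1 ≤ (x2 - x1) / (l x1 * p2) := by
    intro hl1
    have := incr (F := fun x => (x - x1) / (l x1 * l x) - F x) (F' := fun x => 1 / (l x) ^ 2 - d x)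
      h12.le ?_ ?_ ?_
    · simp only [sub_self, zero_div, zero_sub, l2] at this; linarith
    · intro x hx
      have hx0 := (lpos _ _ hl1 PM.1 x hx)
      exact ((hPhi x1 x hl1.ne' hx0.ne').sub (hF x)).continuousAt.continuousWithinAt
    · intro x hx
      have hx0 := (lpos _ _ hl1 PM.1 x (Ioo_subset_Icc_self hx))
      exact ((hPhi x1 x hl1.ne' hx0.ne').sub (hF x))
    · intro x hx
      have hx' : x ∈ Ioo x1 x4 := ⟨by linarith [hx.1], by linarith [hx.2]⟩
      have hx0 := (lpos _ _ hl1 PM.1 x (Ioo_subset_Icc_self hx))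
      have := inv_cmp _ _ hx0 (compare_l x hx)
      rw [hd x hx']; linarith
  have FR : 0 < l x4 → F x4 - F x3 ≤ (x4 - x3) / (p3 * l x4) := by
    intro hl1
    have := incr (F := fun x => (x - x3) / (l x3 * l x) - F x) (F' := fun x => 1 / (l x) ^ 2 - d x)
      h34.le ?_ ?_ ?_
    · simp only [sub_self, zero_div, zero_sub, l3] at this; linarith
    · intro x hx
      have hx0 := (lpos _ _ PM.2 hl1 x hx)
      exact ((hPhi x3 x PM.2.ne' hx0.ne').sub (hF x)).continuousAt.continuousWithinAt
    · intro x hx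
      have hx0 := (lpos _ _ PM.2 hl1 x (Ioo_subset_Icc_self hx))
      exact ((hPhi x3 x PM.2.ne' hx0.ne').sub (hF x))
    · intro x hx
      have hx' : x ∈ Ioo x1 x4 := ⟨by linarith [hx.1], by linarith [hx.2]⟩
      have hx0 := (lpos _ _ PM.2 hl1 x (Ioo_subset_Icc_self hx))
      have := inv_cmp _ _ hx0 (compare_r x hx)
      rw [hd x hx']; linarith
  have FLp : 0 < F x2 - F x1 := sub_pos.2 (hmono h12)
  have FMp : 0 < F x3 - F x2 := sub_pos.2 (hmono h23)
  have FRp : 0 < F x4 - F x3 := sub_pos.2 (hmono h34)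
  have FM' : x3 - x2 ≤ (F x3 - F x2) * (p2 * p3) := by
    rwa [div_le_iff₀ (by positivity)] at FM
  have KL : (F x2 - F x1) * l x1 * (x3 - x2) ≤ (x2 - x1) * p3 * (F x3 - F x2) := by
    rcases le_or_gt (l x1) 0 with h0 | h0
    · have := mul_nonneg FLp.le hMpos.le
      have : 0 ≤ (x2 - x1) * p3 * (F x3 - F x2) := by
        have : 0 < x2 - x1 := by linarith
        positivity
      nlinarith
    · have := FL h0
      rw [le_div_iff₀ (by positivity)] at this
      have h5 : (F x2 - F x1) * l x1 * p2 * (x3 - x2) ≤ (x2 - x1) * p3 * (F x3 - F x2) * p2 := by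
        calc (F x2 - F x1) * l x1 * p2 * (x3 - x2) = (F x2 - F x1) * (l x1 * p2) * (x3 - x2) := by ring
          _ ≤ (x2 - x1) * ((F x3 - F x2) * (p2 * p3)) :=
            mul_le_mul this FM' hMpos.le (by linarith)
          _ = _ := by ring
      have h6 : (F x2 - F x1) * l x1 * (x3 - x2) * p2 ≤ (x2 - x1) * p3 * (F x3 - F x2) * p2 := by linarith
      exact le_of_mul_le_mul_right h6 P2
  have KR : (F x4 - F x3) * l x4 * (x3 - x2) ≤ (x4 - x3) * p2 * (F x3 - F x2) := by
    rcases le_or_gt (l x4) 0 with h0 | h0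
    · have := mul_nonneg FRp.le hMpos.le
      have : 0 ≤ (x4 - x3) * p2 * (F x3 - F x2) := by
        have : 0 < x4 - x3 := by linarith
        positivity
      nlinarith
    · have := FR h0
      rw [le_div_iff₀ (by positivity)] at this
      have h5 : (F x4 - F x3) * l x4 * p3 * (x3 - x2) ≤ (x4 - x3) * p2 * (F x3 - F x2) * p3 := by
        calc (F x4 - F x3) * l x4 * p3 * (x3 - x2) = (F x4 - F x3) * (p3 * l x4) * (x3 - x2) := by ring
          _ ≤ (x4 - x3) * ((F x3 - F x2) * (p2 * p3)) :=
            mul_le_mul this FM' hMpos.le (by linarith)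
          _ = _ := by ring
      have h6 : (F x4 - F x3) * l x4 * (x3 - x2) * p3 ≤ (x4 - x3) * p2 * (F x3 - F x2) * p3 := by linarith
      exact le_of_mul_le_mul_right h6 P3
  have e1 := lmul x1
  have e4 := lmul x4
  have fin := cr_le_of (A := p3 / p2) (B := p2 / p3) h12 h23 h34 (hmono h12) (hmono h23) (hmono h34)
    (by positivity) ?_ ?_
  · have : p3 / p2 * (p2 / p3) = 1 := by field_simp
    rwa [this, one_mul] at fin
  · have : (F x2 - F x1) * (x3 - x1) * p2 ≤ p3 * (x2 - x1) * (F x3 - F x1) := by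
      have : (F x2 - F x1) * (l x1 * (x3 - x2)) ≤ (x2 - x1) * p3 * (F x3 - F x2) := by linarith
      rw [e1] at this
      linarith
    rw [div_mul_eq_mul_div, div_mul_eq_mul_div, le_div_iff₀ P2]; exact this
  · have : (F x4 - F x3) * (x4 - x2) * p3 ≤ p2 * (x4 - x3) * (F x4 - F x2) := by
      have : (F x4 - F x3) * (l x4 * (x3 - x2)) ≤ (x4 - x3) * p2 * (F x3 - F x2) := by linarith
      rw [e4] at this
      linarith
    rw [div_mul_eq_mul_div, div_mul_eq_mul_div, le_div_iff₀ P3]; exact this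

theorem n1_aux1 {F d : ℝ → ℝ} (hF : ∀ x, HasDerivAt F (d x) x) (hm : StrictMono F) {a b y z C : ℝ}
    (hC : 0 ≤ C) (hy : y ∈ Icc a b) (hzy : z ≤ y) (hd0 : 0 ≤ d y)
    (h : ∀ x ∈ Icc a b, |y - z| ≤ 2 * |x - z| → d y ≤ C * d x) :
    d y * (b - a) ≤ 8 * C * (F b - F a) := by
  have key : ∀ p q, a ≤ p → q ≤ b → (b - a) ≤ 8 * (q - p) → p < q →
      (∀ x ∈ Icc p q, |y - z| ≤ 2 * |x - z|) → d y * (b - a) ≤ 8 * C * (F b - F a) := by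
    intro p q hp hq hl hpq hx
    obtain ⟨t, ht, he⟩ := mvt' hpq (fun x _ => hF x)
    have h1 := h t ⟨by linarith [ht.1], by linarith [ht.2]⟩ (hx t (Ioo_subset_Icc_self ht))
    have h2 : F q - F p ≤ F b - F a := by
      have := hm.monotone hp; have := hm.monotone hq; linarith
    calc d y * (b - a) ≤ d y * (8 * (q - p)) := by gcongr
      _ = 8 * (d y * (q - p)) := by ring
      _ ≤ 8 * ((C * d t) * (q - p)) := by
          have := mul_le_mul_of_nonneg_right h1 (sub_pos.2 hpq).le; linarith
      _ = 8 * C * (F q - F p) := by rw [he]; ring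
      _ ≤ _ := by gcongr
  rcases (hy.1.trans hy.2).lt_or_eq with hab | hab
  swap
  · rw [← hab]; simp
  set ρ := y - z with hρ
  have hρ0 : 0 ≤ ρ := by linarith
  rw [abs_of_nonneg hρ0] at key
  by_cases c1 : b - a ≤ 8 * (b - y)
  · refine key y b hy.1 le_rfl c1 (by linarith) fun x hx => ?_
    rw [abs_of_nonneg (by linarith [hx.1])]; linarith [hx.1]
  by_cases c2 : z + ρ / 2 ≤ a
  · refine key a y le_rfl hy.2 (by linarith) (by linarith) fun x hx => ?_
    rw [abs_of_nonneg (by linarith [hx.1])]; linarith [hx.1]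
  by_cases c3 : b - a ≤ 8 * (ρ / 2)
  · refine key (z + ρ / 2) y (by linarith) hy.2 (by linarith) (by linarith) fun x hx => ?_
    rw [abs_of_nonneg (by linarith [hx.1])]; linarith [hx.1]
  · refine key a (z - ρ / 2) le_rfl (by linarith [hy.2]) (by linarith) (by linarith) fun x hx => ?_
    rw [abs_of_nonpos (by linarith [hx.2])]; linarith [hx.2]

theorem n1_aux2 {F d : ℝ → ℝ} (hF : ∀ x, HasDerivAt F (d x) x) (hm : StrictMono F) {a b y z C : ℝ}
    (hC : 0 ≤ C) (hy : y ∈ Icc a b) (hd0 : 0 ≤ d y)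
    (h : ∀ x ∈ Icc a b, |y - z| ≤ 2 * |x - z| → d y ≤ C * d x) :
    d y * (b - a) ≤ 8 * C * (F b - F a) := by
  rcases le_total z y with hzy | hzy
  · exact n1_aux1 hF hm hC hy hzy hd0 h
  · have := n1_aux1 (F := fun x => - F (-x)) (d := fun x => d (-x)) (a := -b) (b := -a) (y := -y)
      (z := -z) (C := C) (fun x => ?_) (fun x y hxy => ?_) hC ⟨by linarith [hy.2], by linarith [hy.1]⟩
      (by linarith) (by simpa using hd0) ?_
    · simp at this; linarith
    · exact (((hF (-x)).comp x (hasDerivAt_neg x)).neg).congr_deriv (by ring)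
    · simp; exact hm (by linarith)
    · intro x hx hxy
      simp only [neg_neg]
      apply h (-x) ⟨by linarith [hx.2], by linarith [hx.1]⟩
      have e1 : |y - z| = |-y - -z| := by rw [← abs_neg]; congr 1; ring
      have e2 : |-x - z| = |x - -z| := by rw [← abs_neg]; congr 1; ring
      rwa [e1, e2]

namespace Nice
variable (f : Nice)

theorem d1_bdd : ∃ B, 0 < B ∧ ∀ x, f.d1 x ≤ B := by
  obtain ⟨B, hB, h⟩ := periodic_bdd f.cont1 (fun x => by simpa using f.d1_add_int x 1)
  exact ⟨B, hB, fun x => (le_abs_self _).trans (h x)⟩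

theorem d2_bdd : ∃ B, 0 < B ∧ ∀ x, |f.d2 x| ≤ B :=
  periodic_bdd f.cont2 (fun x => by simpa using f.d2_add_int x 1)

theorem d3_bdd : ∃ B, 0 < B ∧ ∀ x, |f.d3 x| ≤ B :=
  periodic_bdd f.cont3 (fun x => by simpa using f.d3_add_int x 1)

theorem crit_add_int {z : ℝ} (h : f.d1 z = 0) (k : ℤ) : f.d1 (z + k) = 0 := by
  rw [d1_add_int]; exact h

theorem d1_low {r : ℝ} (hr : 0 < r) : ∃ m, 0 < m ∧ ∀ x, (∀ z, f.d1 z = 0 → r ≤ |x - z|) → m ≤ f.d1 x := by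
  let S : Set ℝ := Icc 0 1 ∩ ⋂ z ∈ {z | f.d1 z = 0}, {x | r ≤ |x - z|}
  have hS : IsCompact S := by
    refine isCompact_Icc.inter_right (isClosed_biInter fun z _ => ?_)
    exact isClosed_le continuous_const (by fun_prop)
  have hred : ∀ x, (∀ z, f.d1 z = 0 → r ≤ |x - z|) → ∃ y ∈ S, f.d1 x = f.d1 y := by
    intro x hx
    refine ⟨Int.fract x, ⟨⟨Int.fract_nonneg x, (Int.fract_lt_one x).le⟩, ?_⟩, ?_⟩
    · simp only [mem_iInter, mem_ofPred_eq]
      intro z hz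
      have := hx (z + (⌊x⌋ : ℤ)) (f.crit_add_int hz _)
      have e : Int.fract x - z = x - (z + (⌊x⌋ : ℤ)) := by rw [Int.fract]; ring
      rwa [e]
    · conv_lhs => rw [← Int.fract_add_floor x, d1_add_int]
  rcases S.eq_empty_or_nonempty with he | hne
  · refine ⟨1, one_pos, fun x hx => ?_⟩
    obtain ⟨y, hy, -⟩ := hred x hx
    rw [he] at hy; exact absurd hy (notMem_empty y)
  · obtain ⟨y0, hy0, hmin⟩ := hS.exists_isMinOn hne f.cont1.continuousOn
    refine ⟨f.d1 y0, f.d1_pos ?_, fun x hx => ?_⟩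
    · intro h0
      have := hy0.2
      simp only [mem_iInter, mem_ofPred_eq] at this
      have := this y0 h0
      simp at this; linarith
    · obtain ⟨y, hy, e⟩ := hred x hx
      rw [e]; exact hmin hy

theorem long_low {h : ℝ} (hh : 0 < h) : ∃ m, 0 < m ∧ ∀ a b, h ≤ b - a → m * (b - a) ≤ f.F b - f.F a := by
  obtain ⟨m, hm, hlow⟩ := periodic_pos (u := fun x => f.F (x + h) - f.F x)
    ((f.contF.comp (by fun_prop)).sub f.contF)
    (fun x => by
      have : x + 1 + h = (x + h) + 1 := by ring
      rw [this, f.deg1, f.deg1]; ring)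
    (fun x => sub_pos.2 (f.mono (by linarith)))
  have ind : ∀ (n : ℕ) a, f.F a + n * m ≤ f.F (a + n * h) := by
    intro n a
    induction n with
    | zero => simp
    | succ n ih =>
      have := hlow (a + n * h)
      have e : a + ((n + 1 : ℕ) : ℝ) * h = a + n * h + h := by push_cast; ring
      rw [e]; push_cast; linarith
  refine ⟨m / (2 * h), by positivity, fun a b hab => ?_⟩
  set n := ⌊(b - a) / h⌋₊ with hn
  have h1 : (1 : ℝ) ≤ (b - a) / h := by rwa [le_div_iff₀ hh, one_mul]
  have h2 : 1 ≤ n := Nat.le_floor (by simpa using h1)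
  have h3 : (n : ℝ) ≤ (b - a) / h := Nat.floor_le (by linarith)
  have h4 : (b - a) / h < n + 1 := Nat.lt_floor_add_one _
  have h5 : (1 : ℝ) ≤ n := by exact_mod_cast h2
  have h6 : a + n * h ≤ b := by rw [le_div_iff₀ hh] at h3; linarith
  have h7 := ind n a
  have h8 := f.mono.monotone h6
  have h9 : (b - a) / h ≤ 2 * n := by linarith
  calc m / (2 * h) * (b - a) = m / 2 * ((b - a) / h) := by field_simp
    _ ≤ m / 2 * (2 * n) := by gcongr
    _ = n * m := by ring
    _ ≤ _ := by linarith

theorem N1 : ∃ C, 1 ≤ C ∧ ∀ a b y, y ∈ Icc a b → f.d1 y * (b - a) ≤ C * (f.F b - f.F a) := by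
  obtain ⟨r, C, σ, hr, -, hC, hσ, hU⟩ := f.unif
  obtain ⟨B, hB, hB1⟩ := f.d1_bdd
  obtain ⟨m0, hm0, hlow⟩ := f.d1_low (r := r / 4) (by positivity)
  obtain ⟨m1, hm1, hlong⟩ := f.long_low (h := r / 4) (by positivity)
  have hmon : ∀ a b y, y ∈ Icc a b → 0 ≤ f.F b - f.F a := fun a b y hy =>
    sub_nonneg.2 (f.mono.monotone (hy.1.trans hy.2))
  refine ⟨8 * C + B / m0 + B / m1, ?_, fun a b y hy => ?_⟩
  · have : 0 < B / m0 := by positivity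
    have : 0 < B / m1 := by positivity
    linarith
  have hab : 0 ≤ b - a := by linarith [hy.1, hy.2]
  have hFab := hmon a b y hy
  have q0 : 0 ≤ 8 * C * (f.F b - f.F a) := by positivity
  have q1 : 0 ≤ B / m0 * (f.F b - f.F a) := by positivity
  have q2 : 0 ≤ B / m1 * (f.F b - f.F a) := by positivity
  have d0 := f.d1_nonneg y
  have fin : ∀ m, 0 < m → m * (b - a) ≤ f.F b - f.F a →
      f.d1 y * (b - a) ≤ B / m * (f.F b - f.F a) := by
    intro m hm h
    calc f.d1 y * (b - a) ≤ B * (b - a) := by gcongr; exact hB1 y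
      _ = B / m * (m * (b - a)) := by field_simp
      _ ≤ _ := by gcongr
  rcases le_or_gt (r / 4) (b - a) with hl | hl
  · have := fin m1 hm1 (hlong a b hl); linarith
  by_cases hz : ∃ z, f.d1 z = 0 ∧ |y - z| < r / 2
  · obtain ⟨z, hz, hyz⟩ := hz
    have := n1_aux2 f.hF f.mono (C := C) (z := z) (by linarith) hy d0 ?_
    · linarith
    · intro x hx hxy
      refine (hU z hz x ?_).2.1 y (by linarith) hxy
      rw [abs_lt] at hyz ⊢
      constructor <;> linarith [hx.1, hx.2, hy.1, hy.2]
  · push Not at hz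
    have := fin m0 hm0 ?_
    · linarith
    rcases hab.lt_or_eq with hab | hab
    swap
    · rw [← hab]; simpa using hFab
    obtain ⟨t, ht, he⟩ := mvt' (a := a) (b := b) (by linarith) (fun x _ => f.hF x)
    rw [he]; gcongr
    refine hlow t fun z hz' => ?_
    have h3 := hz z hz'
    have h4 : |y - z| ≤ |y - t| + |t - z| := abs_sub_le _ _ _
    have h5 : |y - t| ≤ b - a := by
      rw [abs_le]; constructor <;> linarith [ht.1, ht.2, hy.1, hy.2]
    linarith

/-! The function `V = (F')^{-1/2}`. -/

def V (x : ℝ) : ℝ := (√(f.d1 x))⁻¹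
def V1 (x : ℝ) : ℝ := -(1 / 2) * f.d2 x * (f.V x) ^ 3
def Ksch (x : ℝ) : ℝ := -(1 / 2) * f.d3 x * (f.V x) ^ 2 + 3 / 4 * (f.d2 x) ^ 2 * (f.V x) ^ 4

theorem V_pos {x : ℝ} (h : f.d1 x ≠ 0) : 0 < f.V x :=
  inv_pos.2 (Real.sqrt_pos.2 (f.d1_pos h))

theorem V_sq (x : ℝ) : (f.V x) ^ 2 = (f.d1 x)⁻¹ := by
  rw [V, inv_pow, Real.sq_sqrt (f.d1_nonneg x)]

theorem hV {x : ℝ} (h : f.d1 x ≠ 0) : HasDerivAt f.V (f.V1 x) x := by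
  have h1 := ((f.hd1 x).sqrt h).inv (Real.sqrt_pos.2 (f.d1_pos h)).ne'
  refine h1.congr_deriv ?_
  have hs : 0 < √(f.d1 x) := Real.sqrt_pos.2 (f.d1_pos h)
  rw [V1, V]
  field_simp

theorem hV1 {x : ℝ} (h : f.d1 x ≠ 0) : HasDerivAt f.V1 (f.Ksch x * f.V x) x := by
  have h1 := ((f.hd2 x).const_mul (-(1 / 2))).mul ((f.hV h).pow 3)
  refine h1.congr_deriv ?_
  simp only [Ksch, V1, Pi.pow_apply]
  push_cast
  ring

theorem Ksch_nonneg {x : ℝ} (h : f.d1 x ≠ 0) (hS : 2 * f.d3 x * f.d1 x < 3 * (f.d2 x) ^ 2) :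
    0 ≤ f.Ksch x := by
  have hp := f.d1_pos h
  have e : f.Ksch x = (3 * (f.d2 x) ^ 2 - 2 * f.d3 x * f.d1 x) / (4 * (f.d1 x) ^ 2) := by
    have : f.V x ^ 4 = (f.V x ^ 2) ^ 2 := by ring
    rw [Ksch, this, V_sq]; field_simp; ring
  rw [e]
  apply div_nonneg <;> [linarith; positivity]

theorem Ksch_low : ∃ C, 0 < C ∧ ∀ x, f.d1 x ≠ 0 → -C ≤ f.Ksch x := by
  obtain ⟨r, C, σ, hr, -, hC, hσ, hU⟩ := f.unif
  obtain ⟨B, hB, hB1⟩ := f.d3_bdd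
  obtain ⟨m0, hm0, hlow⟩ := f.d1_low hr
  refine ⟨B / m0, by positivity, fun x hx => ?_⟩
  by_cases hz : ∃ z, f.d1 z = 0 ∧ |x - z| < r
  · obtain ⟨z, hz, hxz⟩ := hz
    have hne : x ≠ z := by rintro rfl; exact hx hz
    have := f.Ksch_nonneg hx ((hU z hz x hxz).1 hne).2
    have : 0 < B / m0 := by positivity
    linarith
  · push Not at hz
    have h1 := hlow x hz
    have h2 : 0 ≤ 3 / 4 * (f.d2 x) ^ 2 * (f.V x) ^ 4 := by positivity
    have h3 : f.d3 x * f.V x ^ 2 ≤ B / m0 := by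
      rw [V_sq, div_eq_mul_inv]
      have := (le_abs_self _).trans (hB1 x)
      have hp := f.d1_pos hx
      calc f.d3 x * (f.d1 x)⁻¹ ≤ B * (f.d1 x)⁻¹ := by gcongr
        _ ≤ _ := by gcongr
    have : 0 < B / m0 := by positivity
    rw [Ksch]; linarith

end Nice

namespace Nice
variable (f : Nice)

/-- Mass function: length plus number of critical points. -/
def M (x : ℝ) : ℝ := x + ∑ i, (⌈x - f.c i⌉ : ℝ)

theorem M_add_int (x : ℝ) (k : ℤ) : f.M (x + k) = f.M x + k * (1 + f.N) := by
  have : ∀ i, (⌈x + k - f.c i⌉ : ℝ) = ⌈x - f.c i⌉ + k := by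
    intro i
    have : x + k - f.c i = (x - f.c i) + k := by ring
    rw [this, Int.ceil_add_intCast]; push_cast; ring
  simp only [M, this, Finset.sum_add_distrib, Finset.sum_const, Finset.card_univ, Fintype.card_fin,
    nsmul_eq_mul]
  ring

theorem M_sub_le {a b : ℝ} (h : a ≤ b) : b - a ≤ f.M b - f.M a := by
  have : ∑ i, (⌈a - f.c i⌉ : ℝ) ≤ ∑ i, (⌈b - f.c i⌉ : ℝ) := by
    apply Finset.sum_le_sum; intro i _
    exact_mod_cast Int.ceil_mono (by linarith)
  simp only [M]; linarith

theorem M_mono : Monotone f.M := fun a b h => by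
  have := f.M_sub_le h; linarith

theorem M_crit {a b z : ℝ} (hz : f.d1 z = 0) (ha : a ≤ z) (hb : z < b) : 1 ≤ f.M b - f.M a := by
  obtain ⟨i, k, rfl⟩ := (f.crit z).1 hz
  have h1 : ∀ j ∈ Finset.univ, j ≠ i → (0 : ℝ) ≤ (⌈b - f.c j⌉ : ℝ) - ⌈a - f.c j⌉ := by
    intro j _ _
    have : ⌈a - f.c j⌉ ≤ ⌈b - f.c j⌉ := Int.ceil_mono (by linarith)
    have : (⌈a - f.c j⌉ : ℝ) ≤ ⌈b - f.c j⌉ := by exact_mod_cast this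
    linarith
  have h2 : ⌈a - f.c i⌉ ≤ k := Int.ceil_le.2 (by linarith)
  have h3 : k < ⌈b - f.c i⌉ := Int.lt_ceil.2 (by linarith)
  have h4 : (1 : ℝ) ≤ (⌈b - f.c i⌉ : ℝ) - ⌈a - f.c i⌉ := by
    have : (⌈a - f.c i⌉ : ℤ) + 1 ≤ ⌈b - f.c i⌉ := by omega
    have : ((⌈a - f.c i⌉ : ℤ) : ℝ) + 1 ≤ ⌈b - f.c i⌉ := by exact_mod_cast this
    linarith
  have h5 : (⌈b - f.c i⌉ : ℝ) - ⌈a - f.c i⌉ ≤ ∑ j, ((⌈b - f.c j⌉ : ℝ) - ⌈a - f.c j⌉) := by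
    apply Finset.single_le_sum (f := fun j => (⌈b - f.c j⌉ : ℝ) - ⌈a - f.c j⌉) _ (Finset.mem_univ i)
    intro j hj
    by_cases hji : j = i
    · subst hji; linarith
    · exact h1 j hj hji
  rw [Finset.sum_sub_distrib] at h5
  simp only [M]; linarith

def mass (k : ℕ) (a b : ℝ) : ℝ := ∑ i ∈ Finset.range k, (f.M (f.F^[i] b) - f.M (f.F^[i] a))

theorem mass_nonneg (k : ℕ) {a b : ℝ} (h : a ≤ b) : 0 ≤ f.mass k a b := by
  apply Finset.sum_nonneg; intro i _
  exact sub_nonneg.2 (f.M_mono ((f.iter_strictMono i).monotone h))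

theorem mass_add (k : ℕ) (a b c : ℝ) : f.mass k a b + f.mass k b c = f.mass k a c := by
  simp only [mass, ← Finset.sum_add_distrib]
  apply Finset.sum_congr rfl; intro i _; ring

theorem mass_subset (k : ℕ) {a b a' b' : ℝ} (ha : a ≤ a') (hb : b' ≤ b) :
    f.mass k a' b' ≤ f.mass k a b := by
  apply Finset.sum_le_sum; intro i _
  have := f.M_mono ((f.iter_strictMono i).monotone ha)
  have := f.M_mono ((f.iter_strictMono i).monotone hb)
  linarith

theorem mass_split (k l : ℕ) (a b : ℝ) :
    f.mass (k + l) a b = f.mass k a b + f.mass l (f.F^[k] a) (f.F^[k] b) := by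
  simp only [mass, Finset.sum_range_add, ← Function.iterate_add_apply, add_comm]

theorem mass_mono_k {k l : ℕ} (h : k ≤ l) {a b : ℝ} (hab : a ≤ b) : f.mass k a b ≤ f.mass l a b := by
  obtain ⟨m, rfl⟩ := Nat.exists_eq_add_of_le h
  rw [mass_split]
  have := f.mass_nonneg m ((f.iter_strictMono k).monotone hab)
  linarith

theorem mass_shift (k : ℕ) (a b : ℝ) (p : ℤ) : f.mass k (a + p) (b + p) = f.mass k a b := by
  apply Finset.sum_congr rfl; intro i _
  simp only [iter_eq_T, T_add_int, M_add_int]; ring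

theorem CR1 : ∃ C, 0 ≤ C ∧ ∀ x1 x2 x3 x4, x1 < x2 → x2 < x3 → x3 < x4 →
    cr (f.F x1) (f.F x2) (f.F x3) (f.F x4) ≤ Real.exp (C * (f.M x4 - f.M x1)) * cr x1 x2 x3 x4 := by
  obtain ⟨r, C, σ, hr, hr1, hC, hσ, hU⟩ := f.unif
  obtain ⟨m0, hm0, hlow⟩ := f.d1_low (r := r / 4) (by positivity)
  obtain ⟨C0, hC0, hN1⟩ := f.N1
  obtain ⟨B, hB, hB1⟩ := f.d2_bdd
  refine ⟨2 * C0 / (r / 4) + 2 * (B / m0), by positivity, fun x1 x2 x3 x4 h12 h23 h34 => ?_⟩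
  have hM := f.M_sub_le (a := x1) (b := x4) (by linarith)
  have hM0 : 0 < f.M x4 - f.M x1 := by linarith
  have hcr := cr_pos h12 h23 h34
  have distor : ∀ A : ℝ, 0 ≤ A → (∀ a b y, x1 ≤ a → b ≤ x4 → y ∈ Icc a b → f.d1 y * (b - a) ≤
      Real.exp A * (f.F b - f.F a)) → 
      2 * A ≤ (2 * C0 / (r / 4) + 2 * (B / m0)) * (f.M x4 - f.M x1) → 
      cr (f.F x1) (f.F x2) (f.F x3) (f.F x4) ≤
        Real.exp ((2 * C0 / (r / 4) + 2 * (B / m0)) * (f.M x4 - f.M x1)) * cr x1 x2 x3 x4 := by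
    intro A hA h hexp
    have key := cr_le_of (A := Real.exp A) (B := Real.exp A) h12 h23 h34 (f.mono h12) (f.mono h23)
      (f.mono h34) (Real.exp_pos _).le ?_ ?_
    · refine key.trans ?_
      rw [← Real.exp_add]
      gcongr; linarith
    · obtain ⟨p, hp, he⟩ := mvt' h12 (fun x _ => f.hF x)
      have := h x1 x3 p le_rfl h34.le ⟨hp.1.le, by linarith [hp.2]⟩
      have h3 : 0 < x2 - x1 := by linarith
      rw [he]
      have := mul_le_mul_of_nonneg_right this h3.le
      linarith
    · obtain ⟨p, hp, he⟩ := mvt' h34 (fun x _ => f.hF x)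
      have := h x2 x4 p h12.le le_rfl ⟨by linarith [hp.1], hp.2.le⟩
      have h3 : 0 < x4 - x3 := by linarith
      rw [he]
      have := mul_le_mul_of_nonneg_right this h3.le
      linarith
  have caseA : r / 4 ≤ f.M x4 - f.M x1 → cr (f.F x1) (f.F x2) (f.F x3) (f.F x4) ≤
        Real.exp ((2 * C0 / (r / 4) + 2 * (B / m0)) * (f.M x4 - f.M x1)) * cr x1 x2 x3 x4 := by
    intro h
    refine distor C0 (by linarith) (fun a b y _ _ hy => ?_) ?_
    · refine (hN1 a b y hy).trans ?_
      have h3 : 0 ≤ f.F b - f.F a := sub_nonneg.2 (f.mono.monotone (hy.1.trans hy.2))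
      have := Real.add_one_le_exp C0
      gcongr; linarith
    · have h1 : 2 * C0 / (r / 4) * (r / 4) = 2 * C0 := by field_simp
      have h2 : 2 * C0 / (r / 4) * (r / 4) ≤ 2 * C0 / (r / 4) * (f.M x4 - f.M x1) := by gcongr
      have h3 : 0 ≤ 2 * (B / m0) * (f.M x4 - f.M x1) := by positivity
      linarith
  rcases le_or_gt (r / 4) (f.M x4 - f.M x1) with h | h
  · exact caseA h
  by_cases hz : ∃ z, f.d1 z = 0 ∧ |x1 - z| < r / 2
  · obtain ⟨z, hz, hxz⟩ := hz
    have hreg : ∀ x ∈ Ioo x1 x4, x ≠ z ∧ |x - z| < r := by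
      intro x hx
      refine ⟨?_, ?_⟩
      · rintro rfl
        have := f.M_crit hz hx.1.le hx.2
        linarith
      · rw [abs_lt] at hxz ⊢
        constructor <;> linarith [hx.1, hx.2]
    have hne : ∀ x ∈ Ioo x1 x4, f.d1 x ≠ 0 := fun x hx =>
      (((hU z hz x (hreg x hx).2).1 (hreg x hx).1).1).ne'
    have := chord_cr (V := f.V) (V1 := f.V1) (V2 := fun x => f.Ksch x * f.V x) h12 h23 h34 f.hF f.mono
      (fun x hx => by rw [V_sq]; simp) (fun x hx => f.V_pos (hne x hx)) (fun x hx => f.hV (hne x hx))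
      (fun x hx => f.hV1 (hne x hx)) (fun x hx => mul_nonneg (f.Ksch_nonneg (hne x hx)
        ((hU z hz x (hreg x hx).2).1 (hreg x hx).1).2) (f.V_pos (hne x hx)).le)
    refine this.trans (le_mul_of_one_le_left hcr.le (Real.one_le_exp (by positivity)))
  · push Not at hz
    have hd : ∀ x ∈ Icc x1 x4, m0 ≤ f.d1 x := by
      intro x hx
      refine hlow x fun z hz' => ?_
      have h3 := hz z hz'
      have h4 : |x1 - z| ≤ |x1 - x| + |x - z| := abs_sub_le _ _ _
      have h5 : |x1 - x| ≤ x4 - x1 := by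
        rw [abs_le]; constructor <;> linarith [hx.1, hx.2]
      linarith
    have hlip : ∀ p q, p ∈ Icc x1 x4 → q ∈ Icc x1 x4 → f.d1 p - f.d1 q ≤ B * (x4 - x1) := by
      intro p q hp hq
      have h5 : |p - q| ≤ x4 - x1 := by
        rw [abs_le]; constructor <;> linarith [hp.1, hp.2, hq.1, hq.2]
      have := Convex.norm_image_sub_le_of_norm_hasDerivWithin_le (f := f.d1) (f' := f.d2) (s := univ) (C := B)
        (x := q) (y := p)
        (fun x _ => (f.hd1 x).hasDerivWithinAt) (fun x _ => hB1 x) convex_univ (mem_univ _) (mem_univ _)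
      rw [Real.norm_eq_abs, Real.norm_eq_abs] at this
      calc _ ≤ |f.d1 p - f.d1 q| := le_abs_self _
        _ ≤ B * |p - q| := this
        _ ≤ _ := by gcongr
    refine distor (B / m0 * (x4 - x1)) (by have : 0 < x4 - x1 := by linarith
                                           positivity) (fun a b y ha hb hy => ?_) ?_
    · rcases (hy.1.trans hy.2).lt_or_eq with hab | hab
      swap
      · rw [← hab]; simp
      obtain ⟨t, ht, he⟩ := mvt' hab (fun x _ => f.hF x)
      have ht' : t ∈ Icc x1 x4 := ⟨by linarith [ht.1], by linarith [ht.2]⟩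
      have h1 := hlip y t ⟨by linarith [hy.1], by linarith [hy.2]⟩ ht'
      have h2 := hd t ht'
      have h3 : f.d1 y ≤ Real.exp (B / m0 * (x4 - x1)) * f.d1 t := by
        have h4 := Real.add_one_le_exp (B / m0 * (x4 - x1))
        have h5 : B * (x4 - x1) ≤ B / m0 * (x4 - x1) * f.d1 t := by
          calc B * (x4 - x1) = B / m0 * (x4 - x1) * m0 := by field_simp
            _ ≤ _ := by have : 0 < x4 - x1 := by linarith
                        gcongr
        have h6 := mul_le_mul_of_nonneg_right h4 (hm0.le.trans h2)
        linarith
      rw [he, ← mul_assoc]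
      gcongr
    · have h1 : B / m0 * (x4 - x1) ≤ B / m0 * (f.M x4 - f.M x1) := by gcongr
      have h2 : 0 ≤ 2 * C0 / (r / 4) * (f.M x4 - f.M x1) := by positivity
      linarith

theorem CRk : ∃ C, 0 ≤ C ∧ ∀ (k : ℕ) x1 x2 x3 x4, x1 < x2 → x2 < x3 → x3 < x4 →
    cr (f.F^[k] x1) (f.F^[k] x2) (f.F^[k] x3) (f.F^[k] x4) ≤
      Real.exp (C * f.mass k x1 x4) * cr x1 x2 x3 x4 := by
  obtain ⟨C, hC, h⟩ := f.CR1
  refine ⟨C, hC, fun k x1 x2 x3 x4 h12 h23 h34 => ?_⟩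
  induction k with
  | zero => simp [mass]
  | succ k ih =>
    simp only [Function.iterate_succ_apply']
    refine (h _ _ _ _ (f.iter_strictMono k h12) (f.iter_strictMono k h23) (f.iter_strictMono k h34)).trans ?_
    have : f.mass (k + 1) x1 x4 = f.mass k x1 x4 + (f.M (f.F^[k] x4) - f.M (f.F^[k] x1)) := by
      rw [mass, Finset.sum_range_succ]; rfl
    rw [this, mul_add, Real.exp_add]
    calc _ ≤ Real.exp (C * (f.M (f.F^[k] x4) - f.M (f.F^[k] x1))) *
          (Real.exp (C * f.mass k x1 x4) * cr x1 x2 x3 x4) := by gcongr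
      _ = _ := by ring

/-- Disjoint intervals have bounded total mass. -/
theorem sum_disj (S : Finset ℕ) (a b : ℕ → ℝ) (y : ℝ) (hab : ∀ i ∈ S, a i < b i)
    (hy : ∀ i ∈ S, y ≤ a i) (hd : ∀ i ∈ S, ∀ j ∈ S, i ≠ j → b i ≤ a j ∨ b j ≤ a i) :
    ∀ Y, y ≤ Y → (∀ i ∈ S, b i ≤ Y) → ∑ i ∈ S, (f.M (b i) - f.M (a i)) ≤ f.M Y - f.M y := by
  induction S using Finset.induction_on_max_value a with
  | empty => intro Y hY _; simpa using f.M_mono hY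
  | insert i S hi hmax ih =>
    intro Y hY hb
    rw [Finset.sum_insert hi]
    have h1 := ih (fun j hj => hab j (Finset.mem_insert_of_mem hj))
      (fun j hj => hy j (Finset.mem_insert_of_mem hj))
      (fun j hj k hk => hd j (Finset.mem_insert_of_mem hj) k (Finset.mem_insert_of_mem hk)) (a i)
      (hy i (Finset.mem_insert_self i S)) ?_
    · have := f.M_mono (hb i (Finset.mem_insert_self i S)); linarith
    · intro j hj
      have hne : j ≠ i := by rintro rfl; exact hi hj
      rcases hd j (Finset.mem_insert_of_mem hj) i (Finset.mem_insert_self i S) hne with h | h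
      · exact h
      · have := hab i (Finset.mem_insert_self i S)
        have := hmax j hj
        linarith

theorem massBound {v : ℤ × ℤ} (hv : 0 < f.val v) (hv1 : f.val v ≤ 1) (k : ℕ)
    (hsep : ∀ Q P : ℤ, 0 < Q → Q < k → f.val v ≤ |f.val (Q, P)|) (x : ℝ) :
    f.mass k x (f.T v x) ≤ 1 + f.N := by
  set p : ℕ → ℤ := fun i => ⌊f.F^[i] x - x⌋ with hp
  set a : ℕ → ℝ := fun i => f.T ((i : ℤ), p i) x with ha
  set b : ℕ → ℝ := fun i => f.T (((i : ℤ), p i) + v) x with hb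
  have e : f.mass k x (f.T v x) = ∑ i ∈ Finset.range k, (f.M (b i) - f.M (a i)) := by
    apply Finset.sum_congr rfl; intro i _
    have e1 : a i = f.F^[i] x + ((-p i : ℤ) : ℝ) := by simp only [ha, T_nat]; push_cast; ring
    have e2 : b i = f.F^[i] (f.T v x) + ((-p i : ℤ) : ℝ) := by
      simp only [hb, T_add, T_nat]; push_cast; ring
    rw [e1, e2, M_add_int, M_add_int]; ring
  have hx1 : x + 1 = f.T (0, -1) x := by rw [T_int]; push_cast; ring
  have key := f.sum_disj (Finset.range k) a b x ?_ ?_ ?_ (x + 1) (by linarith) ?_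
  · rw [e]
    have := f.M_add_int x 1
    push_cast at this
    rw [this] at key
    linarith
  · intro i _
    simp only [ha, hb]
    apply T_mono_val; rw [val_add]; linarith
  · intro i _
    simp only [ha, T_nat, hp]
    have := Int.floor_le (f.F^[i] x - x); linarith
  · have wlog : ∀ i ∈ Finset.range k, ∀ j ∈ Finset.range k, i < j → b i ≤ a j ∨ b j ≤ a i := by
      intro i _ j hj hij
      have hj' := Finset.mem_range.1 hj
      have h := hsep ((j : ℤ) - i) (p j - p i) (by omega) (by omega)
      have e1 : f.val ((j : ℤ) - i, p j - p i) = f.val ((j : ℤ), p j) - f.val ((i : ℤ), p i) := by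
        rw [← val_sub]; rfl
      rw [e1] at h
      rcases le_abs'.1 h with h | h
      · right; apply T_mono_val_le; rw [val_add]; linarith
      · left; apply T_mono_val_le; rw [val_add]; linarith
    intro i hi j hj hij
    rcases lt_or_gt_of_ne hij with h | h
    · exact wlog i hi j hj h
    · exact (wlog j hj i hi h).symm
  · intro i hi
    rcases Nat.eq_zero_or_pos i with rfl | hpos
    · have e0 : p 0 = 0 := by simp [hp]
      simp only [hb, e0, hx1]
      apply T_mono_val_le
      simp [val] at hv1 ⊢; linarith
    · have hi' := Finset.mem_range.1 hi
      have h := hsep i (p i + 1) (by omega) (by omega)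
      have h1 : a i < f.T (0, -1) x := by
        rw [← hx1]; simp only [ha, T_nat, hp]
        have := Int.lt_floor_add_one (f.F^[i] x - x); linarith
      have h2 := f.T_val_lt h1
      simp only [hb, hx1]
      apply T_mono_val_le
      rw [val_add]
      simp only [val] at h h2 ⊢
      push_cast at h h2 ⊢
      rw [abs_of_nonpos (by linarith)] at h
      linarith

end Nice

theorem cr_sub (a b c d p : ℝ) : cr (a - p) (b - p) (c - p) (d - p) = cr a b c d := by
  simp [cr]

theorem cr_low {a b c d κ : ℝ} (hab : a < b) (hbc : b < c) (hcd : c < d) (hκ : 0 ≤ κ)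
    (h : κ ≤ cr a b c d) : κ * (c - a) ≤ b - a ∧ κ * (d - b) ≤ d - c := by
  have h1 : 0 < c - a := by linarith
  have h2 : 0 < d - b := by linarith
  rw [cr, le_div_iff₀ (by positivity)] at h
  constructor
  · have : κ * (c - a) * (d - b) ≤ (b - a) * (d - b) := by nlinarith
    exact le_of_mul_le_mul_right this h2
  · have : κ * (d - b) * (c - a) ≤ (d - c) * (c - a) := by nlinarith
    exact le_of_mul_le_mul_right this h1

theorem cr_ge {a b c d α β : ℝ} (hab : a < b) (hbc : b < c) (hcd : c < d) (hα : 0 ≤ α) (hβ : 0 ≤ β)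
    (h1 : α * (c - a) ≤ b - a) (h2 : β * (d - b) ≤ d - c) : α * β ≤ cr a b c d := by
  have h3 : 0 < c - a := by linarith
  have h4 : 0 < d - b := by linarith
  rw [cr, le_div_iff₀ (by positivity)]
  have := mul_le_mul h1 h2 (by positivity) (by linarith)
  linarith

/-- Two consecutive closest returns, the longer one to the right. -/
structure Level (f : Nice) where
  v : ℤ × ℤ
  w : ℤ × ℤ
  hv : 0 < f.val v
  hv1 : f.val v ≤ 1
  hw : f.val w < 0
  hlt : 0 < f.val v + f.val w
  q0 : 0 ≤ v.1
  qle : v.1 ≤ w.1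
  w1 : 1 ≤ w.1
  det : v.1 * w.2 - v.2 * w.1 = 1 ∨ v.1 * w.2 - v.2 * w.1 = -1

namespace Level
variable {f : Nice} (L : Level f)

theorem decomp (u : ℤ × ℤ) : ∃ i j : ℤ, u = i • L.v + j • L.w := by
  rcases L.det with h | h
  · refine ⟨u.1 * L.w.2 - u.2 * L.w.1, L.v.1 * u.2 - L.v.2 * u.1, Prod.ext ?_ ?_⟩
    · simp; linear_combination (-u.1) * h
    · simp; linear_combination (-u.2) * h
  · refine ⟨-(u.1 * L.w.2 - u.2 * L.w.1), -(L.v.1 * u.2 - L.v.2 * u.1), Prod.ext ?_ ?_⟩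
    · simp; linear_combination (u.1) * h
    · simp; linear_combination (u.2) * h

theorem sep {Q P : ℤ} (h0 : 0 < Q) (h1 : Q < L.w.1) : f.val L.v ≤ |f.val (Q, P)| := by
  obtain ⟨i, j, h⟩ := L.decomp (Q, P)
  have hQ : Q = i * L.v.1 + j * L.w.1 := by
    have := congrArg Prod.fst h; simpa using this
  have hval : f.val (Q, P) = i * f.val L.v + j * f.val L.w := by
    rw [h, f.val_add, f.val_zsmul, f.val_zsmul]
  have hv := L.hv
  have hw := L.hw
  have q0 := L.q0
  have w1 := L.w1
  rw [hval]
  rcases lt_trichotomy i 0 with hi | hi | hi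
  · have hj : 0 ≤ j := by
      by_contra hj; push Not at hj
      nlinarith
    have h2 : (i : ℝ) ≤ -1 := by exact_mod_cast (by omega : i ≤ -1)
    have h3 : (0 : ℝ) ≤ j := by exact_mod_cast hj
    rw [le_abs']; left; nlinarith
  · exfalso
    subst hi
    simp at hQ
    rcases lt_trichotomy j 0 with hj | hj | hj
    · nlinarith
    · subst hj; simp at hQ; omega
    · nlinarith
  · have hj : j ≤ 0 := by
      by_contra hj; push Not at hj
      nlinarith
    have h2 : (1 : ℝ) ≤ i := by exact_mod_cast hi
    have h3 : (j : ℝ) ≤ 0 := by exact_mod_cast hj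
    rw [le_abs']; right; nlinarith

def q : ℕ := L.w.1.toNat
theorem q_cast : (L.q : ℤ) = L.w.1 := Int.toNat_of_nonneg (by have := L.w1; omega)

theorem mass_one (x : ℝ) : f.mass L.q x (f.T L.v x) ≤ 1 + f.N :=
  f.massBound L.hv L.hv1 L.q (fun Q P h0 h1 => L.sep h0 (by rw [← L.q_cast]; exact h1)) x

theorem mass_J (J : ℕ) (x : ℝ) : f.mass L.q x (f.T (J • L.v) x) ≤ J * (1 + f.N) := by
  induction J with
  | zero => simp [Nice.mass]
  | succ J ih =>
    have h1 := L.mass_one (f.T (J • L.v) x)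
    rw [← f.T_add, add_comm, ← succ_nsmul] at h1
    rw [← f.mass_add _ x (f.T (J • L.v) x)]
    push_cast; linarith

theorem mass_KJ (K J : ℕ) (x : ℝ) : f.mass (K * L.q) x (f.T (J • L.v) x) ≤ K * (J * (1 + f.N)) := by
  induction K with
  | zero => simp [Nice.mass]
  | succ K ih =>
    have h1 := L.mass_J J (f.F^[K * L.q] x)
    rw [add_mul, one_mul, f.mass_split, f.iter_T]
    push_cast; linarith

end Level

namespace Nice
variable (f : Nice)

/-- Cross-ratio control for the action within a level. -/
theorem crT : ∃ C, 0 ≤ C ∧ ∀ (L : Level f) (K J : ℕ) (i p : ℤ), 0 ≤ i → i ≤ K * L.w.1 →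
    ∀ x1 x2 x3 x4, x1 < x2 → x2 < x3 → x3 < x4 → x4 ≤ f.T (J • L.v) x1 →
    cr (f.T (i, p) x1) (f.T (i, p) x2) (f.T (i, p) x3) (f.T (i, p) x4) ≤
      Real.exp (C * (K * J)) * cr x1 x2 x3 x4 := by
  obtain ⟨C, hC, h⟩ := f.CRk
  refine ⟨C * (1 + f.N), by positivity, fun L K J i p hi hiK x1 x2 x3 x4 h12 h23 h34 h4 => ?_⟩
  lift i to ℕ using hi
  simp only [f.T_nat, cr_sub]
  refine (h i x1 x2 x3 x4 h12 h23 h34).trans ?_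
  have hcr := cr_pos h12 h23 h34
  have hik : i ≤ K * L.q := by
    rw [← L.q_cast] at hiK; exact_mod_cast hiK
  have hm : f.mass i x1 x4 ≤ K * (J * (1 + f.N)) :=
    ((f.mass_mono_k hik (by linarith)).trans (f.mass_subset _ le_rfl h4)).trans (L.mass_KJ K J x1)
  have hle : C * f.mass i x1 x4 ≤ C * (1 + f.N) * (K * J) := by
    calc C * f.mass i x1 x4 ≤ C * (K * (J * (1 + f.N))) := by gcongr
      _ = _ := by ring
  exact mul_le_mul_of_nonneg_right (Real.exp_le_exp.2 hle) hcr.le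

end Nice

namespace Level
variable {f : Nice} (L : Level f)

theorem w_small (x : ℝ) (M : ℝ) : ∃ j : ℕ, f.T (j • L.w) x < M := by
  have hw := L.hw
  obtain ⟨n, hn⟩ := exists_nat_gt (x - M)
  obtain ⟨j, hj⟩ := exists_nat_gt ((n : ℝ) / (-f.val L.w))
  refine ⟨j, ?_⟩
  have h1 : f.val (j • L.w) < f.val (0, (n : ℤ)) := by
    rw [← natCast_zsmul, f.val_zsmul]
    rw [div_lt_iff₀ (by linarith)] at hj
    simp [Nice.val] at hj ⊢; linarith
  have := f.T_mono_val h1 x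
  rw [f.T_int] at this; push_cast at this; linarith

theorem w_big (x : ℝ) (M : ℝ) : ∃ j : ℕ, M < f.T (-(j • L.w)) x := by
  obtain ⟨j, hj⟩ := L.w_small M x
  refine ⟨j, ?_⟩
  have := (f.T_lt_iff (-(j • L.w))).2 hj
  rwa [f.T_neg_T] at this

theorem lt_v (x : ℝ) : x < f.T L.v x := f.T_pos L.hv x
theorem w_lt (x : ℝ) : f.T L.w x < x := f.T_neg L.hw x

/-- every orbit reaches each fundamental interval quickly -/
theorem reach (x a : ℝ) : ∃ (k : ℕ) (p : ℤ), (k : ℤ) < L.v.1 + L.w.1 ∧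
    f.T ((k : ℤ), p) x ∈ Ico a (f.T L.v a) := by
  classical
  have w1 := L.w1
  have q0 := L.q0
  have ex : ∃ k : ℕ, ∃ p : ℤ, f.T ((k : ℤ), p) x ∈ Ico a (f.T L.v a) := by
    obtain ⟨n, hn⟩ := exists_int_gt (f.T L.v a - x)
    have h1 : ∃ j : ℕ, f.T (j • L.w) (x + n) < f.T L.v a := L.w_small _ _
    set j := Nat.find h1 with hj
    have hj1 := Nat.find_spec h1
    rw [← hj] at hj1
    have hj0 : j ≠ 0 := by
      intro h0; rw [h0] at hj1; simp at hj1; linarith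
    obtain ⟨i, hi⟩ := Nat.exists_eq_succ_of_ne_zero hj0
    have hj2 := Nat.find_min h1 (m := i) (by omega)
    push Not at hj2
    have hxn : x + n = f.T (0, -n) x := by rw [f.T_int]; push_cast; ring
    refine ⟨j * L.q, j * L.w.2 - n, ?_, ?_⟩
    · have e : f.T (((j * L.q : ℕ) : ℤ), j * L.w.2 - n) x = f.T L.w (f.T (i • L.w) (x + n)) := by
        rw [hxn, ← f.T_add, ← f.T_add]; congr 1
        ext
        · simp [L.q_cast, hi]; ring
        · simp [hi]; ring
      rw [e]
      have h3 : f.T L.w (f.T L.v a) ≤ f.T L.w (f.T (i • L.w) (x + n)) := (f.T_le_iff _).2 hj2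
      have h4 : a < f.T L.w (f.T L.v a) := by
        rw [← f.T_add]; apply f.T_pos; rw [f.val_add]; linarith [L.hlt]
      linarith
    · have e : f.T (((j * L.q : ℕ) : ℤ), j * L.w.2 - n) x = (f.T (j • L.w) (x + n)) := by
        rw [hxn, ← f.T_add]; congr 1
        ext
        · simp [L.q_cast]
        · simp; ring
      rw [e]; exact hj1
  obtain ⟨p, hp⟩ := Nat.find_spec ex
  refine ⟨Nat.find ex, p, ?_, hp⟩
  set k := Nat.find ex with hk
  by_contra hlt
  push Not at hlt
  set y := f.T ((k : ℤ), p) x with hy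
  have hm : ∀ u : ℤ × ℤ, 0 < u.1 → u.1 ≤ k → f.T (-u) y ∉ Ico a (f.T L.v a) := by
    intro u hu1 hu2 hmem
    have e : f.T (-u) y = f.T ((((k : ℤ) - u.1).toNat : ℤ), p - u.2) x := by
      rw [hy, ← f.T_add, Int.toNat_of_nonneg (by omega)]; congr 1
      ext
      · simp; ring
      · simp; ring
    rw [e] at hmem
    have := Nat.find_min' ex ⟨_, hmem⟩
    omega
  have h1 := hm L.w (by omega) (by omega)
  have h2 : y < f.T (-L.w) y := f.T_pos (by rw [f.val_neg]; linarith [L.hw]) y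
  have h3 : f.T L.v a ≤ f.T (-L.w) y := by
    by_contra h; push Not at h; exact h1 ⟨by linarith [hp.1], h⟩
  refine hm (L.v + L.w) (by simp; omega) (by simp; omega) ⟨?_, ?_⟩
  · have := (f.T_le_iff (-L.v)).2 h3
    rw [f.T_neg_T, ← f.T_add] at this
    rwa [neg_add]
  · have : f.T (-(L.v + L.w)) y < y := by
      apply f.T_neg; rw [f.val_neg, f.val_add]; linarith [L.hlt]
    linarith [hp.2]

end Level

/-- step length -/
def Nice.st (f : Nice) (v : ℤ × ℤ) (x : ℝ) : ℝ := f.T v x - x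

namespace Nice
variable (f : Nice)

theorem st_cont (v : ℤ × ℤ) : Continuous (f.st v) := (f.T_cont v).sub continuous_id
theorem st_per (v : ℤ × ℤ) (x : ℝ) : f.st v (x + 1) = f.st v x := by
  simp only [st, T_add_one]; ring

set_option maxHeartbeats 1000000 in
theorem RB_min : ∃ B, 1 ≤ B ∧ ∀ L : Level f, ∃ x0 m, 0 < m ∧ (∀ x, x + m ≤ f.T L.v x) ∧
    f.T L.v (f.T L.v (f.T L.v x0)) - f.T (-L.v) x0 ≤ B * m := by
  obtain ⟨E, hE, hcr⟩ := f.crT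
  obtain ⟨κ, hκ⟩ : ∃ x : ℝ, x = Real.exp (-(E * (4 * 3))) / 4 := ⟨_, rfl⟩
  have hκ0 : 0 < κ := by rw [hκ]; positivity
  have hκ1 : κ ≤ 1 := by
    have : Real.exp (-(E * (4 * 3))) ≤ 1 := Real.exp_le_one_iff.2 (by linarith)
    rw [hκ]; generalize Real.exp (-(E * (4 * 3))) = t at this; linarith
  obtain ⟨A, hA⟩ : ∃ x : ℝ, x = κ⁻¹ := ⟨_, rfl⟩
  have hA1 : 1 ≤ A := by rw [hA]; exact (one_le_inv₀ hκ0).2 hκ1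
  -- chain of constants
  obtain ⟨B1, hB1⟩ : ∃ x : ℝ, x = A * (1 + A) := ⟨_, rfl⟩
  obtain ⟨B2, hB2⟩ : ∃ x : ℝ, x = A * B1 + B1 + 1 := ⟨_, rfl⟩
  obtain ⟨B3, hB3⟩ : ∃ x : ℝ, x = A * (B2 + A) := ⟨_, rfl⟩
  obtain ⟨B4, hB4⟩ : ∃ x : ℝ, x = B2 + B3 + A * B3 + A * (A * B3) := ⟨_, rfl⟩
  obtain ⟨B5, hB5⟩ : ∃ x : ℝ, x = B4 + A := ⟨_, rfl⟩
  have b1 : 0 < B1 := by rw [hB1]; positivity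
  have b2 : 0 < B2 := by rw [hB2]; positivity
  have b3 : 0 < B3 := by rw [hB3]; positivity
  have b4 : 0 < B4 := by rw [hB4]; positivity
  have b5 : 1 ≤ B5 := by linarith
  refine ⟨B5, b5, fun L => ?_⟩
  obtain ⟨x0, hx0⟩ := periodic_min (f.st_cont L.v) (f.st_per L.v)
  set m := f.st L.v x0 with hm
  have q0 := L.q0
  have w1 := L.w1
  have qle := L.qle
  have hv := L.hv
  have hw := L.hw
  have hlt := L.hlt
  have hmpos : 0 < m := sub_pos.2 (f.T_pos L.hv x0)
  have hG : ∀ x, f.T L.v x = x + f.st L.v x := fun x => by simp only [st]; ring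
  have hmin : ∀ x, x + m ≤ f.T L.v x := fun x => by rw [hG]; linarith [hx0 x]
  have v3 : ∀ y, f.T L.v (f.T L.v (f.T L.v y)) = f.T (3 • L.v) y := by
    intro y; rw [← f.T_add, ← f.T_add]; congr 1; abel
  -- (a)
  have stepA : ∀ u : ℤ × ℤ, 0 ≤ u.1 → u.1 ≤ 4 * L.w.1 → ∀ y, f.T L.v y = f.T (-u) x0 →
      f.st L.v (f.T L.v y) ≤ A * f.st L.v y ∧
      f.st L.v (f.T L.v y) ≤ A * f.st L.v (f.T L.v (f.T L.v y)) := by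
    intro u hu0 hu1 y hy
    set z := f.T L.v y with hz
    have h12 : y < z := L.lt_v y
    have h23 : z < f.T L.v z := L.lt_v z
    have h34 : f.T L.v z < f.T L.v (f.T L.v z) := L.lt_v _
    have key := hcr L 4 3 u.1 u.2 hu0 (by push_cast; exact hu1) y z (f.T L.v z) (f.T L.v (f.T L.v z)) h12 h23 h34
      (by rw [hz, v3])
    have eu : (u.1, u.2) = u := rfl
    rw [eu] at key
    have ez : f.T u z = x0 := by rw [hy, f.T_T_neg]
    have ey : f.T u y + m ≤ x0 := by rw [← ez, hz, f.T_comm u]; exact hmin _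
    have e3 : f.T u (f.T L.v z) = f.T L.v x0 := by rw [f.T_comm, ez]
    have e4 : f.T u (f.T L.v (f.T L.v z)) = f.T L.v (f.T L.v x0) := by rw [f.T_comm, e3]
    rw [ez, e3, e4] at key
    have g1 := hG x0
    have g2 := hmin (f.T L.v x0)
    rw [← hm] at g1
    have low := cr_ge (a := f.T u y) (b := x0) (c := f.T L.v x0) (d := f.T L.v (f.T L.v x0))
      (α := 1 / 2) (β := 1 / 2) (by linarith) (by linarith) (by linarith) (by norm_num) (by norm_num)
      (by linarith) (by linarith)
    have hk : κ ≤ cr y z (f.T L.v z) (f.T L.v (f.T L.v z)) := by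
      have h5 := low.trans key
      rw [hκ, Real.exp_neg, div_le_iff₀ (by norm_num), inv_le_iff_one_le_mul₀ (Real.exp_pos _)]
      push_cast at h5
      have e : cr y z (f.T L.v z) (f.T L.v (f.T L.v z)) * 4 * Real.exp (E * (4 * 3)) = 4 * (Real.exp (E * (4 * 3)) * cr y z (f.T L.v z) (f.T L.v (f.T L.v z))) := by ring
      rw [e]
      generalize Real.exp (E * (4 * 3)) * cr y z (f.T L.v z) (f.T L.v (f.T L.v z)) = t at h5
      linarith
    obtain ⟨l1, l2⟩ := cr_low h12 h23 h34 hκ0.le hk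
    have hAκ : A * κ = 1 := by rw [hA]; exact inv_mul_cancel₀ hκ0.ne'
    have l1' : A * (κ * (f.T L.v z - y)) ≤ A * (z - y) := by gcongr
    have l2' : A * (κ * (f.T L.v (f.T L.v z) - z)) ≤ A * (f.T L.v (f.T L.v z) - f.T L.v z) := by gcongr
    rw [← mul_assoc, hAκ, one_mul] at l1' l2'
    simp only [st]
    constructor <;> linarith
  -- (b)
  set y1 := f.T (-L.v) x0 with hy1
  set y2 := f.T (-L.v) y1 with hy2
  have Gy1 : f.T L.v y1 = x0 := f.T_T_neg _ _
  have Gy2 : f.T L.v y2 = y1 := f.T_T_neg _ _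
  have s1 : f.st L.v y1 ≤ A * m := by
    have := (stepA L.v q0 (by linarith) y2 (by rw [Gy2])).2
    rwa [Gy2, Gy1] at this
  have y1x0 : x0 - y1 ≤ A * m := by
    simp only [st, Gy1] at s1; exact s1
  -- A-point
  set a1 := f.T (-L.w) x0 with ha1
  have a1lo : x0 < a1 := f.T_pos (by rw [f.val_neg]; linarith) x0
  have a1hi : a1 < f.T L.v x0 := f.T_mono_val (by rw [f.val_neg]; linarith) x0
  have hx0G : f.T L.v x0 = x0 + m := hG x0
  set a1' := f.T (-L.v) a1 with ha1'
  have Ga1' : f.T L.v a1' = a1 := f.T_T_neg _ _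
  have a1'lo : y1 < a1' := (f.T_lt_iff _).2 a1lo
  have sa1 : f.st L.v a1 ≤ B1 * m := by
    have := (stepA L.w (by linarith) (by linarith) a1' Ga1').1
    rw [Ga1'] at this
    have h2 : f.st L.v a1' ≤ (1 + A) * m := by simp only [st, Ga1']; linarith
    calc _ ≤ A * f.st L.v a1' := this
      _ ≤ A * ((1 + A) * m) := by gcongr
      _ = _ := by rw [hB1]; ring
  have sGa1 : f.st L.v (f.T L.v a1) ≤ A * (B1 * m) := by
    have := (stepA (L.w - L.v) (by simp; linarith) (by simp; linarith) a1 (by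
      rw [ha1, ← f.T_add]; congr 1; abel)).1
    exact this.trans (by gcongr)
  have x2 : f.T L.v (f.T L.v x0) - x0 ≤ B2 * m := by
    have h1 : f.T L.v (f.T L.v x0) < f.T L.v (f.T L.v a1) := (f.T_lt_iff _).2 ((f.T_lt_iff _).2 a1lo)
    have h2 := hG a1
    have h3 := hG (f.T L.v a1)
    have e : B2 * m = A * (B1 * m) + B1 * m + m := by rw [hB2]; ring
    rw [e]; linarith
  -- second A-point
  set a2 := f.T (-L.w) a1 with ha2
  have a2lo : x0 < a2 := a1lo.trans (f.T_pos (by rw [f.val_neg]; linarith) a1)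
  have a2hi : a2 < f.T L.v (f.T L.v x0) := by
    rw [ha2, ha1, ← f.T_add, ← f.T_add]
    apply f.T_mono_val; simp only [f.val_add, f.val_neg]; linarith
  set a2' := f.T (-L.v) a2 with ha2'
  have Ga2' : f.T L.v a2' = a2 := f.T_T_neg _ _
  have a2'lo : y1 < a2' := (f.T_lt_iff _).2 a2lo
  have sa2 : f.st L.v a2 ≤ B3 * m := by
    have := (stepA (L.w + L.w) (by simp; linarith) (by simp; linarith) a2' (by
      rw [Ga2', ha2, ha1, ← f.T_add]; congr 1; abel)).1
    rw [Ga2'] at this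
    have h2 : f.st L.v a2' ≤ (B2 + A) * m := by simp only [st, Ga2']; linarith
    calc _ ≤ A * f.st L.v a2' := this
      _ ≤ A * ((B2 + A) * m) := by gcongr
      _ = _ := by rw [hB3]; ring
  have sGa2 : f.st L.v (f.T L.v a2) ≤ A * (B3 * m) := by
    have := (stepA (L.w + L.w - L.v) (by simp; linarith) (by simp; linarith) a2 (by
      rw [ha2, ha1, ← f.T_add, ← f.T_add]; congr 1; abel)).1
    exact this.trans (by gcongr)
  have sGGa2 : f.st L.v (f.T L.v (f.T L.v a2)) ≤ A * (A * (B3 * m)) := by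
    have := (stepA (L.w + L.w - L.v - L.v) (by simp; linarith) (by simp; linarith) (f.T L.v a2) (by
      rw [ha2, ha1, ← f.T_add, ← f.T_add, ← f.T_add]; congr 1; abel)).1
    exact this.trans (by gcongr)
  have x3 : f.T L.v (f.T L.v (f.T L.v x0)) - x0 ≤ B4 * m := by
    have h1 : f.T L.v (f.T L.v (f.T L.v x0)) < f.T L.v (f.T L.v (f.T L.v a2)) :=
      (f.T_lt_iff _).2 ((f.T_lt_iff _).2 ((f.T_lt_iff _).2 a2lo))
    have h2 := hG a2
    have h3 := hG (f.T L.v a2)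
    have h4 := hG (f.T L.v (f.T L.v a2))
    have e : B4 * m = B2 * m + B3 * m + A * (B3 * m) + A * (A * (B3 * m)) := by rw [hB4]; ring
    rw [e]; linarith
  refine ⟨x0, m, hmpos, hmin, ?_⟩
  have e : B5 * m = B4 * m + A * m := by rw [hB5]; ring
  rw [e]; linarith

theorem RB : ∃ C, 1 ≤ C ∧ ∀ (L : Level f) x,
    f.st L.v (f.T L.v x) ≤ C * f.st L.v x ∧ f.st L.v x ≤ C * f.st L.v (f.T L.v x) := by
  obtain ⟨E, hE, hcr⟩ := f.crT
  obtain ⟨B5, b5, hB⟩ := f.RB_min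
  refine ⟨B5 * B5 * Real.exp (E * (2 * 3)), ?_, fun L => ?_⟩
  · have : 1 ≤ Real.exp (E * (2 * 3)) := Real.one_le_exp (by positivity)
    have h2 : 1 ≤ B5 * B5 := one_le_mul_of_one_le_of_one_le b5 b5
    exact one_le_mul_of_one_le_of_one_le h2 this
  obtain ⟨x0, m, hmpos, hmin, htot⟩ := hB L
  have qle := L.qle
  have v3 : ∀ y, f.T L.v (f.T L.v (f.T L.v y)) = f.T (3 • L.v) y := by
    intro y; rw [← f.T_add, ← f.T_add]; congr 1; abel
  have final : ∀ y, f.st L.v (f.T L.v y) ≤ B5 * B5 * Real.exp (E * (2 * 3)) * f.st L.v y ∧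
      f.st L.v (f.T L.v y) ≤ B5 * B5 * Real.exp (E * (2 * 3)) * f.st L.v (f.T L.v (f.T L.v y)) := by
    intro y
    set z := f.T L.v y with hz
    have h12 : y < z := L.lt_v y
    have h23 : z < f.T L.v z := L.lt_v z
    have h34 : f.T L.v z < f.T L.v (f.T L.v z) := L.lt_v _
    obtain ⟨k, p, hk, hmem⟩ := L.reach z x0
    have key := hcr L 2 3 k p (by positivity) (by push_cast; linarith) y z (f.T L.v z)
      (f.T L.v (f.T L.v z)) h12 h23 h34 (by rw [hz, v3])
    set u : ℤ × ℤ := ((k : ℤ), p) with hu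
    set Y := f.T u z with hY
    have ey : f.T L.v (f.T u y) = Y := by rw [hY, hz, f.T_comm]
    have e3 : f.T u (f.T L.v z) = f.T L.v Y := by rw [f.T_comm]
    have e4 : f.T u (f.T L.v (f.T L.v z)) = f.T L.v (f.T L.v Y) := by rw [f.T_comm, e3]
    rw [e3, e4] at key
    have g0 := hmin (f.T u y)
    rw [ey] at g0
    have g1 := hmin Y
    have g2 := hmin (f.T L.v Y)
    have ylo : f.T (-L.v) x0 ≤ f.T u y := by
      have := (f.T_le_iff (-L.v)).2 hmem.1
      rw [← ey, f.T_neg_T] at this; exact this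
    have yhi : f.T L.v (f.T L.v Y) ≤ f.T L.v (f.T L.v (f.T L.v x0)) :=
      (f.T_le_iff _).2 ((f.T_le_iff _).2 hmem.2.le)
    have tot : f.T L.v (f.T L.v Y) - f.T u y ≤ B5 * m := by
      linarith
    have hB5pos : 0 < B5 := by linarith
    have hm5 : ∀ t, m ≤ t → B5 * m ≤ B5 * t := fun t ht => mul_le_mul_of_nonneg_left ht hB5pos.le
    have low := cr_ge (a := f.T u y) (b := Y) (c := f.T L.v Y) (d := f.T L.v (f.T L.v Y))
      (α := B5⁻¹) (β := B5⁻¹) (by linarith) (by linarith) (by linarith) (by positivity) (by positivity)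
      (by rw [inv_mul_le_iff₀ hB5pos]; exact le_trans (by linarith) (hm5 _ (by linarith)))
      (by rw [inv_mul_le_iff₀ hB5pos]; exact le_trans (by linarith) (hm5 _ (by linarith)))
    obtain ⟨X, hX⟩ : ∃ x : ℝ, x = B5 * B5 * Real.exp (E * (2 * 3)) := ⟨_, rfl⟩
    rw [← hX]
    have hXpos : 0 < X := by rw [hX]; positivity
    have hk : X⁻¹ ≤ cr y z (f.T L.v z) (f.T L.v (f.T L.v z)) := by
      have h5 := low.trans key
      push_cast at h5
      rw [inv_le_iff_one_le_mul₀ hXpos, hX]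
      have h6 : B5 * B5 * (B5⁻¹ * B5⁻¹) = 1 := by field_simp
      have h7 := mul_le_mul_of_nonneg_left h5 (by positivity : 0 ≤ B5 * B5)
      rw [h6] at h7
      refine h7.trans (le_of_eq ?_)
      ring
    obtain ⟨l1, l2⟩ := cr_low h12 h23 h34 (by positivity) hk
    rw [inv_mul_le_iff₀ hXpos] at l1 l2
    simp only [st]
    constructor <;> linarith
  intro x
  refine ⟨(final x).1, ?_⟩
  have := (final (f.T (-L.v) x)).2
  rwa [f.T_T_neg] at this

end Nice

/-- flip the orientation of an index -/
def sg (v : ℤ × ℤ) : ℤ × ℤ := (v.1, -v.2)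

theorem sg_sg (v : ℤ × ℤ) : sg (sg v) = v := by simp [sg]
theorem sg_neg (v : ℤ × ℤ) : sg (-v) = - sg v := by simp [sg]

namespace Nice

/-- equivariance of the action under a (signed) conjugacy -/
theorem T_conj (f g : Nice) (φ : ℝ → ℝ) (h1 : ∀ x, φ (f.F x) = g.F (φ x))
    (h2 : ∀ x (k : ℤ), φ (x + k) = φ x + k) (v : ℤ × ℤ) (x : ℝ) : φ (f.T v x) = g.T v (φ x) := by
  have pos : ∀ (i : ℕ) (p : ℤ) (x : ℝ), φ (f.T ((i : ℤ), p) x) = g.T ((i : ℤ), p) (φ x) := by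
    intro i p x
    have hs : ∀ i : ℕ, φ (f.F^[i] x) = g.F^[i] (φ x) := by
      intro i
      induction i with
      | zero => rfl
      | succ i ih => rw [Function.iterate_succ_apply', h1, ih, Function.iterate_succ_apply']
    rw [f.T_nat, g.T_nat]
    have := h2 (f.F^[i] x) (-p)
    push_cast at this
    rw [sub_eq_add_neg, this, hs]; ring
  obtain ⟨q, p⟩ := v
  rcases le_total 0 q with hq | hq
  · lift q to ℕ using hq; exact pos q p x
  · obtain ⟨i, hi⟩ := Int.eq_ofNat_of_zero_le (neg_nonneg.2 hq)
    have e : (q, p) = -((i : ℤ), -p) := by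
      ext
      · simp; omega
      · simp
    rw [e]
    have := pos i (-p) (f.T (-((i : ℤ), -p)) x)
    rw [f.T_T_neg] at this
    rw [this, g.T_neg_T]

/-- the map conjugated by `x ↦ -x` -/
def reflect (f : Nice) : Nice where
  F x := -f.F (-x)
  d1 x := f.d1 (-x)
  d2 x := -f.d2 (-x)
  d3 x := f.d3 (-x)
  hF x := ((f.hF (-x)).comp x (hasDerivAt_neg x)).neg.congr_deriv (by ring)
  hd1 x := ((f.hd1 (-x)).comp x (hasDerivAt_neg x)).congr_deriv (by ring)
  hd2 x := ((f.hd2 (-x)).comp x (hasDerivAt_neg x)).neg.congr_deriv (by ring)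
  cont3 := f.cont3.comp continuous_neg
  mono := fun x y h => neg_lt_neg (f.mono (neg_lt_neg h))
  deg1 := fun x => by
    have := f.deg1 (-(x + 1))
    rw [show -(x + 1) + 1 = -x by ring] at this
    linarith
  N := f.N
  N_pos := f.N_pos
  c i := - f.c i
  crit := fun x => by
    rw [f.crit]
    constructor
    · rintro ⟨i, k, h⟩; exact ⟨i, -k, by push_cast; linarith⟩
    · rintro ⟨i, k, h⟩; exact ⟨i, -k, by push_cast; linarith⟩
  pl := fun i => by
    obtain ⟨r, s, a, b, hr, hs, ha, hb, h⟩ := f.pl i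
    refine ⟨r, s, a, b, hr, hs, ha, hb, fun x hx hxr => ?_⟩
    have e : |-x - f.c i| = |x - -f.c i| := by
      rw [← abs_neg]; congr 1; ring
    have := h (-x) (fun hh => hx (by linarith)) (by rw [e]; exact hxr)
    rw [e] at this
    simpa using this
  ρ := -f.ρ
  irr := f.irr.neg
  rot := by
    have h := f.rot.neg
    refine h.congr fun n => ?_
    have : (fun x => -f.F (-x))^[n] 0 = - f.F^[n] 0 := by
      induction n with
      | zero => simp
      | succ n ih => rw [Function.iterate_succ_apply', ih, Function.iterate_succ_apply']; simp
    rw [this]; ring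

theorem reflect_reflect (f : Nice) : f.reflect.reflect = f := by
  cases f; simp [reflect]

theorem T_reflect (f : Nice) (v : ℤ × ℤ) (x : ℝ) : f.reflect.T v (-x) = - f.T (sg v) x := by
  have pos : ∀ (i : ℕ) (p : ℤ) (x : ℝ), f.reflect.T ((i : ℤ), p) (-x) = - f.T ((i : ℤ), -p) x := by
    intro i p x
    have hs : ∀ i : ℕ, f.reflect.F^[i] (-x) = - f.F^[i] x := by
      intro i
      induction i with
      | zero => rfl
      | succ i ih => rw [Function.iterate_succ_apply', ih, Function.iterate_succ_apply']; simp [reflect]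
    rw [f.T_nat, T_nat, hs]; push_cast; ring
  obtain ⟨q, p⟩ := v
  rcases le_total 0 q with hq | hq
  · lift q to ℕ using hq; exact pos q p x
  · obtain ⟨i, hi⟩ := Int.eq_ofNat_of_zero_le (neg_nonneg.2 hq)
    have e : (q, p) = -((i : ℤ), -p) := by
      ext
      · simp; omega
      · simp
    rw [e]
    have := pos i (-p) (f.T (-((i : ℤ), p)) x)
    rw [neg_neg, f.T_T_neg] at this
    have h2 := congrArg (f.reflect.T (-((i : ℤ), -p))) this
    rw [f.reflect.T_neg_T] at h2
    rw [← h2]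
    simp [sg]

theorem val_reflect (f : Nice) (v : ℤ × ℤ) : f.reflect.val (sg v) = - f.val v := by
  simp [val, reflect, sg]; ring

end Nice

/-- Working data attached to a multicritical circle map. -/
def MCM.nice (f : MCM) (ρ : ℝ) (irr : Irrational ρ) (rot : HasRotationNumber f.F ρ) : Nice where
  F := f.F
  d1 := deriv f.F
  d2 := deriv (deriv f.F)
  d3 := deriv (deriv (deriv f.F))
  hF x := (f.smooth.differentiable (by norm_num) x).hasDerivAt
  hd1 x := by
    have h2 : ContDiff ℝ 2 (deriv f.F) := by
      have h := f.smooth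
      rw [show (3 : WithTop ℕ∞) = 2 + 1 by norm_num, contDiff_succ_iff_deriv] at h
      exact h.2.2
    exact (h2.differentiable (by norm_num) x).hasDerivAt
  hd2 x := by
    have h2 : ContDiff ℝ 2 (deriv f.F) := by
      have h := f.smooth
      rw [show (3 : WithTop ℕ∞) = 2 + 1 by norm_num, contDiff_succ_iff_deriv] at h
      exact h.2.2
    rw [show (2 : WithTop ℕ∞) = 1 + 1 by norm_num, contDiff_succ_iff_deriv] at h2
    exact (h2.2.2.differentiable (by norm_num) x).hasDerivAt
  cont3 := by
    have h2 : ContDiff ℝ 2 (deriv f.F) := by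
      have h := f.smooth
      rw [show (3 : WithTop ℕ∞) = 2 + 1 by norm_num, contDiff_succ_iff_deriv] at h
      exact h.2.2
    rw [show (2 : WithTop ℕ∞) = 1 + 1 by norm_num, contDiff_succ_iff_deriv] at h2
    exact h2.2.2.continuous_deriv (by norm_num)
  mono := f.mono
  deg1 := f.deg1
  N := f.N
  N_pos := f.N_pos
  c := f.c
  crit := fun x => by
    refine ⟨f.critOnly x, ?_⟩
    rintro ⟨i, k, rfl⟩
    have hper : ∀ (k : ℤ) y, f.F (y + k) = f.F y + k := by
      let L : CircleDeg1Lift := ⟨⟨f.F, f.mono.monotone⟩, f.deg1⟩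
      intro k y; exact L.map_add_int y k
    have e : (fun y => f.F (y + k)) = fun y => f.F y + k := funext fun y => hper k y
    have := deriv_comp_add_const (f := f.F) (k : ℝ) (f.c i)
    rw [← this, e, deriv_add_const, f.isCrit]
  pl := fun i => by
    obtain ⟨r, hr, hW⟩ := Metric.isOpen_iff.1 (f.W_open i) (f.c i) (f.c_mem_W i)
    refine ⟨r, f.s i, f.al i, f.be i, hr, f.s_gt_one i, f.al_pos i, (f.al_pos i).trans (f.al_lt_be i),
      fun x hx hxr => ?_⟩
    have hxW : x ∈ f.W i := hW (by rw [Metric.mem_ball, Real.dist_eq]; exact hxr)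
    obtain ⟨p1, p2⟩ := f.powerLaw i x hxW hx
    refine ⟨p1.le, p2.le, ?_⟩
    have h2 : ContDiff ℝ 2 (deriv f.F) := by
      have h := f.smooth
      rw [show (3 : WithTop ℕ∞) = 2 + 1 by norm_num, contDiff_succ_iff_deriv] at h
      exact h.2.2
    have hd1 : HasDerivAt (deriv f.F) (deriv (deriv f.F) x) x :=
      (h2.differentiable (by norm_num) x).hasDerivAt
    have h3 := h2
    rw [show (2 : WithTop ℕ∞) = 1 + 1 by norm_num, contDiff_succ_iff_deriv] at h3
    have hd2 : HasDerivAt (deriv (deriv f.F)) (deriv (deriv (deriv f.F)) x) x :=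
      (h3.2.2.differentiable (by norm_num) x).hasDerivAt
    have pos : 0 < deriv f.F x := by
      refine lt_of_le_of_lt ?_ p1
      have := f.al_pos i
      positivity
    have hS := f.negSchwarzian i x hxW hx
    have hdiv := (hd2.div hd1 pos.ne').deriv
    have e : (fun y => deriv (deriv f.F) y / deriv f.F y) = (deriv (deriv f.F) / deriv f.F) := rfl
    rw [schwarzianDeriv, e, hdiv] at hS
    generalize deriv f.F x = a at *
    generalize deriv (deriv f.F) x = b at *
    generalize deriv (deriv (deriv f.F)) x = c at *
    have : (2 * c * a - 3 * b ^ 2) / (2 * a ^ 2) < 0 := by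
      calc _ = (c * a - b * b) / a ^ 2 - 1 / 2 * (b / a) ^ 2 := by field_simp; ring
        _ < 0 := hS
    have h4 : 2 * c * a - 3 * b ^ 2 < 0 := by
      by_contra hn
      push Not at hn
      exact absurd (div_nonneg hn (by positivity)) (not_le.2 this)
    linarith
  ρ := ρ
  irr := irr
  rot := rot

namespace Level
variable {f : Nice}

theorem val_ne (L : Level f) (k : ℤ) : f.val (L.v + k • L.w) ≠ 0 := by
  intro h
  have h0 : L.v + k • L.w = 0 := f.val_inj (by rw [h, f.val_zero])
  have h1 := congrArg Prod.fst h0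
  have h2 := congrArg Prod.snd h0
  simp at h1 h2
  have e : L.v.1 * L.w.2 - L.v.2 * L.w.1 = 0 := by
    linear_combination L.w.2 * h1 - L.w.1 * h2
  rcases L.det with h | h <;> omega

def nextK (L : Level f) : ℤ := ⌊-(f.val L.v / f.val L.w)⌋

/-- the next level, for the reflected map -/
def next (L : Level f) : Level f.reflect := by
  have hv := L.hv
  have hw := L.hw
  have hlt := L.hlt
  have a1 := Int.floor_le (-(f.val L.v / f.val L.w))
  have a2 := Int.lt_floor_add_one (-(f.val L.v / f.val L.w))
  have e : -(f.val L.v / f.val L.w) * (-f.val L.w) = f.val L.v := by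
    rw [neg_mul_neg, div_mul_cancel₀ _ hw.ne]
  have k1 : 1 ≤ L.nextK := by
    rw [nextK, Int.le_floor]; push_cast
    have : 1 * (-f.val L.w) ≤ -(f.val L.v / f.val L.w) * (-f.val L.w) := by rw [e]; linarith
    exact le_of_mul_le_mul_right this (by linarith)
  have hne := L.val_ne L.nextK
  have hval : f.val (L.v + L.nextK • L.w) = f.val L.v + L.nextK * f.val L.w := by
    rw [f.val_add, f.val_zsmul]
  have b1 : 0 ≤ f.val L.v + L.nextK * f.val L.w := by
    have : (L.nextK : ℝ) * (-f.val L.w) ≤ -(f.val L.v / f.val L.w) * (-f.val L.w) :=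
      mul_le_mul_of_nonneg_right a1 (by linarith)
    rw [e] at this; linarith
  have b2 : f.val L.v + L.nextK * f.val L.w < - f.val L.w := by
    have : -(f.val L.v / f.val L.w) * (-f.val L.w) < ((L.nextK : ℝ) + 1) * (-f.val L.w) :=
      mul_lt_mul_of_pos_right a2 (by linarith)
    rw [e] at this; linarith
  rw [hval] at hne
  have b3 := lt_of_le_of_ne b1 hne.symm
  have q0 := L.q0
  have w1 := L.w1
  have qle := L.qle
  exact
  { v := sg L.w
    w := sg (L.v + L.nextK • L.w)
    hv := by rw [f.val_reflect]; linarith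
    hv1 := by rw [f.val_reflect]; linarith [L.hv1]
    hw := by rw [f.val_reflect, hval]; linarith
    hlt := by rw [f.val_reflect, f.val_reflect, hval]; linarith
    q0 := by simp [sg]; linarith
    qle := by
      simp [sg]
      nlinarith
    w1 := by
      simp [sg]
      nlinarith
    det := by
      simp [sg]
      rcases L.det with h | h
      · left; linear_combination h
      · right; linear_combination h }

theorem next_v (L : Level f) : L.next.v = sg L.w := rfl
theorem next_w (L : Level f) : L.next.w = sg (L.v + L.nextK • L.w) := rfl

/-- the first level -/
def first (f : Nice) : Level f := by
  have h1 : ((⌈f.ρ⌉ : ℤ) : ℝ) < f.ρ + 1 := Int.ceil_lt_add_one _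
  have h2 : f.ρ < ⌈f.ρ⌉ := lt_of_le_of_ne (Int.le_ceil _) (f.irr.ne_int _)
  exact
  { v := (0, -1)
    w := (1, ⌈f.ρ⌉)
    hv := by simp [Nice.val]
    hv1 := by simp [Nice.val]
    hw := by simp [Nice.val]; linarith
    hlt := by simp [Nice.val]; linarith
    q0 := le_rfl
    qle := by norm_num
    w1 := le_rfl
    det := by left; simp }

end Level

namespace Nice

/-- alternately reflected maps -/
def rf (f : Nice) : ℕ → Nice
  | 0 => f
  | n + 1 => (rf f n).reflect

theorem rf_cases (f g : Nice) (n : ℕ) :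
    (f.rf n = f ∧ g.rf n = g) ∨ (f.rf n = f.reflect ∧ g.rf n = g.reflect) := by
  induction n with
  | zero => exact Or.inl ⟨rfl, rfl⟩
  | succ n ih =>
    rcases ih with ⟨h1, h2⟩ | ⟨h1, h2⟩
    · right; simp [rf, h1, h2]
    · left; simp [rf, h1, h2, reflect_reflect]

/-- the levels -/
def lev (f : Nice) : ∀ n, Level (f.rf n)
  | 0 => Level.first f
  | n + 1 => (lev f n).next

theorem lev_same (f g : Nice) (h : f.ρ = g.ρ) (n : ℕ) : (f.rf n).ρ = (g.rf n).ρ ∧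
    (f.lev n).v = (g.lev n).v ∧ (f.lev n).w = (g.lev n).w := by
  induction n with
  | zero =>
    refine ⟨h, rfl, ?_⟩
    show ((1 : ℤ), ⌈f.ρ⌉) = (1, ⌈g.ρ⌉); rw [h]
  | succ n ih =>
    obtain ⟨h1, h2, h3⟩ := ih
    refine ⟨?_, ?_, ?_⟩
    · simp [rf, reflect, h1]
    · show sg _ = sg _; rw [h3]
    · show sg _ = sg _
      rw [h2, h3, Level.nextK, Level.nextK, h2, h3]
      simp only [val, h1]

/-- uniform constants along alternately reflected maps -/
theorem rf_unif (f : Nice) (P : Nice → ℝ → Prop) (hmono : ∀ g C C', C ≤ C' → P g C → P g C')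
    (h : ∀ g, ∃ C, P g C) : ∃ C, 1 ≤ C ∧ ∀ n, P (f.rf n) C := by
  obtain ⟨C1, h1⟩ := h f
  obtain ⟨C2, h2⟩ := h f.reflect
  refine ⟨max 1 (max C1 C2), le_max_left _ _, fun n => ?_⟩
  rcases rf_cases f f n with ⟨h3, -⟩ | ⟨h3, -⟩
  · rw [h3]; exact hmono _ _ _ ((le_max_left _ _).trans (le_max_right _ _)) h1
  · rw [h3]; exact hmono _ _ _ ((le_max_right _ _).trans (le_max_right _ _)) h2

end Nice

/-- short step to the left -/
def Level.us {f : Nice} (L : Level f) (x : ℝ) : ℝ := x - f.T L.w x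
/-- long step to the right -/
def Level.ss {f : Nice} (L : Level f) (x : ℝ) : ℝ := f.T L.v x - x

namespace Level
variable {f : Nice} (L : Level f)

theorem us_pos (x : ℝ) : 0 < L.us x := sub_pos.2 (L.w_lt x)
theorem ss_pos (x : ℝ) : 0 < L.ss x := sub_pos.2 (L.lt_v x)
theorem lt_psi (x : ℝ) : x < f.T (-L.w) x := f.T_pos (by rw [f.val_neg]; linarith [L.hw]) x
theorem vinv_lt (x : ℝ) : f.T (-L.v) x < x := f.T_neg (by rw [f.val_neg]; linarith [L.hv]) x
theorem psi_lt_v (x : ℝ) : f.T (-L.w) x < f.T L.v x :=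
  f.T_mono_val (by rw [f.val_neg]; linarith [L.hlt]) x
theorem vinv_lt_w (x : ℝ) : f.T (-L.v) x < f.T L.w x :=
  f.T_mono_val (by rw [f.val_neg]; linarith [L.hlt]) x
theorem us_lt_ss_psi (x : ℝ) : L.us (f.T (-L.w) x) < L.ss x := by
  simp only [us, ss, f.T_T_neg]
  linarith [L.psi_lt_v x]

theorem us_next (x : ℝ) : L.us x = L.next.ss (-x) := by
  simp only [us, ss, next_v, f.T_reflect, sg_sg]; ring

/-- existence of spots -/
theorem spot_exists (c y : ℝ) : ∃ (Q : ℕ) (p : ℤ), Q < L.q ∧ y ≤ f.T (-(Q : ℤ), p) c ∧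
    f.T (-(Q : ℤ), p) c < f.T (-L.w) (f.T L.v y) := by
  classical
  have w1 := L.w1
  have q0 := L.q0
  have qle := L.qle
  have hq := L.q_cast
  have ex : ∃ k : ℕ, ∃ p : ℤ, y ≤ f.T (-(k : ℤ), p) c ∧ f.T (-(k : ℤ), p) c < f.T (-L.w) (f.T L.v y) := by
    obtain ⟨n, hn⟩ := exists_int_gt (c - y)
    have h1 : ∃ j : ℕ, y < f.T (-(j • L.w)) (c - n) := L.w_big _ _
    set j := Nat.find h1 with hj
    have hj1 := Nat.find_spec h1
    rw [← hj] at hj1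
    have hj0 : j ≠ 0 := by
      intro h0; rw [h0] at hj1; simp at hj1; linarith
    obtain ⟨i, hi⟩ := Nat.exists_eq_succ_of_ne_zero hj0
    have hj2 := Nat.find_min h1 (m := i) (by omega)
    push Not at hj2
    have hxn : c - n = f.T (0, n) c := by rw [f.T_int]
    have e : f.T (-((j * L.q : ℕ) : ℤ), -(j * L.w.2) + n) c = f.T (-(j • L.w)) (c - n) := by
      rw [hxn, ← f.T_add]; congr 1
      ext
      · simp [L.q_cast]
      · simp
    refine ⟨j * L.q, -(j * L.w.2) + n, ?_, ?_⟩
    · rw [e]; exact hj1.le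
    · rw [e, hi]
      have h3 : f.T (-L.w) (f.T (-(i • L.w)) (c - n)) ≤ f.T (-L.w) y := (f.T_le_iff _).2 hj2
      have h4 : f.T (-L.w) y < f.T (-L.w) (f.T L.v y) := (f.T_lt_iff _).2 (L.lt_v y)
      rw [← f.T_add] at h3
      have e2 : -(i.succ • L.w) = -L.w + -(i • L.w) := by
        rw [Nat.succ_eq_add_one, succ_nsmul]; abel
      rw [e2]; linarith
  obtain ⟨p, hp1, hp2⟩ := Nat.find_spec ex
  refine ⟨Nat.find ex, p, ?_, hp1, hp2⟩
  set k := Nat.find ex with hk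
  by_contra hlt
  push Not at hlt
  set z := f.T (-(k : ℤ), p) c with hz
  have hm : ∀ u : ℤ × ℤ, 0 < u.1 → u.1 ≤ k →
      ¬ (y ≤ f.T u z ∧ f.T u z < f.T (-L.w) (f.T L.v y)) := by
    intro u hu1 hu2 hmem
    have e : f.T u z = f.T (-(((k : ℤ) - u.1).toNat : ℤ), p + u.2) c := by
      rw [hz, ← f.T_add, Int.toNat_of_nonneg (by omega)]; congr 1
      ext
      · simp; ring
      · simp; ring
    rw [e] at hmem
    have := Nat.find_min' ex ⟨_, hmem⟩
    omega
  have h1 := hm L.w (by omega) (by omega)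
  have h2 := L.w_lt z
  have h3 : f.T L.w z < y := by
    by_contra h; push Not at h; exact h1 ⟨h, by linarith⟩
  rcases q0.lt_or_eq with h | h
  · refine hm L.v h (by omega) ⟨by linarith [L.lt_v z], ?_⟩
    have := (f.T_lt_iff (-L.w)).2 ((f.T_lt_iff L.v).2 h3)
    rw [f.T_comm L.v, f.T_neg_T] at this
    exact this
  · refine hm (L.v + L.w) (by simp; omega) (by simp; omega) ⟨?_, ?_⟩
    · have : z < f.T (L.v + L.w) z := f.T_pos (by rw [f.val_add]; exact L.hlt) z
      linarith
    · rw [f.T_add]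
      have := (f.T_lt_iff L.v).2 h3
      linarith [L.lt_psi (f.T L.v y)]

/-- critical points of the short return -/
def Spot (y : ℝ) : Prop := ∃ i : ℕ, i < L.q ∧ f.d1 (f.F^[i] y) = 0

theorem exists_spot (y : ℝ) : ∃ z, L.Spot z ∧ y ≤ z ∧ z < f.T (-L.w) (f.T L.v y) := by
  obtain ⟨c, hc⟩ := f.exists_crit
  obtain ⟨Q, p, hQ, h1, h2⟩ := L.spot_exists c y
  refine ⟨_, ⟨Q, hQ, ?_⟩, h1, h2⟩
  rw [f.iter_eq_T, ← f.T_add]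
  have e : ((Q : ℤ), (0 : ℤ)) + (-(Q : ℤ), p) = (0, p) := by simp
  rw [e, f.T_int]
  have := f.crit_add_int hc (-p)
  push_cast at this
  rwa [sub_eq_add_neg]

end Level

namespace Nice
variable (f : Nice)

theorem RBs : ∃ C, 1 ≤ C ∧ ∀ (L : Level f) x,
    L.ss (f.T L.v x) ≤ C * L.ss x ∧ L.ss x ≤ C * L.ss (f.T L.v x) := f.RB

theorem RBw : ∃ C, 1 ≤ C ∧ ∀ (L : Level f) x,
    L.us (f.T L.w x) ≤ C * L.us x ∧ L.us x ≤ C * L.us (f.T L.w x) := by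
  obtain ⟨C, hC, h⟩ := f.reflect.RB
  refine ⟨C, hC, fun L x => ?_⟩
  have := h L.next (-x)
  rw [Level.next_v, f.T_reflect, sg_sg] at this
  rw [L.us_next, L.us_next]
  exact this

/-- slow variation of the long step -/
theorem slow : ∃ C, 1 ≤ C ∧ ∀ (L : Level f) x y, f.T (-L.v) x ≤ y → y ≤ f.T L.v x →
    L.ss y ≤ C * L.ss x := by
  obtain ⟨C, hC, h⟩ := f.RBs
  refine ⟨1 + C, by linarith, fun L x y h1 h2 => ?_⟩
  rcases le_total x y with hxy | hxy
  · have h3 : f.T L.v y ≤ f.T L.v (f.T L.v x) := (f.T_le_iff _).2 h2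
    have := (h L x).1
    simp only [Level.ss] at *
    linarith
  · have h3 : f.T L.v y ≤ f.T L.v x := (f.T_le_iff _).2 hxy
    have := (h L (f.T (-L.v) x)).2
    simp only [Level.ss, f.T_T_neg] at *
    linarith

/-- two-step exponential decay -/
theorem decay : ∃ θ : ℝ, 0 < θ ∧ θ < 1 ∧ ∀ (L : Level f) x,
    f.T (L.v + L.nextK • L.w) x - x ≤ θ * L.ss x := by
  obtain ⟨C, hC, h⟩ := f.RBw
  refine ⟨C / (1 + C), by positivity, by rw [div_lt_one (by linarith)]; linarith, fun L x => ?_⟩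
  set z := f.T (L.v + L.nextK • L.w) x with hz
  have e1 : f.T L.w z < x := by
    rw [hz, ← f.T_add]; apply f.T_neg
    have := L.next.hlt
    rw [Level.next_v, Level.next_w, f.val_reflect, f.val_reflect] at this
    rw [f.val_add]; linarith
  have e2 : f.T (-L.w) z ≤ f.T L.v x := by
    rw [hz, ← f.T_add]; apply f.T_mono_val_le
    have k1 : 1 ≤ L.nextK := by
      by_contra hk
      have hk0 : L.nextK ≤ 0 := by omega
      have h0 := L.next.hlt
      rw [Level.next_v, Level.next_w, f.val_reflect, f.val_reflect, f.val_add, f.val_zsmul] at h0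
      have h1 : (L.nextK : ℝ) ≤ 0 := by exact_mod_cast hk0
      nlinarith [L.hlt, L.hw]
    have k2 : (1 : ℝ) ≤ L.nextK := by exact_mod_cast k1
    rw [f.val_add, f.val_neg, f.val_add, f.val_zsmul]
    nlinarith [L.hw]
  have e3 := (h L (f.T (-L.w) z)).1
  rw [f.T_T_neg] at e3
  simp only [Level.us, Level.ss, f.T_T_neg] at *
  rw [div_mul_eq_mul_div, le_div_iff₀ (by linarith)]
  have e4 : z - x ≤ C * (f.T L.v x - z) :=
    le_trans (by linarith) (e3.trans (mul_le_mul_of_nonneg_left (by linarith) (by linarith)))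
  linarith

/-- pull back a lower bound of the short step -/
theorem pullback : ∃ C, 1 ≤ C ∧ ∀ (L : Level f) (κ : ℝ) (i p : ℤ) y, 0 < κ → κ ≤ 1 → 0 ≤ i → i ≤ L.w.1 →
    κ * L.ss (f.T (i, p) y) ≤ L.us (f.T (i, p) y) → κ * L.ss y ≤ C * L.us y := by
  obtain ⟨E, hE, hcr⟩ := f.crT
  obtain ⟨C, hC, h⟩ := f.RBs
  refine ⟨Real.exp (E * (1 * 3)) * (2 * (1 + C)), ?_, fun L κ i p y hκ hκ1 hi0 hi1 hz => ?_⟩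
  · have : 1 ≤ Real.exp (E * (1 * 3)) := Real.one_le_exp (by positivity)
    exact one_le_mul_of_one_le_of_one_le this (by linarith)
  have h12 := L.w_lt y
  have h23 := L.lt_v y
  have h34 := L.lt_v (f.T L.v y)
  have hle : f.T L.v (f.T L.v y) ≤ f.T (3 • L.v) (f.T L.w y) := by
    rw [← f.T_add, ← f.T_add]; apply f.T_mono_val_le
    have e : 3 • L.v + L.w = L.v + L.v + (L.v + L.w) := by abel
    rw [e, f.val_add (L.v + L.v), f.val_add L.v L.w]; linarith [L.hlt]
  have key := hcr L 1 3 i p hi0 (by simpa using hi1) _ _ _ _ h12 h23 h34 hle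
  set z := f.T (i, p) y with hzd
  rw [f.T_comm _ L.w, f.T_comm (i, p) L.v (f.T L.v y), f.T_comm (i, p) L.v y, ← hzd] at key
  have low := cr_ge (a := f.T L.w z) (b := z) (c := f.T L.v z) (d := f.T L.v (f.T L.v z))
      (α := κ / 2) (β := (1 + C)⁻¹) (L.w_lt z) (L.lt_v z) (L.lt_v _) (by positivity) (by positivity)
      (by
        have := L.us_pos z
        have e : κ / 2 * (f.T L.v z - f.T L.w z) = (κ * L.ss z + κ * L.us z) / 2 := by
          simp only [Level.ss, Level.us]; ring
        have e2 : κ * L.us z ≤ L.us z := by nlinarith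
        rw [e]; simp only [Level.us] at *; linarith)
      (by
        rw [inv_mul_le_iff₀ (by linarith)]
        have := (h L z).2
        simp only [Level.ss] at *; linarith)
  have lk := low.trans key
  push_cast at lk
  obtain ⟨X, hX⟩ : ∃ x : ℝ, x = Real.exp (E * (1 * 3)) := ⟨_, rfl⟩
  have hX0 : 0 < X := by rw [hX]; positivity
  rw [← hX] at lk ⊢
  have hk : κ / (X * (2 * (1 + C))) ≤ cr (f.T L.w y) y (f.T L.v y) (f.T L.v (f.T L.v y)) := by
    rw [div_le_iff₀ (by positivity)]
    have : κ = (κ / 2 * (1 + C)⁻¹) * (2 * (1 + C)) := by field_simp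
    rw [this]
    calc _ ≤ (X * cr (f.T L.w y) y (f.T L.v y) (f.T L.v (f.T L.v y))) * (2 * (1 + C)) := by gcongr
      _ = _ := by ring
  have := (cr_low h12 h23 h34 (by positivity) hk).1
  rw [div_mul_eq_mul_div, div_le_iff₀ (by positivity)] at this
  have h5 := L.us_pos y
  simp only [Level.ss, Level.us] at *
  nlinarith

/-- contraction at a critical point -/
theorem crit_contr : ∃ r C σ : ℝ, 0 < r ∧ 1 ≤ C ∧ 0 < σ ∧ ∀ z, f.d1 z = 0 → ∀ θ l, 0 ≤ θ → θ ≤ 1 →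
    0 ≤ l → l < r → f.F (z + θ * l) - f.F z ≤ C * θ ^ σ * θ * (f.F (z + l) - f.F z) := by
  obtain ⟨r, C, σ, hr, -, hC, hσ, h⟩ := f.unif
  refine ⟨r, C, σ, hr, hC, hσ, fun z hz θ l h0 h1 hl hlr => ?_⟩
  have hc := f.contF
  have := incr (F := fun t => C * θ ^ σ * θ * f.F (z + t) - f.F (z + θ * t))
    (F' := fun t => C * θ ^ σ * θ * f.d1 (z + t) - f.d1 (z + θ * t) * θ) hl (by fun_prop)
    (fun t _ => by
      have a1 : HasDerivAt (fun t => f.F (z + t)) (f.d1 (z + t)) t :=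
        ((f.hF (z + t)).comp t ((hasDerivAt_id t).const_add z)).congr_deriv (by ring)
      have a2 : HasDerivAt (fun t => f.F (z + θ * t)) (f.d1 (z + θ * t) * θ) t :=
        ((f.hF (z + θ * t)).comp t (((hasDerivAt_id t).const_mul θ).const_add z)).congr_deriv (by ring)
      exact (a1.const_mul _).sub a2)
    (fun t ht => by
      have e1 : |z + t - z| = t := by rw [add_sub_cancel_left, abs_of_pos ht.1]
      have h2 := (h z hz (z + t) (by rw [e1]; linarith [ht.2])).2.2 (z + θ * t) θ h0 h1
        (by rw [e1, add_sub_cancel_left, abs_of_nonneg (by have := ht.1; positivity)])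
      nlinarith)
  simp only [mul_zero, add_zero] at this
  nlinarith


theorem crit_u : ∃ r c : ℝ, 0 < r ∧ 0 < c ∧ c ≤ 1 ∧ ∀ (L : Level f) z, (∀ x, L.ss x < r) → f.d1 z = 0 →
    c * L.ss z ≤ L.us z := by
  obtain ⟨E, hE, hcr⟩ := f.crT
  obtain ⟨S, hS, slow⟩ := f.slow
  obtain ⟨R, hR, RBw⟩ := f.RBw
  obtain ⟨r, C, σ, hr, hC, hσ, hcc⟩ := f.crit_contr
  obtain ⟨X, hX⟩ : ∃ x : ℝ, x = Real.exp (E * (1 * 2)) := ⟨_, rfl⟩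
  have hX0 : 0 < X := by rw [hX]; positivity
  obtain ⟨D, hD⟩ : ∃ D : ℝ, D = X * C * R * (S * (S * (1 + S))) := ⟨_, rfl⟩
  have hD0 : 0 < D := by rw [hD]; positivity
  refine ⟨r, min 1 ((D⁻¹) ^ (1 / σ) / R), hr, by positivity, min_le_left _ _, fun L z hs hz => ?_⟩
  set x2 := f.T (-L.w) z with hx2
  set x3 := f.T L.v z with hx3
  set x4 := f.T L.v x3 with hx4
  have h12 : z < x2 := L.lt_psi z
  have h23 : x2 < x3 := L.psi_lt_v z
  have h34 : x3 < x4 := L.lt_v x3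
  have hl : 0 < L.ss z := L.ss_pos z
  have hu : 0 < L.us z := L.us_pos z
  have e3 : x3 = z + L.ss z := by simp only [Level.ss, hx3]; ring
  obtain ⟨θ, hθ⟩ : ∃ θ : ℝ, θ = (x2 - z) / L.ss z := ⟨_, rfl⟩
  have hθ0 : 0 < θ := by rw [hθ]; exact div_pos (by linarith) hl
  have hθl : θ * L.ss z = x2 - z := by rw [hθ, div_mul_cancel₀ _ hl.ne']
  have hθ1 : θ ≤ 1 := by
    rw [hθ, div_le_one hl]; linarith
  -- cross ratio of images under F
  have hF := hcc z hz θ (L.ss z) hθ0.le hθ1 hl.le (hs z)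
  rw [hθl, ← e3, show z + (x2 - z) = x2 by ring] at hF
  have f12 := f.mono h12
  have f23 := f.mono h23
  have f34 := f.mono h34
  have up : cr (f.F z) (f.F x2) (f.F x3) (f.F x4) ≤ C * θ ^ σ * θ := by
    rw [cr, div_le_iff₀ (mul_pos (by linarith) (by linarith))]
    have hnn : 0 ≤ C * θ ^ σ * θ * (f.F x3 - f.F z) :=
      mul_nonneg (by positivity) (by linarith)
    calc _ ≤ (C * θ ^ σ * θ * (f.F x3 - f.F z)) * (f.F x4 - f.F x2) :=
          mul_le_mul hF (by linarith) (by linarith) hnn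
      _ = _ := by ring
  have key := hcr L 1 2 (L.w.1 - 1) L.w.2 (by linarith [L.w1]) (by push_cast; linarith)
    _ _ _ _ f12 f23 f34 (by rw [hx4, hx3, f.F_T, f.F_T, ← f.T_add, two_nsmul])
  have comp : ∀ y, f.T (L.w.1 - 1, L.w.2) (f.F y) = f.T L.w y := by
    intro y; rw [f.F_eq_T, ← f.T_add]; congr 1; ext <;> simp
  simp only [comp] at key
  rw [hx2, f.T_T_neg, ← hx2] at key
  have h5 := key.trans (mul_le_mul_of_nonneg_left up (Real.exp_pos _).le)
  push_cast at h5
  rw [← hX] at h5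
  -- lower bound
  have s1 : L.ss (f.T L.w z) ≤ S * L.ss z :=
    slow L z _ (L.vinv_lt_w z).le ((L.w_lt z).trans (L.lt_v z)).le
  have hzz : z < f.T L.w x3 := by
    rw [hx3, ← f.T_add]; apply f.T_pos; rw [f.val_add]; linarith [L.hlt]
  have s2 : L.ss z ≤ S * L.ss (f.T L.w x3) := by
    apply slow L
    · have h6 : f.T L.w x3 ≤ x3 := (L.w_lt x3).le
      have := (f.T_le_iff (-L.v)).2 h6
      rwa [hx3, f.T_neg_T, ← hx3] at this
    · linarith [L.lt_v (f.T L.w x3)]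
  have s3 : L.ss x3 ≤ S * L.ss z := slow L z _ (by linarith [L.vinv_lt z]) le_rfl
  have g1 : f.T L.w x3 = f.T L.w z + L.ss (f.T L.w z) := by
    rw [hx3, f.T_comm]; simp only [Level.ss]; ring
  have g2 : f.T L.w x4 = f.T L.w x3 + L.ss (f.T L.w x3) := by
    rw [hx4, f.T_comm]; simp only [Level.ss]; ring
  have g3 : x4 = x3 + L.ss x3 := by simp only [Level.ss, hx4]; ring
  have hwx4 := L.w_lt x4
  have p1 := L.ss_pos (f.T L.w x3)
  have p2 := L.ss_pos (f.T L.w z)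
  have low : L.us z / L.ss z ≤ S * (S * (1 + S)) * cr (f.T L.w z) z (f.T L.w x3) (f.T L.w x4) := by
    have d1 : 0 < f.T L.w x3 - f.T L.w z := by linarith
    have d2 : 0 < f.T L.w x4 - z := by linarith
    have hden : (f.T L.w x3 - f.T L.w z) * (f.T L.w x4 - z) ≤ (S * L.ss z) * ((1 + S) * L.ss z) :=
      mul_le_mul (by linarith) (by linarith) (by linarith) (by positivity)
    have hus : z - f.T L.w z = L.us z := rfl
    rw [cr, mul_div_assoc', div_le_div_iff₀ hl (by positivity), hus]
    have hss : f.T L.w x4 - f.T L.w x3 = L.ss (f.T L.w x3) := by linarith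
    rw [hss]
    calc L.us z * ((f.T L.w x3 - f.T L.w z) * (f.T L.w x4 - z))
        ≤ L.us z * ((S * L.ss z) * ((1 + S) * L.ss z)) := by gcongr
      _ = L.us z * (S * (1 + S)) * L.ss z * L.ss z := by ring
      _ ≤ L.us z * (S * (1 + S)) * (S * L.ss (f.T L.w x3)) * L.ss z := by gcongr
      _ = _ := by ring
  have low2 : L.us z / L.ss z ≤ S * (S * (1 + S)) * (X * (C * θ ^ σ * θ)) :=
    low.trans (by gcongr)
  -- θ ≤ R τ
  have hb := (RBw L x2).2
  rw [hx2, f.T_T_neg] at hb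
  have hbu : L.us (f.T (-L.w) z) = x2 - z := by simp only [Level.us, f.T_T_neg, hx2]
  rw [hbu] at hb
  have hθR : θ ≤ R * (L.us z / L.ss z) := by
    rw [hθ, mul_div_assoc']; gcongr
  have hone : 1 ≤ D * θ ^ σ := by
    have h7 : θ ≤ D * θ ^ σ * θ := by
      calc θ ≤ R * (L.us z / L.ss z) := hθR
        _ ≤ R * (S * (S * (1 + S)) * (X * (C * θ ^ σ * θ))) := by gcongr
        _ = D * θ ^ σ * θ := by rw [hD]; ring
    by_contra hn
    push Not at hn
    nlinarith
  have hθlow : (D⁻¹) ^ (1 / σ) ≤ θ := by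
    have h8 : D⁻¹ ≤ θ ^ σ := by rw [inv_le_iff_one_le_mul₀ hD0]; linarith
    calc (D⁻¹) ^ (1 / σ) ≤ (θ ^ σ) ^ (1 / σ) := Real.rpow_le_rpow (by positivity) h8 (by positivity)
      _ = θ := by rw [← Real.rpow_mul hθ0.le, mul_one_div_cancel hσ.ne', Real.rpow_one]
  have hfin : (D⁻¹) ^ (1 / σ) / R ≤ L.us z / L.ss z := by
    rw [div_le_iff₀ (by linarith)]; linarith
  have : min 1 ((D⁻¹) ^ (1 / σ) / R) ≤ L.us z / L.ss z := (min_le_right _ _).trans hfin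
  rwa [le_div_iff₀ hl] at this

/-- lower bound of the short step along the orbit of a spot -/
theorem spot_u : ∃ r c : ℝ, 0 < r ∧ 0 < c ∧ c ≤ 1 ∧ ∀ (L : Level f) y, (∀ x, L.ss x < r) → L.Spot y →
    ∀ (j : ℕ) (p : ℤ), j ≤ L.q → c * L.ss (f.T ((j : ℤ), p) y) ≤ L.us (f.T ((j : ℤ), p) y) := by
  obtain ⟨r, c, hr, hc, hc1, H⟩ := f.crit_u
  obtain ⟨R, hR, RBw⟩ := f.RBw
  obtain ⟨S, hS, slow⟩ := f.slow
  obtain ⟨P, hP, pb⟩ := f.pullback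
  have hRS : 1 ≤ R * S := one_le_mul_of_one_le_of_one_le hR hS
  have hk1 : c / (R * S) ≤ 1 := by rw [div_le_one (by positivity)]; linarith
  have hkc : c / (R * S) ≤ c := div_le_self hc.le hRS
  refine ⟨r, c / (R * S) / P, hr, by positivity, ?_, fun L y hs hy j p hj => ?_⟩
  · exact (div_le_self (by positivity) hP).trans hk1
  obtain ⟨i, hi, hcr⟩ := hy
  have hq := L.q_cast
  have h1 := H L _ hs hcr
  rw [div_mul_eq_mul_div, div_le_iff₀ (by linarith), mul_comm (L.us _)]
  rcases le_total j i with hji | hij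
  · apply pb L _ ((i : ℤ) - j) (-p) _ (by positivity) hk1 (by omega) (by omega)
    have e : f.T ((i : ℤ) - j, -p) (f.T ((j : ℤ), p) y) = f.F^[i] y := by
      rw [f.iter_eq_T, ← f.T_add]; congr 1; simp
    rw [e]
    exact (mul_le_mul_of_nonneg_right hkc (L.ss_pos _).le).trans h1
  · apply pb L _ (L.w.1 + i - j) (L.w.2 - p) _ (by positivity) hk1 (by omega) (by omega)
    have e : f.T (L.w.1 + i - j, L.w.2 - p) (f.T ((j : ℤ), p) y) = f.T L.w (f.F^[i] y) := by
      rw [f.iter_eq_T, ← f.T_add, ← f.T_add]; congr 1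
      ext <;> simp
    rw [e]
    have h2 := (RBw L (f.F^[i] y)).2
    have h3 : L.ss (f.T L.w (f.F^[i] y)) ≤ S * L.ss (f.F^[i] y) :=
      slow L _ _ (L.vinv_lt_w _).le ((L.w_lt _).trans (L.lt_v _)).le
    rw [div_mul_eq_mul_div, div_le_iff₀ (by positivity)]
    calc c * L.ss (f.T L.w (f.F^[i] y)) ≤ c * (S * L.ss (f.F^[i] y)) := by gcongr
      _ = S * (c * L.ss (f.F^[i] y)) := by ring
      _ ≤ S * (R * L.us (f.T L.w (f.F^[i] y))) := mul_le_mul_of_nonneg_left (h1.trans h2) (by linarith)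
      _ = _ := by ring

end Nice

theorem chordc {V V1 V2 : ℝ → ℝ} {a b : ℝ} (h1 : ∀ x ∈ Icc a b, HasDerivAt V (V1 x) x)
    (h2 : ∀ x ∈ Icc a b, HasDerivAt V1 (V2 x) x) (h3 : ∀ x ∈ Icc a b, 0 ≤ V2 x)
    {x y z : ℝ} (hx : a ≤ x) (hxy : x ≤ y) (hyz : y ≤ z) (hz : z ≤ b) :
    V y * (z - x) ≤ V x * (z - y) + V z * (y - x) := by
  rcases hxy.lt_or_eq with hxy | rfl
  swap
  · linarith
  rcases hyz.lt_or_eq with hyz | rfl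
  swap
  · linarith
  obtain ⟨p, hp, ep⟩ := mvt' hxy (fun t ht => h1 t ⟨by linarith [ht.1], by linarith [ht.2]⟩)
  obtain ⟨q, hq, eq⟩ := mvt' hyz (fun t ht => h1 t ⟨by linarith [ht.1], by linarith [ht.2]⟩)
  have hpq : p ≤ q := by linarith [hp.2, hq.1]
  have hsub : ∀ t ∈ Icc p q, t ∈ Icc a b := fun t ht =>
    ⟨by linarith [ht.1, hp.1], by linarith [ht.2, hq.2]⟩
  have mono : V1 p ≤ V1 q := incr hpq
    (fun t ht => (h2 t (hsub t ht)).continuousAt.continuousWithinAt)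
    (fun t ht => h2 t (hsub t (Ioo_subset_Icc_self ht))) (fun t ht => h3 t (hsub t (Ioo_subset_Icc_self ht)))
  have := mul_nonneg (mul_nonneg (sub_nonneg.2 mono) (sub_pos.2 hxy).le) (sub_pos.2 hyz).le
  have e1 : V x = V y - V1 p * (y - x) := by linarith
  have e2 : V z = V y + V1 q * (z - y) := by linarith
  rw [e1, e2]; nlinarith

theorem qchord {V V1 V2 : ℝ → ℝ} {a b D : ℝ} (h1 : ∀ x ∈ Icc a b, HasDerivAt V (V1 x) x)
    (h2 : ∀ x ∈ Icc a b, HasDerivAt V1 (V2 x) x) (h3 : ∀ x ∈ Icc a b, -D ≤ V2 x) (e : ℝ)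
    {x y z : ℝ} (hx : a ≤ x) (hxy : x ≤ y) (hyz : y ≤ z) (hz : z ≤ b) :
    (V y + D / 2 * (y - e) ^ 2) * (z - x) ≤ (V x + D / 2 * (x - e) ^ 2) * (z - y) +
      (V z + D / 2 * (z - e) ^ 2) * (y - x) := by
  refine chordc (a := a) (b := b) (V := fun x => V x + D / 2 * (x - e) ^ 2) (V1 := fun x => V1 x + D * (x - e))
      (V2 := fun x => V2 x + D) ?_ ?_ ?_ hx hxy hyz hz
  · intro x hx
    have e := (((hasDerivAt_id x).sub_const e).pow 2).const_mul (D / 2)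
    exact ((h1 x hx).add e).congr_deriv (by simp; ring)
  · intro x hx
    exact ((h2 x hx).add (((hasDerivAt_id x).sub_const e).const_mul D)).congr_deriv (by ring)
  · intro x hx; linarith [h3 x hx]

/-- data for the parabolic lemma on `[A,B]` -/
structure Parab (A A' B' B Λ κ δ : ℝ) (U p v v1 v2 : ℝ → ℝ) : Prop where
  hAA : κ ≤ A' - A
  hAB : A' ≤ B'
  hBB : κ ≤ B - B'
  hlen : B - A ≤ Λ
  hκ : 0 < κ
  hκ1 : κ ≤ 1
  hΛ : 1 ≤ Λ
  hδ : 0 ≤ δ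
  hU : ∀ x ∈ Icc A B, HasDerivAt U (1 - p x) x
  hv : ∀ x ∈ Icc A B, HasDerivAt v (v1 x) x
  hv1 : ∀ x ∈ Icc A B, HasDerivAt v1 (v2 x) x
  hv2 : ∀ x ∈ Icc A B, -(δ * v x) ≤ v2 x
  vpos : ∀ x ∈ Icc A B, 0 < v x
  pv : ∀ x ∈ Icc A B, p x * v x ^ 2 = 1
  pL : ∀ x ∈ Icc A B, p x ≤ Λ
  vA : v A ≤ Λ
  vB : v B ≤ Λ
  Upos : ∀ x ∈ Icc A' B', 0 < U x
  Ule : ∀ x ∈ Icc A' B', U x ≤ Λ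
  UA : κ ≤ U A'
  UB : κ ≤ U B'

namespace Parab
variable {A A' B' B Λ κ δ : ℝ} {U p v v1 v2 : ℝ → ℝ}

theorem ppos (h : Parab A A' B' B Λ κ δ U p v v1 v2) {x : ℝ} (hx : x ∈ Icc A B) : 0 < p x := by
  have h1 := h.pv x hx
  have h2 := h.vpos x hx
  by_contra hn
  push Not at hn
  nlinarith [pow_pos h2 2]

theorem vle (h : Parab A A' B' B Λ κ δ U p v v1 v2) (hδ : δ * Λ ^ 2 ≤ 1) :
    ∀ x ∈ Icc A B, v x ≤ 2 * Λ := by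
  have hAB : A < B := by linarith [h.hAA, h.hAB, h.hBB, h.hκ]
  have hc : ContinuousOn v (Icc A B) := fun x hx => (h.hv x hx).continuousAt.continuousWithinAt
  obtain ⟨m, hm, hmax⟩ := isCompact_Icc.exists_isMaxOn (nonempty_Icc.2 hAB.le) hc
  have hmax' : ∀ x ∈ Icc A B, v x ≤ v m := fun x hx => hmax hx
  suffices hs : v m ≤ 2 * Λ from fun x hx => (hmax' x hx).trans hs
  have hΛ := h.hΛ
  rcases hm.1.eq_or_lt with e | hA
  · rw [← e]; linarith [h.vA]
  rcases hm.2.eq_or_lt with e | hB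
  · rw [e]; linarith [h.vB]
  have hvm := h.vpos m hm
  have hD : ∀ x ∈ Icc A B, -(δ * v m) ≤ v2 x := fun x hx => by
    have := h.hv2 x hx
    have h5 : δ * v x ≤ δ * v m := mul_le_mul_of_nonneg_left (hmax' x hx) h.hδ
    linarith
  have ch := qchord h.hv h.hv1 hD A le_rfl hA.le hB.le le_rfl
  have e1 : v A * (B - m) ≤ Λ * (B - m) := mul_le_mul_of_nonneg_right h.vA (by linarith)
  have e2 : (v B + δ * v m / 2 * (B - A) ^ 2) * (m - A) ≤ (Λ + v m / 2) * (m - A) := by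
    refine mul_le_mul_of_nonneg_right (add_le_add h.vB ?_) (by linarith)
    have h6 : (B - A) ^ 2 ≤ Λ ^ 2 := pow_le_pow_left₀ (by linarith) h.hlen 2
    calc δ * v m / 2 * (B - A) ^ 2 ≤ δ * v m / 2 * Λ ^ 2 :=
          mul_le_mul_of_nonneg_left h6 (by have := h.hδ; positivity)
      _ = (δ * Λ ^ 2) * (v m / 2) := by ring
      _ ≤ 1 * (v m / 2) := by gcongr
      _ = _ := one_mul _
  have e3 : 0 ≤ δ * v m / 2 * (m - A) ^ 2 * (B - A) := by
    have := h.hδ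
    have : 0 ≤ B - A := by linarith
    positivity
  have e4 : v m * (B - A) ≤ (Λ + v m / 2) * (B - A) := by
    have : v m / 2 * (B - m) ≥ 0 := mul_nonneg (by linarith) (by linarith)
    nlinarith
  have := le_of_mul_le_mul_right e4 (by linarith)
  linarith

/-- second derivative bound with uniform constant -/
theorem v2low (h : Parab A A' B' B Λ κ δ U p v v1 v2) (hδ : δ * Λ ^ 2 ≤ 1) :
    ∀ x ∈ Icc A B, -(2 * Λ * δ) ≤ v2 x := by
  intro x hx
  have h1 := h.vle hδ x hx
  have h2 := h.hv2 x hx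
  have := mul_le_mul_of_nonneg_left h1 h.hδ
  linarith

theorem v1bd (h : Parab A A' B' B Λ κ δ U p v v1 v2) (hδ : δ * Λ ^ 2 ≤ 1) :
    ∀ x ∈ Icc A' B', |v1 x| ≤ 4 * Λ / κ := by
  intro x hx
  have hκ := h.hκ
  have hκ1 := h.hκ1
  have hΛ := h.hΛ
  have h1 := h.hAA
  have h2 := h.hBB
  have hlen := h.hlen
  have hd := h.hδ
  have hx1 := hx.1
  have hx2 := hx.2
  have vl := h.vle hδ
  have D := h.v2low hδ
  have hDL : 2 * Λ * δ * Λ ≤ 2 := by nlinarith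
  have key : ∀ a b, a ∈ Icc A B → b ∈ Icc A B → a ≤ b → v1 a + 2 * Λ * δ * a ≤ v1 b + 2 * Λ * δ * b := by
    intro a b ha hb hab
    refine incr (F := fun t => v1 t + 2 * Λ * δ * t) (F' := fun t => v2 t + 2 * Λ * δ) hab ?_ ?_ ?_
    · intro t ht
      have ht' : t ∈ Icc A B := ⟨by linarith [ht.1, ha.1], by linarith [ht.2, hb.2]⟩
      exact ((h.hv1 t ht').continuousAt.add (by fun_prop)).continuousWithinAt
    · intro t ht
      have ht' : t ∈ Icc A B := ⟨by linarith [ht.1, ha.1], by linarith [ht.2, hb.2]⟩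
      exact ((h.hv1 t ht').add ((hasDerivAt_id t).const_mul (2 * Λ * δ))).congr_deriv (by ring)
    · intro t ht
      have ht' : t ∈ Icc A B := ⟨by linarith [ht.1, ha.1], by linarith [ht.2, hb.2]⟩
      linarith [D t ht']
  have hxI : x ∈ Icc A B := ⟨by linarith, by linarith⟩
  have conv : ∀ w, w * κ ≤ 4 * Λ → w ≤ 4 * Λ / κ := fun w hw => by rwa [le_div_iff₀ hκ]
  rw [abs_le']
  constructor
  · obtain ⟨q, hq, eq⟩ := mvt' (show x < B by linarith)
      (fun t ht => h.hv t ⟨by linarith [ht.1], by linarith [ht.2]⟩)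
    have hqI : q ∈ Icc A B := ⟨by linarith [hq.1], by linarith [hq.2]⟩
    have k := key x q hxI hqI hq.1.le
    have b1 := vl B ⟨by linarith, le_rfl⟩
    have b2 := h.vpos x hxI
    have : v1 q * (B - x) ≤ 2 * Λ := by linarith
    have hqx : 2 * Λ * δ * (q - x) ≤ 2 * Λ * δ * Λ :=
      mul_le_mul_of_nonneg_left (by linarith [hq.2]) (by positivity)
    apply conv
    by_cases hs : v1 q ≤ 0
    · nlinarith
    · push Not at hs
      have : v1 q * κ ≤ v1 q * (B - x) := mul_le_mul_of_nonneg_left (by linarith) hs.le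
      nlinarith
  · obtain ⟨q, hq, eq⟩ := mvt' (show A < x by linarith)
      (fun t ht => h.hv t ⟨by linarith [ht.1], by linarith [ht.2]⟩)
    have hqI : q ∈ Icc A B := ⟨by linarith [hq.1], by linarith [hq.2]⟩
    have k := key q x hqI hxI hq.2.le
    have b1 := vl A ⟨le_rfl, by linarith⟩
    have b2 := h.vpos x hxI
    have : -v1 q * (x - A) ≤ 2 * Λ := by linarith
    have hqx : 2 * Λ * δ * (x - q) ≤ 2 * Λ * δ * Λ :=
      mul_le_mul_of_nonneg_left (by linarith [hq.1]) (by positivity)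
    apply conv
    by_cases hs : -v1 q ≤ 0
    · nlinarith
    · push Not at hs
      have : -v1 q * κ ≤ -v1 q * (x - A) := mul_le_mul_of_nonneg_left (by linarith) hs.le
      nlinarith

end Parab

namespace Parab
variable {A A' B' B Λ κ δ : ℝ} {U p v v1 v2 : ℝ → ℝ}

theorem alg1 {p v s Λ : ℝ} (h : p * v ^ 2 = 1) (hp : 0 < p) (hv : 0 < v) (hs : 0 ≤ s) (hpΛ : p ≤ Λ)
    (hvs : 1 - s ≤ v) : -(2 * Λ * s) ≤ 1 - p := by
  have e : 1 - p = p * (v + 1) * (v - 1) := by linear_combination -h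
  have hΛ : 0 < Λ := by linarith
  rw [e]
  by_cases h1 : 1 ≤ v
  · have : 0 ≤ p * (v + 1) * (v - 1) := mul_nonneg (by positivity) (by linarith)
    have : 0 ≤ 2 * Λ * s := by positivity
    linarith
  · push Not at h1
    have h2 : p * (v + 1) ≤ 2 * Λ := by nlinarith
    have h3 : p * (v + 1) * (1 - v) ≤ 2 * Λ * s :=
      mul_le_mul h2 (by linarith) (by linarith) (by positivity)
    linarith

theorem alg2 {p v s : ℝ} (h : p * v ^ 2 = 1) (hp : 0 < p) (hv : 0 < v) (hs : 0 ≤ s)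
    (hvs : v ≤ 1 - s) : 1 - p ≤ -s := by
  have e : 1 - p = p * (v + 1) * (v - 1) := by linear_combination -h
  have h1 : 1 ≤ p * (v + 1) := by
    have : v ^ 2 ≤ v := by nlinarith
    have : p * v ^ 2 ≤ p * v := mul_le_mul_of_nonneg_left this hp.le
    linarith
  have : 1 * s ≤ p * (v + 1) * (1 - v) := mul_le_mul h1 (by linarith) hs (by linarith)
  linarith

theorem alg3 {p v s : ℝ} (h : p * v ^ 2 = 1) (hp : 0 < p) (hv : 0 < v) (hs : 0 ≤ s) (hs1 : s ≤ 1)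
    (hvs : 1 + s ≤ v) : s / 2 ≤ 1 - p := by
  have h1 : (1 + s) ^ 2 ≤ v ^ 2 := pow_le_pow_left₀ (by linarith) hvs 2
  have h2 : p * (1 + s) ^ 2 ≤ 1 := (mul_le_mul_of_nonneg_left h1 hp.le).trans h.le
  nlinarith [mul_nonneg hp.le hs, mul_nonneg hp.le (sq_nonneg s)]

theorem alg4 {p v s Λ : ℝ} (h : p * v ^ 2 = 1) (hp : 0 < p) (hv : 0 < v) (hΛ : 1 ≤ Λ) (hpΛ : p ≤ Λ)
    (hvs : |v - 1| ≤ s) : |1 - p| ≤ 2 * Λ * s := by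
  have e : 1 - p = p * (v + 1) * (v - 1) := by linear_combination -h
  have h1 : p * v ≤ Λ := by
    by_cases hv1 : v ≤ 1
    · nlinarith
    · push Not at hv1
      nlinarith [mul_pos hp hv]
  rw [e, abs_mul, abs_of_pos (by positivity)]
  exact mul_le_mul (by linarith) hvs (abs_nonneg _) (by linarith)

theorem drop (h : Parab A A' B' B Λ κ δ U p v v1 v2) {e x b0 : ℝ} (he : 0 ≤ e) (hx : A' ≤ x)
    (hxb : x ≤ b0) (hb : b0 ≤ B') (hl : ∀ l ∈ Icc A' x, 1 - e * (b0 - l) ≤ v l) :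
    κ - 2 * e * Λ ^ 3 ≤ U x := by
  have h1 := h.hAA
  have h2 := h.hBB
  have h3 := h.hκ
  have h4 := h.hΛ
  have h5 := h.hlen
  have hUA := h.UA
  rcases hx.eq_or_lt with rfl | hx
  · have : 0 ≤ 2 * e * Λ ^ 3 := by positivity
    linarith
  have hI : ∀ t ∈ Icc A' x, t ∈ Icc A B := fun t ht => ⟨by linarith [ht.1], by linarith [ht.2]⟩
  obtain ⟨t, ht, et⟩ := mvt' hx (fun t ht => h.hU t (hI t ht))
  have ht' := Ioo_subset_Icc_self ht
  have a1 := alg1 (h.pv t (hI t ht')) (h.ppos (hI t ht')) (h.vpos t (hI t ht'))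
    (mul_nonneg he (by linarith [ht.2])) (h.pL t (hI t ht')) (hl t ht')
  have a2 : (-(1 - p t)) * (x - A') ≤ (2 * Λ * (e * (b0 - t))) * (x - A') :=
    mul_le_mul_of_nonneg_right (by linarith) (by linarith)
  have a3 : (2 * Λ * (e * (b0 - t))) * (x - A') ≤ (2 * Λ * (e * Λ)) * Λ := by
    have : b0 - t ≤ Λ := by linarith [ht.1]
    have : e * (b0 - t) ≤ e * Λ := mul_le_mul_of_nonneg_left this he
    have : 2 * Λ * (e * (b0 - t)) ≤ 2 * Λ * (e * Λ) := mul_le_mul_of_nonneg_left this (by positivity)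
    exact mul_le_mul this (by linarith) (by linarith) (by positivity)
  nlinarith

set_option maxHeartbeats 1000000 in
theorem main (h : Parab A A' B' B Λ κ δ U p v v1 v2) (hδ : δ * (16 * Λ ^ 5) ≤ κ) :
    ∃ xs ∈ Icc A' B', ∀ x ∈ Icc A' B', U x ≤ 64 * Λ ^ 3 / κ * (U xs + (x - xs) ^ 2) ∧
      U xs + (x - xs) ^ 2 ≤ 64 * Λ ^ 3 / κ * U x := by
  have h1 := h.hAA
  have h2 := h.hBB
  have hAB := h.hAB
  have hκ := h.hκ
  have hκ1 := h.hκ1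
  have hΛ := h.hΛ
  have hlen := h.hlen
  have hd := h.hδ
  have hI : ∀ t ∈ Icc A' B', t ∈ Icc A B := fun t ht => ⟨by linarith [ht.1], by linarith [ht.2]⟩
  have hc : ContinuousOn U (Icc A' B') := fun x hx => (h.hU x (hI x hx)).continuousAt.continuousWithinAt
  obtain ⟨xs, hxs, hmin⟩ := isCompact_Icc.exists_isMinOn (nonempty_Icc.2 hAB) hc
  have hmin' : ∀ x ∈ Icc A' B', U xs ≤ U x := fun x hx => hmin hx
  have hΛ2 : Λ ≤ Λ ^ 2 := by first | linarith | nlinarith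
  have hΛ3 : Λ ^ 2 ≤ Λ ^ 3 := by first | linarith [mul_nonneg (sub_nonneg.2 hΛ) (sq_nonneg Λ)] | nlinarith [mul_nonneg (sub_nonneg.2 hΛ) (sq_nonneg Λ)]
  have hC1 : (64 : ℝ) ≤ 64 * Λ ^ 3 / κ := by
    rw [le_div_iff₀ hκ]; first | linarith | nlinarith
  obtain ⟨C, hC⟩ : ∃ C : ℝ, C = 64 * Λ ^ 3 / κ := ⟨_, rfl⟩
  have hCκ : C * κ = 64 * Λ ^ 3 := by rw [hC]; field_simp
  rw [← hC] at hC1 ⊢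
  have hdist : ∀ x ∈ Icc A' B', (x - xs) ^ 2 ≤ Λ ^ 2 := fun x hx => by
    have a1 : |x - xs| ≤ Λ := abs_le.2 ⟨by linarith [hx.1, hxs.2], by linarith [hx.2, hxs.1]⟩
    exact sq_le_sq' (by linarith [(abs_le.1 a1).1]) (abs_le.1 a1).2
  refine ⟨xs, hxs, ?_⟩
  have upos := h.Upos xs hxs
  -- crude bound
  have crude : ∀ x ∈ Icc A' B', κ / 2 ≤ U x → U xs + (x - xs) ^ 2 ≤ C * U x := fun x hx hU => by
    have := hdist x hx
    have := h.Ule xs hxs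
    have : C * (κ / 2) ≤ C * U x := mul_le_mul_of_nonneg_left hU (by linarith)
    first | linarith | nlinarith
  by_cases hus : κ / 2 ≤ U xs
  · intro x hx
    refine ⟨?_, crude x hx (hus.trans (hmin' x hx))⟩
    have := h.Ule x hx
    have : C * (κ / 2) ≤ C * (U xs + (x - xs) ^ 2) :=
      mul_le_mul_of_nonneg_left (by linarith [sq_nonneg (x - xs)]) (by linarith)
    first | linarith | nlinarith
  push Not at hus
  -- interior minimum
  have hxA : A' < xs := lt_of_le_of_ne hxs.1 (fun e => by rw [← e] at hus; linarith [h.UA])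
  have hxB : xs < B' := lt_of_le_of_ne hxs.2 (fun e => by rw [e] at hus; linarith [h.UB])
  have hloc : IsLocalMin U xs := hmin.isLocalMin (Icc_mem_nhds hxA hxB)
  have hp1 : p xs = 1 := by
    have := hloc.hasDerivAt_eq_zero (h.hU xs (hI xs hxs))
    linarith
  have hv1' : v xs = 1 := by
    have e := h.pv xs (hI xs hxs)
    rw [hp1, one_mul] at e
    have := h.vpos xs (hI xs hxs)
    first | linarith | nlinarith
  have hδ2 : δ * Λ ^ 2 ≤ 1 := by
    have : Λ ^ 2 ≤ 16 * Λ ^ 5 := by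
      have : Λ ^ 2 * 1 ≤ Λ ^ 2 * (16 * Λ ^ 3) := mul_le_mul_of_nonneg_left (by first | linarith | nlinarith) (by positivity)
      first | linarith | nlinarith
    have := mul_le_mul_of_nonneg_left this hd
    linarith
  have D := h.v2low hδ2
  obtain ⟨c, hcdef⟩ : ∃ c : ℝ, c = κ / (16 * Λ ^ 3) := ⟨_, rfl⟩
  have hcpos : 0 < c := by rw [hcdef]; positivity
  have hcκ : 16 * c * Λ ^ 3 = κ := by rw [hcdef]; field_simp
  have hδc : 2 * Λ * δ / 2 * Λ ≤ c := by
    have : (δ * Λ ^ 2) * (16 * Λ ^ 3) ≤ c * (16 * Λ ^ 3) := by first | linarith | nlinarith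
    have := le_of_mul_le_mul_right this (by positivity)
    first | linarith | nlinarith
  have hCc : C * c = 4 := by
    have : C * c * (16 * Λ ^ 3) = 4 * (16 * Λ ^ 3) := by
      calc C * c * (16 * Λ ^ 3) = C * κ := by rw [← hcκ]; ring
        _ = _ := by rw [hCκ]; ring
    exact mul_right_cancel₀ (by positivity) this
  obtain ⟨E, hE⟩ : ∃ E : ℝ, E = 2 * Λ * δ / 2 := ⟨_, rfl⟩
  have hE0 : 0 ≤ E := by rw [hE]; positivity
  rw [← hE] at hδc
  have hEa : ∀ a, 0 ≤ a → a ≤ Λ → E * a ≤ c := fun a h0 ha =>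
    (mul_le_mul_of_nonneg_left ha hE0).trans hδc
  have hdrop : κ / 2 ≤ κ - 2 * (2 * c) * Λ ^ 3 := by first | linarith | nlinarith
  have hcΛ : c * Λ ≤ 1 := by first | linarith | nlinarith
  intro x hx
  constructor
  · -- upper bound
    have lip : ∀ y ∈ Icc A' B', |v y - 1| ≤ 4 * Λ / κ * |y - xs| := by
      intro y hy
      have := (convex_Icc A' B').norm_image_sub_le_of_norm_hasDerivWithin_le (f := v) (f' := v1)
        (C := 4 * Λ / κ) (fun t ht => (h.hv t (hI t ht)).hasDerivWithinAt)
        (fun t ht => by rw [Real.norm_eq_abs]; exact h.v1bd hδ2 t ht) hxs hy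
      rw [hv1'] at this
      simpa [Real.norm_eq_abs] using this
    have lip2 : ∀ y ∈ Icc A' B', |1 - p y| ≤ 2 * Λ * (4 * Λ / κ * |y - xs|) := fun y hy =>
      alg4 (h.pv y (hI y hy)) (h.ppos (hI y hy)) (h.vpos y (hI y hy)) hΛ (h.pL y (hI y hy)) (lip y hy)
    have hcc : 2 * Λ * (4 * Λ / κ) ≤ C := by
      have : (2 * Λ * (4 * Λ / κ)) * κ ≤ C * κ := by
        rw [hCκ]; field_simp; first | linarith | nlinarith
      exact le_of_mul_le_mul_right this hκ
    have hseg : uIcc xs x ⊆ Icc A' B' := by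
      intro t ht
      rcases le_total xs x with e | e
      · rw [uIcc_of_le e] at ht; exact ⟨by linarith [ht.1], by linarith [ht.2, hx.2]⟩
      · rw [uIcc_of_ge e] at ht; exact ⟨by linarith [ht.1, hx.1], by linarith [ht.2]⟩
    have := (convex_uIcc xs x).norm_image_sub_le_of_norm_hasDerivWithin_le (f := U) (f' := fun y => 1 - p y)
        (C := C * |x - xs|) (fun t ht => (h.hU t (hI t (hseg ht))).hasDerivWithinAt)
        (fun t ht => by
          rw [Real.norm_eq_abs]
          refine (lip2 t (hseg ht)).trans ?_
          have : |t - xs| ≤ |x - xs| := by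
            have := Set.abs_sub_left_of_mem_uIcc ht
            exact this
          have a1 : 2 * Λ * (4 * Λ / κ) * |t - xs| ≤ C * |x - xs| :=
            mul_le_mul hcc this (abs_nonneg _) (by linarith)
          linarith) left_mem_uIcc right_mem_uIcc
    rw [Real.norm_eq_abs, Real.norm_eq_abs, mul_assoc, abs_mul_abs_self] at this
    have := (abs_le.1 this).2
    first | linarith | nlinarith
  · rcases le_total x xs with hxx | hxx
    · by_cases hi : ∀ y ∈ Icc x xs, v y ≤ 1 - c * (xs - y)
      · have hsub : ∀ y ∈ Icc x xs, y ∈ Icc A B := fun y hy => hI y ⟨by linarith [hx.1, hy.1], by linarith [hy.2]⟩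
        have hd : ∀ t ∈ Icc x xs, HasDerivAt (fun t => c / 2 * (xs - t) ^ 2 - U t)
            (-(c * (xs - t)) - (1 - p t)) t := by
          intro t ht
          have e := (((hasDerivAt_id t).const_sub xs).pow 2).const_mul (c / 2)
          exact (e.sub (h.hU t (hsub t ht))).congr_deriv (by simp; ring)
        have := incr hxx (fun t ht => (hd t ht).continuousAt.continuousWithinAt)
          (fun t ht => hd t (Ioo_subset_Icc_self ht)) (fun t ht => by
            have ht := Ioo_subset_Icc_self ht
            have := alg2 (h.pv t (hsub t ht)) (h.ppos (hsub t ht)) (h.vpos t (hsub t ht))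
              (mul_nonneg hcpos.le (by linarith [ht.2])) (hi t ht)
            linarith)
        simp only [sub_self] at this
        have a1 : C * (U xs + c / 2 * (x - xs) ^ 2) ≤ C * U x :=
          mul_le_mul_of_nonneg_left (by linarith) (by linarith)
        have a2 : C * (U xs + c / 2 * (x - xs) ^ 2) = C * U xs + 2 * (x - xs) ^ 2 := by
          linear_combination (1 / 2) * (x - xs) ^ 2 * hCc
        have a3 : U xs ≤ C * U xs := by
          have := mul_le_mul_of_nonneg_right hC1 upos.le
          linarith
        linarith [sq_nonneg (x - xs)]
      · push Not at hi
        obtain ⟨y, hy, hvy⟩ := hi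
        refine crude x hx (hdrop.trans ?_)
        refine h.drop (e := 2 * c) (by positivity) hx.1 hxx hxs.2 ?_
        intro l hl
        have hly : l ≤ y := hl.2.trans hy.1
        have q := qchord h.hv h.hv1 D xs (show A ≤ l by linarith [hl.1]) hly hy.2 (show xs ≤ B by linarith)
        rw [← hE, hv1'] at q
        have hyx : y < xs := lt_of_le_of_ne hy.2 (fun e => by rw [e, hv1'] at hvy; linarith)
        obtain ⟨a, ha⟩ : ∃ a : ℝ, a = xs - l := ⟨_, rfl⟩
        obtain ⟨b, hb⟩ : ∃ b : ℝ, b = xs - y := ⟨_, rfl⟩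
        have hb0 : 0 < b := by linarith
        have ha0 : 0 ≤ a := by linarith
        have hea := hEa a ha0 (by linarith [hl.1])
        rw [show l - xs = -a by linarith, show y - xs = -b by linarith, show y - l = a - b by linarith,
          ← ha, ← hb] at q
        rw [← hb] at hvy
        rw [← ha]
        have q1 : (1 - c * b) * a ≤ (v l + E * a ^ 2) * b + (a - b) := by
          have : (1 - c * b) * a ≤ (v y + E * (-b) ^ 2) * a :=
            mul_le_mul_of_nonneg_right (by first | linarith [mul_nonneg hE0 (sq_nonneg b)] | nlinarith [mul_nonneg hE0 (sq_nonneg b)]) ha0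
          first | linarith | nlinarith
        have q2 : (1 - c * a) * b ≤ (v l + E * a ^ 2) * b := by first | linarith | nlinarith
        have q3 := le_of_mul_le_mul_right q2 hb0
        first | linarith | nlinarith
    · by_cases hi : ∀ y ∈ Icc xs x, 1 + c * (y - xs) ≤ v y
      · have hsub : ∀ y ∈ Icc xs x, y ∈ Icc A B := fun y hy => hI y ⟨by linarith [hxs.1, hy.1], by linarith [hy.2, hx.2]⟩
        have hd : ∀ t ∈ Icc xs x, HasDerivAt (fun t => U t - c / 4 * (t - xs) ^ 2)
            ((1 - p t) - c / 2 * (t - xs)) t := by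
          intro t ht
          have e := (((hasDerivAt_id t).sub_const xs).pow 2).const_mul (c / 4)
          exact ((h.hU t (hsub t ht)).sub e).congr_deriv (by simp; ring)
        have := incr hxx (fun t ht => (hd t ht).continuousAt.continuousWithinAt)
          (fun t ht => hd t (Ioo_subset_Icc_self ht)) (fun t ht => by
            have ht := Ioo_subset_Icc_self ht
            have ct : c * (t - xs) ≤ 1 :=
              (mul_le_mul_of_nonneg_left (show t - xs ≤ Λ by linarith [ht.2, hx.2]) hcpos.le).trans hcΛ
            have := alg3 (h.pv t (hsub t ht)) (h.ppos (hsub t ht)) (h.vpos t (hsub t ht))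
              (mul_nonneg hcpos.le (by linarith [ht.1])) ct (hi t ht)
            linarith)
        simp only [sub_self] at this
        have a1 : C * (U xs + c / 4 * (x - xs) ^ 2) ≤ C * U x :=
          mul_le_mul_of_nonneg_left (by linarith) (by linarith)
        have a2 : C * (U xs + c / 4 * (x - xs) ^ 2) = C * U xs + (x - xs) ^ 2 := by
          linear_combination (1 / 4) * (x - xs) ^ 2 * hCc
        have a3 : U xs ≤ C * U xs := by
          have := mul_le_mul_of_nonneg_right hC1 upos.le
          linarith
        linarith [sq_nonneg (x - xs)]
      · exfalso
        push Not at hi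
        obtain ⟨y, hy, hvy⟩ := hi
        refine absurd (hdrop.trans ?_) (not_le.2 hus)
        refine h.drop (e := 2 * c) (by positivity) hxs.1 le_rfl hxs.2 ?_
        intro l hl
        have q := qchord h.hv h.hv1 D xs (show A ≤ l by linarith [hl.1]) hl.2 hy.1
          (show y ≤ B by linarith [hy.2, hx.2])
        rw [← hE, hv1'] at q
        have hyx : xs < y := lt_of_le_of_ne hy.1 (fun e => by rw [← e, hv1'] at hvy; linarith)
        obtain ⟨a, ha⟩ : ∃ a : ℝ, a = xs - l := ⟨_, rfl⟩
        obtain ⟨b, hb⟩ : ∃ b : ℝ, b = y - xs := ⟨_, rfl⟩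
        have hb0 : 0 < b := by linarith
        have ha0 : 0 ≤ a := by linarith [hl.2]
        have hea := hEa (a + b) (by linarith) (by linarith [hl.1, hy.2, hx.2])
        rw [show l - xs = -a by linarith, show y - l = a + b by linarith,
          ← ha, ← hb] at q
        rw [← hb] at hvy
        rw [← ha]
        simp only [sub_self] at q
        have q1 : a + b ≤ (v l + E * a ^ 2) * b + (1 + c * b + E * b ^ 2) * a := by
          have : (v y + E * b ^ 2) * a ≤ (1 + c * b + E * b ^ 2) * a :=
            mul_le_mul_of_nonneg_right (by linarith) ha0
          first | linarith | nlinarith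
        have q2 : (1 - c * a - E * (a + b) * a) * b ≤ v l * b := by first | linarith | nlinarith
        have q3 := le_of_mul_le_mul_right q2 hb0
        have q4 : E * (a + b) * a ≤ c * a := mul_le_mul_of_nonneg_right hea ha0
        linarith

end Parab

theorem deriv_le_of {g : ℝ → ℝ} {g' y z K : ℝ} (hg : HasDerivAt g g' y) (hyz : y < z)
    (h : ∀ t, y < t → t ≤ z → g t - g y ≤ K * (t - y)) : g' ≤ K := by
  have h1 := (hasDerivAt_iff_tendsto_slope.1 hg).mono_left
    (nhdsWithin_mono y (fun t (ht : t ∈ Ioi y) => (ne_of_gt ht : t ≠ y)))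
  refine le_of_tendsto h1 ?_
  filter_upwards [Ioc_mem_nhdsGT hyz] with t ht
  rw [slope_def_field, div_le_iff₀ (by linarith [ht.1])]
  exact h t ht.1 ht.2

namespace Nice
variable (f : Nice)

/-- derivative of the iterate -/
def P (i : ℕ) (y : ℝ) : ℝ := ∏ j ∈ Finset.range i, f.d1 (f.F^[j] y)
def vv (i : ℕ) (y : ℝ) : ℝ := ∏ j ∈ Finset.range i, f.V (f.F^[j] y)
def vd : ℕ → ℝ → ℝ
  | 0, _ => 0
  | i + 1, y => f.V1 (f.F^[i] y) * (vv f i y)⁻¹ + f.V (f.F^[i] y) * vd i y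
def kap (i : ℕ) (y : ℝ) : ℝ := ∑ j ∈ Finset.range i, f.Ksch (f.F^[j] y) * (f.P j y) ^ 2

theorem hP (i : ℕ) (y : ℝ) : HasDerivAt (f.F^[i]) (f.P i y) y := by
  induction i with
  | zero => simpa [P] using hasDerivAt_id y
  | succ i ih =>
    rw [Function.iterate_succ', P, Finset.prod_range_succ, mul_comm]
    exact (f.hF (f.F^[i] y)).comp y ih

theorem vv_pos {i : ℕ} {y : ℝ} (h : ∀ j < i, f.d1 (f.F^[j] y) ≠ 0) : 0 < f.vv i y :=
  Finset.prod_pos fun j hj => f.V_pos (h j (Finset.mem_range.1 hj))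

theorem P_vv {i : ℕ} {y : ℝ} (h : ∀ j < i, f.d1 (f.F^[j] y) ≠ 0) : f.P i y * (f.vv i y) ^ 2 = 1 := by
  rw [P, vv, ← Finset.prod_pow, ← Finset.prod_mul_distrib]
  refine Finset.prod_eq_one fun j hj => ?_
  rw [f.V_sq, mul_inv_cancel₀ (h j (Finset.mem_range.1 hj))]

theorem P_nonneg (i : ℕ) (y : ℝ) : 0 ≤ f.P i y := Finset.prod_nonneg fun j _ => f.d1_nonneg _

theorem hvv (i : ℕ) {y : ℝ} (h : ∀ j < i, f.d1 (f.F^[j] y) ≠ 0) : HasDerivAt (f.vv i) (f.vd i y) y := by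
  induction i with
  | zero =>
    have e : f.vv 0 = fun _ => 1 := by funext y; simp [vv]
    rw [e]; exact hasDerivAt_const _ _
  | succ i ih =>
    have hi := ih fun j hj => h j (by omega)
    have e : f.vv (i + 1) = fun y => f.vv i y * f.V (f.F^[i] y) := by
      funext y; rw [vv, Finset.prod_range_succ]; rfl
    have hp : 0 < f.vv i y := f.vv_pos fun j hj => h j (by omega)
    have hP2 := f.P_vv (i := i) (y := y) fun j hj => h j (by omega)
    rw [e]
    refine (hi.mul ((f.hV (h i (by omega))).comp y (f.hP i y))).congr_deriv ?_
    rw [vd]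
    have : f.vv i y * f.P i y = (f.vv i y)⁻¹ := by
      field_simp; linarith
    rw [← this]; simp only [Function.comp]; ring

theorem hvd (i : ℕ) {y : ℝ} (h : ∀ j < i, f.d1 (f.F^[j] y) ≠ 0) :
    HasDerivAt (f.vd i) (f.kap i y * f.vv i y) y := by
  induction i with
  | zero =>
    have e : f.vd 0 = fun _ => 0 := by funext y; simp [vd]
    rw [e]; simpa [kap] using hasDerivAt_const y (0 : ℝ)
  | succ i ih =>
    have h' : ∀ j < i, f.d1 (f.F^[j] y) ≠ 0 := fun j hj => h j (by omega)
    have hi := ih h'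
    have hp : 0 < f.vv i y := f.vv_pos h'
    have hP2 := f.P_vv h'
    have e : f.vd (i + 1) = fun y => f.V1 (f.F^[i] y) * (f.vv i y)⁻¹ + f.V (f.F^[i] y) * f.vd i y := by
      funext y; rfl
    rw [e]
    have d1 := ((f.hV1 (h i (by omega))).comp y (f.hP i y)).mul ((f.hvv i h').inv hp.ne')
    have d2 := ((f.hV (h i (by omega))).comp y (f.hP i y)).mul hi
    refine (d1.add d2).congr_deriv ?_
    have e1 : (f.vv i y)⁻¹ = f.vv i y * f.P i y := by field_simp; linarith
    have e2 : -f.vd i y / f.vv i y ^ 2 = -f.vd i y * f.P i y := by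
      rw [div_eq_iff (by positivity)]; linear_combination f.vd i y * hP2
    have k1 : f.kap (i + 1) y = f.kap i y + f.Ksch (f.F^[i] y) * (f.P i y) ^ 2 := by
      rw [kap, Finset.sum_range_succ]; rfl
    have k2 : f.vv (i + 1) y = f.vv i y * f.V (f.F^[i] y) := by
      rw [vv, Finset.prod_range_succ]; rfl
    rw [k1, k2, e2]
    simp only [Function.comp, Pi.inv_apply]
    rw [e1]
    ring

theorem kap_low : ∃ C, 0 < C ∧ ∀ (i : ℕ) (y : ℝ), (∀ j < i, f.d1 (f.F^[j] y) ≠ 0) →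
    -(C * ∑ j ∈ Finset.range i, (f.P j y) ^ 2) ≤ f.kap i y := by
  obtain ⟨C, hC, h⟩ := f.Ksch_low
  refine ⟨C, hC, fun i y hy => ?_⟩
  rw [kap, Finset.mul_sum, ← Finset.sum_neg_distrib]
  refine Finset.sum_le_sum fun j hj => ?_
  have := mul_le_mul_of_nonneg_right (h _ (hy j (Finset.mem_range.1 hj))) (sq_nonneg (f.P j y))
  linarith

/-- iterated slow variation -/
theorem slowk (k : ℕ) : ∃ C, 1 ≤ C ∧ ∀ (L : Level f) x y, f.T (-((k : ℤ) • L.v)) x ≤ y →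
    y ≤ f.T ((k : ℤ) • L.v) x → L.ss y ≤ C * L.ss x := by
  obtain ⟨S, hS, slow⟩ := f.slow
  induction k with
  | zero =>
    refine ⟨1, le_rfl, fun L x y h1 h2 => ?_⟩
    simp at h1 h2
    rw [le_antisymm h1 h2, one_mul]
  | succ k ih =>
    obtain ⟨C, hC, h⟩ := ih
    refine ⟨C * S, one_le_mul_of_one_le_of_one_le hC hS, fun L x y h1 h2 => ?_⟩
    have hSx := L.ss_pos x
    by_cases c1 : f.T ((k : ℤ) • L.v) x < y
    · have a1 : L.ss (f.T ((k : ℤ) • L.v) x) ≤ C * L.ss x := by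
        refine h L x _ ?_ le_rfl
        have hv := L.hv
        apply f.T_mono_val_le
        rw [f.val_neg, f.val_zsmul]
        push_cast
        have : 0 ≤ (k : ℝ) * f.val L.v := by positivity
        linarith
      have a2 : L.ss y ≤ S * L.ss (f.T ((k : ℤ) • L.v) x) := by
        refine slow L _ _ ((L.vinv_lt _).le.trans c1.le) ?_
        rw [← f.T_add]
        convert h2 using 2
        push_cast; rw [add_smul, one_smul, add_comm]
      calc L.ss y ≤ S * (C * L.ss x) := a2.trans (by gcongr)
        _ = _ := by ring
    by_cases c2 : y < f.T (-((k : ℤ) • L.v)) x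
    · have a1 : L.ss (f.T (-((k : ℤ) • L.v)) x) ≤ C * L.ss x := by
        refine h L x _ le_rfl ?_
        have hv := L.hv
        apply f.T_mono_val_le
        rw [f.val_neg, f.val_zsmul]
        push_cast
        have : 0 ≤ (k : ℝ) * f.val L.v := by positivity
        linarith
      have a2 : L.ss y ≤ S * L.ss (f.T (-((k : ℤ) • L.v)) x) := by
        refine slow L _ _ ?_ (c2.le.trans (L.lt_v _).le)
        rw [← f.T_add]
        convert h1 using 2
        push_cast; rw [add_smul, one_smul, neg_add, add_comm]
      calc L.ss y ≤ S * (C * L.ss x) := a2.trans (by gcongr)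
        _ = _ := by ring
    push Not at c1 c2
    have := h L x y c2 c1
    calc L.ss y ≤ C * L.ss x := this
      _ ≤ C * L.ss x * S := le_mul_of_one_le_right (by positivity) hS
      _ = _ := by ring

/-- iterated comparability of small steps -/
theorem RBwk (k : ℕ) : ∃ C, 1 ≤ C ∧ ∀ (L : Level f) x y, f.T ((k : ℤ) • L.w) x ≤ y →
    y ≤ f.T (-((k : ℤ) • L.w)) x → L.us y ≤ C * L.us x := by
  obtain ⟨C, hC, h⟩ := f.reflect.slowk k
  refine ⟨C, hC, fun L x y h1 h2 => ?_⟩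
  rw [L.us_next, L.us_next]
  refine h L.next _ _ ?_ ?_
  · rw [Level.next_v, f.T_reflect]
    have : sg (-((k : ℤ) • sg L.w)) = -((k : ℤ) • L.w) := by ext <;> simp [sg]
    rw [this]; linarith
  · rw [Level.next_v, f.T_reflect]
    have : sg (((k : ℤ) • sg L.w)) = ((k : ℤ) • L.w) := by ext <;> simp [sg]
    rw [this]; linarith

/-- length of `k` big steps -/
theorem longk (k : ℕ) : ∃ C, 0 ≤ C ∧ ∀ (L : Level f) x, f.T ((k : ℤ) • L.v) x - x ≤ C * L.ss x := by
  obtain ⟨R, hR, h⟩ := f.RBs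
  induction k with
  | zero => exact ⟨0, le_rfl, fun L x => by simp⟩
  | succ k ih =>
    obtain ⟨C, hC, hk⟩ := ih
    refine ⟨C * R + 1, by positivity, fun L x => ?_⟩
    have h1 := hk L (f.T L.v x)
    have h2 := (h L x).1
    rw [← f.T_add] at h1
    have e : (((k + 1 : ℕ) : ℤ)) • L.v = (k : ℤ) • L.v + L.v := by push_cast; rw [add_smul, one_smul]
    rw [e]
    have : C * L.ss (f.T L.v x) ≤ C * (R * L.ss x) := mul_le_mul_of_nonneg_left h2 hC
    have e3 : L.ss x = f.T L.v x - x := rfl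
    nlinarith

end Nice

theorem cr_alg {A B C Δ a b d τ X c s l R D : ℝ} (hB : 0 < B) (hC : 0 < C) (hb : 0 < b) (hd : 0 < d)
    (ha : a ≤ b) (hτ : 0 < τ) (hΔ : 0 < Δ) (hX : 0 < X) (hc : 0 < c) (hs : 0 < s) (hl : 0 < l)
    (hR : 0 < R) (hD : 0 ≤ D) (hA1 : c * s ≤ R * A) (hd1 : c * l ≤ R * d) (hB1 : B ≤ D * s)
    (hC1 : C ≤ D * s) (h : A * Δ / (B * C) ≤ X * (a * τ / (b * d))) :
    Δ * l ≤ X * D ^ 2 * R ^ 2 / c ^ 2 * s * τ := by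
  have hA : 0 < A := by
    have : 0 < R * A := lt_of_lt_of_le (by positivity) hA1
    exact pos_of_mul_pos_right this hR.le
  have h1 : A * Δ / (B * C) ≤ X * (τ / d) := by
    refine h.trans (mul_le_mul_of_nonneg_left ?_ hX.le)
    rw [div_le_div_iff₀ (by positivity) hd]
    have := mul_le_mul_of_nonneg_right ha (mul_pos hτ hd).le
    nlinarith
  rw [div_le_iff₀ (by positivity), ← mul_div_assoc, div_mul_eq_mul_div, le_div_iff₀ hd] at h1
  have h2 : B * C ≤ (D * s) * (D * s) := mul_le_mul hB1 hC1 hC.le (by positivity)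
  have h3 : (c * s) * (c * l) ≤ (R * A) * (R * d) := mul_le_mul hA1 hd1 (by positivity) (by positivity)
  have h4 : A * Δ * d ≤ X * τ * ((D * s) * (D * s)) := h1.trans (mul_le_mul_of_nonneg_left h2 (by positivity))
  have h5 : (c * s) * (c * l) * Δ ≤ (R * A) * (R * d) * Δ := mul_le_mul_of_nonneg_right h3 hΔ.le
  have h6 : R ^ 2 * (A * Δ * d) ≤ R ^ 2 * (X * τ * ((D * s) * (D * s))) := mul_le_mul_of_nonneg_left h4 (by positivity)
  have h7 : (c ^ 2 * (Δ * l)) * s ≤ (X * D ^ 2 * R ^ 2 * s * τ) * s := by linarith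
  have h8 := le_of_mul_le_mul_right h7 hs
  have : X * D ^ 2 * R ^ 2 / c ^ 2 * s * τ = (X * D ^ 2 * R ^ 2 * s * τ) / c ^ 2 := by ring
  rw [this, le_div_iff₀ (by positivity)]
  linarith

namespace Nice
variable (f : Nice)

theorem dbound : ∃ r C : ℝ, 0 < r ∧ 1 ≤ C ∧ ∀ (L : Level f) α, (∀ x, L.ss x < r) → L.Spot α →
    ∀ i ≤ L.q, ∀ y, f.T (-((2 : ℤ) • L.w)) α ≤ y → y ≤ f.T ((3 : ℤ) • L.v) α →
      f.P i y * L.ss α ≤ C * L.ss (f.F^[i] α) := by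
  obtain ⟨r, c, hr, hc, hc1, hsu⟩ := f.spot_u
  obtain ⟨E, hE, hcr⟩ := f.crT
  obtain ⟨R, hR, hRw⟩ := f.RBwk 2
  obtain ⟨D, hD, hlong⟩ := f.longk 4
  obtain ⟨X, hX⟩ : ∃ x : ℝ, x = Real.exp (E * ((1 : ℕ) * (4 : ℕ))) := ⟨_, rfl⟩
  have hX0 : 0 < X := by rw [hX]; positivity
  refine ⟨r, X * D ^ 2 * R ^ 2 / c ^ 2 + 1, hr, le_add_of_nonneg_left (by positivity), ?_⟩
  intro L α hsm hα i hi y hy1 hy2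
  have hv := L.hv
  have hw := L.hw
  have hlt := L.hlt
  have vv : ∀ (m n : ℤ), f.val (m • L.v + n • L.w) = m * f.val L.v + n * f.val L.w := fun m n => by
    rw [f.val_add, f.val_zsmul, f.val_zsmul]
  have hs : 0 < L.ss (f.F^[i] α) := L.ss_pos _
  have hl : 0 < L.ss α := L.ss_pos _
  have h12 : α < f.T (-L.w) α := L.lt_psi α
  have h2y : f.T (-L.w) α < f.T (-((2 : ℤ) • L.w)) α := by
    apply f.T_mono_val; rw [f.val_neg, f.val_neg, f.val_zsmul]; push_cast; linarith
  have h34 : f.T ((3 : ℤ) • L.v) α < f.T ((4 : ℤ) • L.v) α := by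
    apply f.T_mono_val; rw [f.val_zsmul, f.val_zsmul]; push_cast; linarith
  have hyz : y < f.T ((4 : ℤ) • L.v) α := lt_of_le_of_lt hy2 h34
  have hmono := f.iter_strictMono i
  have spA := hsu L α hsm hα i 0 hi
  rw [← f.iter_eq_T] at spA
  have sp0 := hsu L α hsm hα 0 0 (Nat.zero_le _)
  have e00 : f.T (((0 : ℕ) : ℤ), 0) α = α := f.T_zero α
  rw [e00] at sp0
  have key := deriv_le_of (K := X * D ^ 2 * R ^ 2 / c ^ 2 * L.ss (f.F^[i] α) / L.ss α) (f.hP i y) hyz ?_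
  · rw [le_div_iff₀ hl] at key
    linarith
  intro t ht1 ht2
  have cri := hcr L 1 4 (i : ℤ) 0 (by positivity) (by rw [← L.q_cast]; push_cast; rw [one_mul]; exact_mod_cast hi)
    α (f.T (-L.w) α) y t h12 (by linarith) ht1 (by rw [← natCast_zsmul]; exact_mod_cast ht2)
  rw [← f.iter_eq_T, ← f.iter_eq_T, ← f.iter_eq_T, ← f.iter_eq_T, ← hX] at cri
  have m1 : f.F^[i] α < f.F^[i] (f.T (-L.w) α) := hmono h12
  have m2 : f.F^[i] (f.T (-L.w) α) < f.F^[i] y := hmono (by linarith)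
  have m3 : f.F^[i] y < f.F^[i] t := hmono ht1
  have m4 : f.F^[i] t ≤ f.F^[i] (f.T ((4 : ℤ) • L.v) α) := hmono.monotone ht2
  have lg := hlong L (f.F^[i] α)
  rw [f.iter_T] at m4
  push_cast at lg
  have hA1 : c * L.ss (f.F^[i] α) ≤ R * (f.F^[i] (f.T (-L.w) α) - f.F^[i] α) := by
    refine spA.trans ?_
    have : f.F^[i] (f.T (-L.w) α) - f.F^[i] α = L.us (f.T (-L.w) (f.F^[i] α)) := by
      rw [Level.us, f.T_T_neg, f.iter_T]
    rw [this]
    refine hRw L _ _ ?_ ?_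
    · rw [← f.T_add]
      apply le_of_lt
      apply f.T_neg
      rw [f.val_add, f.val_neg, f.val_zsmul]; push_cast; linarith
    · rw [← f.T_add]
      apply le_of_lt
      apply f.T_pos
      rw [f.val_add, f.val_neg, f.val_neg, f.val_zsmul]; push_cast; linarith
  have hd1 : c * L.ss α ≤ R * (t - f.T (-L.w) α) := by
    refine sp0.trans ?_
    have : L.us (f.T (-((2 : ℤ) • L.w)) α) ≤ t - f.T (-L.w) α := by
      rw [Level.us, ← f.T_add]
      have : L.w + -((2 : ℤ) • L.w) = -L.w := by rw [two_smul]; abel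
      rw [this]; linarith
    refine le_trans ?_ (mul_le_mul_of_nonneg_left this (by linarith))
    refine hRw L _ _ ?_ ?_
    · rw [← f.T_add]
      have : ((2 : ℕ) : ℤ) • L.w + -((2 : ℤ) • L.w) = 0 := by push_cast; abel
      rw [this, f.T_zero]
    · rw [← f.T_add]
      apply le_of_lt
      apply f.T_pos
      rw [f.val_add, f.val_neg, f.val_neg, f.val_zsmul, f.val_zsmul]; push_cast; linarith
  have fin := cr_alg (B := f.F^[i] y - f.F^[i] α) (C := f.F^[i] t - f.F^[i] (f.T (-L.w) α))
    (Δ := f.F^[i] t - f.F^[i] y) (a := f.T (-L.w) α - α) (b := y - α) (τ := t - y) (X := X) (D := D)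
    (by linarith) (by linarith) (by linarith) (by linarith) (by linarith) (by linarith) (by linarith)
    hX0 hc hs hl (by linarith) hD hA1 hd1 (by linarith) (by linarith) cri
  rw [div_mul_eq_mul_div, le_div_iff₀ hl]
  exact fin

end Nice

namespace Level
variable {f : Nice} (L : Level f)

/-- orbit under the inverse small step -/
def o (x : ℝ) (m : ℤ) : ℝ := f.T ((-m) • L.w) x

theorem o_zero (x : ℝ) : L.o x 0 = x := by simp [o, f.T_zero]
theorem o_o (x : ℝ) (m n : ℤ) : L.o (L.o x m) n = L.o x (m + n) := by
  rw [o, o, o, ← f.T_add, ← add_smul]; congr 2; ring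
theorem Tw_o (x : ℝ) (m : ℤ) : f.T L.w (L.o x m) = L.o x (m - 1) := by
  have : f.T L.w (L.o x m) = L.o (L.o x m) (-1) := by simp [o]
  rw [this, o_o]; rfl
theorem o_lt {x : ℝ} {m n : ℤ} (h : m < n) : L.o x m < L.o x n := by
  apply f.T_mono_val
  rw [f.val_zsmul, f.val_zsmul]
  have := L.hw
  have : (m : ℝ) < n := by exact_mod_cast h
  push_cast; nlinarith
theorem o_le {x : ℝ} {m n : ℤ} (h : m ≤ n) : L.o x m ≤ L.o x n := by
  rcases h.lt_or_eq with h | rfl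
  · exact (L.o_lt h).le
  · exact le_rfl
theorem o_lt_iff {x y : ℝ} (m : ℤ) : L.o x m < L.o y m ↔ x < y := f.T_lt_iff _
theorem o_le_iff {x y : ℝ} (m : ℤ) : L.o x m ≤ L.o y m ↔ x ≤ y := f.T_le_iff _
theorem o_us (x : ℝ) (m : ℤ) : L.us (L.o x m) = L.o x m - L.o x (m - 1) := by
  rw [us, Tw_o]
theorem o_v_le {x : ℝ} {m n : ℤ} (hm : 0 ≤ m) (h : m ≤ n) : L.o x m ≤ f.T (n • L.v) x := by
  apply f.T_mono_val_le
  rw [f.val_zsmul, f.val_zsmul]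
  have h1 := L.hw
  have h2 := L.hlt
  have h3 : (m : ℝ) ≤ n := by exact_mod_cast h
  have h4 : (0 : ℝ) ≤ m := by exact_mod_cast hm
  push_cast; nlinarith [L.hv]
theorem v_le_o {x : ℝ} {m n : ℤ} (hm : 0 ≤ m) (h : m ≤ n) : f.T (-(n • L.v)) x ≤ L.o x (-m) := by
  apply f.T_mono_val_le
  rw [f.val_neg, f.val_zsmul, f.val_zsmul]
  have h1 := L.hw
  have h2 := L.hlt
  have h3 : (m : ℝ) ≤ n := by exact_mod_cast h
  have h4 : (0 : ℝ) ≤ m := by exact_mod_cast hm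
  push_cast; nlinarith [L.hv]

theorem ss_add_int (x : ℝ) (k : ℤ) : L.ss (x + k) = L.ss x := by
  rw [ss, ss, f.T_add_int]; ring

theorem Tw_eq (y : ℝ) : f.T L.w y = f.F^[L.q] y - L.w.2 := by
  rw [← f.T_nat, L.q_cast]

theorem hus (y : ℝ) : HasDerivAt L.us (1 - f.P L.q y) y := by
  have e : L.us = fun y => y - (f.F^[L.q] y - L.w.2) := by
    funext y; rw [us, L.Tw_eq]
  rw [e]
  exact (hasDerivAt_id y).sub ((f.hP L.q y).sub_const _)

end Level

namespace Nice
variable (f : Nice)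

theorem RBo (k : ℕ) : ∃ C, 1 ≤ C ∧ ∀ (L : Level f) x y, L.o x (-k) ≤ y → y ≤ L.o x k → L.us y ≤ C * L.us x := by
  obtain ⟨C, hC, h⟩ := f.RBwk k
  refine ⟨C, hC, fun L x y h1 h2 => h L x y ?_ ?_⟩
  · simpa [Level.o] using h1
  · simpa [Level.o] using h2

theorem us_le_ss : ∃ C, 1 ≤ C ∧ ∀ (L : Level f) x, L.us x ≤ C * L.ss x := by
  obtain ⟨S, hS, h⟩ := f.slow
  refine ⟨S, hS, fun L x => ?_⟩
  have := L.us_lt_ss_psi (f.T L.w x)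
  rw [f.T_neg_T] at this
  exact this.le.trans (h L _ _ (L.vinv_lt_w x).le ((L.w_lt x).le.trans (L.lt_v x).le))

/-- near a spot the small step is comparable to the big step -/
theorem near_us (k : ℕ) : ∃ r c : ℝ, 0 < r ∧ 0 < c ∧ c ≤ 1 ∧ ∀ (L : Level f), (∀ x, L.ss x < r) → ∀ z x, L.Spot z →
    L.o x (-k) ≤ z → z ≤ L.o x k → c * L.ss x ≤ L.us x := by
  obtain ⟨r, c, hr, hc, hc1, hsu⟩ := f.spot_u
  obtain ⟨R, hR, RB⟩ := f.RBo k
  obtain ⟨S, hS, slow⟩ := f.slowk k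
  refine ⟨r, c / (R * S), hr, by positivity, ?_, fun L hsm z x hz h1 h2 => ?_⟩
  · rw [div_le_one (by positivity)]
    exact hc1.trans (one_le_mul_of_one_le_of_one_le hR hS)
  have sp0 := hsu L z hsm hz 0 0 (Nat.zero_le _)
  have e00 : f.T (((0 : ℕ) : ℤ), 0) z = z := f.T_zero z
  rw [e00] at sp0
  have a1 := RB L x z h1 h2
  have h1' : x ≤ L.o z k := by
    have := (L.o_le_iff (k : ℤ)).2 h1
    rwa [L.o_o, neg_add_cancel, L.o_zero] at this
  have h2' : L.o z (-k) ≤ x := by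
    have := (L.o_le_iff (-(k : ℤ))).2 h2
    rwa [L.o_o, add_neg_cancel, L.o_zero] at this
  have a2 := slow L z x ((L.v_le_o (by positivity) le_rfl).trans h2') (h1'.trans (L.o_v_le (by positivity) le_rfl))
  rw [div_mul_eq_mul_div, div_le_iff₀ (by positivity)]
  calc c * L.ss x ≤ c * (S * L.ss z) := by gcongr
    _ = S * (c * L.ss z) := by ring
    _ ≤ S * (R * L.us x) := mul_le_mul_of_nonneg_left (sp0.trans a1) (by linarith)
    _ = _ := by ring

set_option maxHeartbeats 1000000 in
/-- parabolic behaviour of the small step inside a gap between consecutive spots -/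
theorem gap : ∃ r C : ℝ, 0 < r ∧ 1 ≤ C ∧ ∀ (L : Level f), (∀ x, L.ss x < r) → ∀ α β, L.Spot α → L.Spot β →
    (∀ z, L.Spot z → α < z → β ≤ z) → L.o α 8 < β →
    ∃ xs ∈ Icc (L.o α 4) (L.o β (-3)), ∀ x ∈ Icc (L.o α 4) (L.o β (-3)),
      L.us x * L.ss α ≤ C * (L.us xs * L.ss α + (x - xs) ^ 2) ∧
      L.us xs * L.ss α + (x - xs) ^ 2 ≤ C * (L.us x * L.ss α) := by
  obtain ⟨r1, c, hr1, hc, hc1, hnu⟩ := f.near_us 4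
  obtain ⟨r2, Cd, hr2, hCd, hdb⟩ := f.dbound
  obtain ⟨R, hR, RB⟩ := f.RBo 4
  obtain ⟨S, hS, slow⟩ := f.slowk 4
  obtain ⟨D, hD, hlong⟩ := f.longk 3
  obtain ⟨Ck, hCk, hkap⟩ := f.kap_low
  obtain ⟨U0, hU0, husle⟩ := f.us_le_ss
  obtain ⟨Λ, hΛ⟩ : ∃ x : ℝ, x = U0 * S + D + R + Cd * S := ⟨_, rfl⟩
  have hCS : 1 ≤ Cd * S := one_le_mul_of_one_le_of_one_le hCd hS
  have hUS : 1 ≤ U0 * S := one_le_mul_of_one_le_of_one_le hU0 hS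
  obtain ⟨κ, hκ⟩ : ∃ x : ℝ, x = c / (R * S) := ⟨_, rfl⟩
  have hκ0 : 0 < κ := by rw [hκ]; positivity
  have hκ1 : κ ≤ 1 := by
    rw [hκ, div_le_one (by positivity)]; exact hc1.trans (one_le_mul_of_one_le_of_one_le hR hS)
  have hκRS : κ * (R * S) = c := by rw [hκ]; field_simp
  have hκc : κ ≤ c := by rw [← hκRS]; exact le_mul_of_one_le_right hκ0.le (one_le_mul_of_one_le_of_one_le hR hS)
  have hΛ1 : 1 ≤ Λ := by rw [hΛ]; linarith
  obtain ⟨Q, hQ⟩ : ∃ x : ℝ, x = Ck * (Cd ^ 2 * (1 + f.N)) := ⟨_, rfl⟩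
  have hQ0 : 0 < Q := by rw [hQ]; positivity
  obtain ⟨r3, hr3⟩ : ∃ x : ℝ, x = κ / (16 * Λ ^ 5) / Q := ⟨_, rfl⟩
  have hr30 : 0 < r3 := by rw [hr3]; positivity
  have hC1 : (1 : ℝ) ≤ 64 * Λ ^ 3 / κ := by
    rw [le_div_iff₀ hκ0]
    have : 1 ≤ Λ ^ 3 := one_le_pow₀ hΛ1
    linarith
  refine ⟨min r3 (min r1 r2), 64 * Λ ^ 3 / κ, by positivity, hC1, ?_⟩
  intro L hsm α β hα hβ hgap h8
  have hs1 : ∀ x, L.ss x < r1 := fun x => (hsm x).trans_le ((min_le_right _ _).trans (min_le_left _ _))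
  have hs2 : ∀ x, L.ss x < r2 := fun x => (hsm x).trans_le ((min_le_right _ _).trans (min_le_right _ _))
  have hs3 : ∀ x, L.ss x < r3 := fun x => (hsm x).trans_le (min_le_left _ _)
  obtain ⟨l, hl⟩ : ∃ x : ℝ, x = L.ss α := ⟨_, rfl⟩
  have hl0 : 0 < l := by rw [hl]; exact L.ss_pos α
  have hα0 := L.o_zero α
  have hβ0 := L.o_zero β
  -- upper bound for β
  have hβv : β ≤ f.T ((3 : ℤ) • L.v) α := by
    obtain ⟨z, hz, z1, z2⟩ := L.exists_spot (f.T (-L.w) α)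
    refine (hgap z hz ((L.lt_psi α).trans_le z1)).trans (z2.le.trans ?_)
    rw [← f.T_add, ← f.T_add]
    apply f.T_mono_val_le
    rw [f.val_add, f.val_add, f.val_neg, f.val_zsmul]; push_cast; linarith [L.hlt, L.hv]
  have hαβ : α < β := by rw [← hα0]; exact (L.o_lt (by norm_num)).trans h8
  have noSpot : ∀ y, α < y → y < β → ∀ j < L.q, f.d1 (f.F^[j] y) ≠ 0 := fun y h1 h2 j hj h0 =>
    absurd (hgap y ⟨j, hj, h0⟩ h1) (not_le.2 h2)
  have hT4 : ∀ y, α ≤ y → y ≤ β → L.ss y ≤ S * l := by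
    intro y h1 h2
    rw [hl]
    refine slow L α y ?_ ?_
    · refine le_trans (L.v_le_o (m := 0) le_rfl (by norm_num)) ?_
      simpa [L.o_zero] using h1
    · refine h2.trans (hβv.trans (f.T_mono_val_le ?_ α))
      rw [f.val_zsmul, f.val_zsmul]; push_cast; linarith [L.hv]
  -- small steps near the ends
  have usα : ∀ j : ℤ, 0 ≤ j → j ≤ 4 → κ * l ≤ L.us (L.o α j) := by
    intro j h0 h4
    have h1 := hnu L hs1 α α hα (by rw [← hα0, L.o_o]; exact L.o_le (by norm_num))
      (by nth_rewrite 1 [← hα0]; exact L.o_le (by norm_num))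
    have h2 := RB L (L.o α j) α (by nth_rewrite 2 [← hα0]; rw [L.o_o]; exact L.o_le (by push_cast; omega))
      (by nth_rewrite 1 [← hα0]; rw [L.o_o]; exact L.o_le (by push_cast; omega))
    rw [← hl] at h1
    have h3 : c * l ≤ R * L.us (L.o α j) := h1.trans h2
    rw [← hκRS] at h3
    have h4 : R * (κ * l) ≤ R * L.us (L.o α j) := by
      refine le_trans ?_ h3
      have : R * (κ * l) * 1 ≤ R * (κ * l) * S := mul_le_mul_of_nonneg_left hS (by positivity)
      linarith
    exact le_of_mul_le_mul_left h4 (by linarith)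
  have ssβ : l ≤ S * L.ss β := by
    rw [hl]
    refine slow L β α ?_ (hαβ.le.trans ?_)
    · have := (f.T_le_iff (-((3 : ℤ) • L.v))).2 hβv
      rw [f.T_neg_T] at this
      refine le_trans (f.T_mono_val_le ?_ β) this
      rw [f.val_neg, f.val_neg, f.val_zsmul, f.val_zsmul]; push_cast; linarith [L.hv]
    · refine (L.o_zero β).ge.trans (L.o_v_le le_rfl (by norm_num))
  have usβ : ∀ j : ℤ, 0 ≤ j → j ≤ 4 → κ * l ≤ L.us (L.o β (-j)) := by
    intro j h0 h4
    have h1 := hnu L hs1 β β hβ (by nth_rewrite 2 [← hβ0]; exact L.o_le (by norm_num))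
      (by nth_rewrite 1 [← hβ0]; exact L.o_le (by norm_num))
    have h2 := RB L (L.o β (-j)) β (by nth_rewrite 2 [← hβ0]; rw [L.o_o]; exact L.o_le (by push_cast; omega))
      (by nth_rewrite 1 [← hβ0]; rw [L.o_o]; exact L.o_le (by push_cast; omega))
    have h3 : c * L.ss β ≤ R * L.us (L.o β (-j)) := h1.trans h2
    have h4 : R * (κ * l) ≤ R * L.us (L.o β (-j)) := by
      refine le_trans ?_ h3
      rw [← hκRS]
      have : R * κ * l ≤ R * κ * (S * L.ss β) := mul_le_mul_of_nonneg_left ssβ (by positivity)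
      linarith
    exact le_of_mul_le_mul_left h4 (by linarith)
  -- iterates of q
  have Fq : ∀ y, f.F^[L.q] y = f.T L.w y + L.w.2 := fun y => by rw [L.Tw_eq]; ring
  -- choice of y1, y2
  have pick : ∀ x : ℝ, ∀ m : ℤ, ∃ y ∈ Ioo (L.o x (m - 1)) (L.o x m), 1 ≤ R * f.P L.q y := by
    intro x m
    obtain ⟨y, hy, ey⟩ := mvt' (F := f.F^[L.q]) (F' := f.P L.q) (L.o_lt (x := x) (show m - 1 < m by omega))
      (fun t _ => f.hP L.q t)
    refine ⟨y, hy, ?_⟩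
    rw [Fq, Fq, L.Tw_o, L.Tw_o] at ey
    have e1 := L.o_us x m
    have e2 := L.o_us x (m - 1)
    have := RB L (L.o x (m - 1)) (L.o x m) (by rw [L.o_o]; exact L.o_le (by push_cast; omega))
      (by rw [L.o_o]; exact L.o_le (by push_cast; omega))
    have hp := L.us_pos (L.o x m)
    have e3 : L.us (L.o x (m - 1)) = f.P L.q y * L.us (L.o x m) := by rw [e1, e2]; linarith
    rw [e3] at this
    have : 1 * L.us (L.o x m) ≤ (R * f.P L.q y) * L.us (L.o x m) := by linarith
    exact le_of_mul_le_mul_right this hp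
  obtain ⟨y1, hy1, py1⟩ := pick α 3
  obtain ⟨y2, hy2, py2⟩ := pick β (-1)
  norm_num at hy1 hy2
  have o48 : L.o α 4 < L.o β (-3) := by
    have := (L.o_lt_iff (-3)).2 h8
    rw [L.o_o] at this
    exact (L.o_lt (by norm_num)).trans this
  have hy1α : L.o α 2 < y1 := hy1.1
  have hα2 : α < L.o α 2 := by nth_rewrite 1 [← hα0]; exact L.o_lt (by norm_num)
  have hβ1 : L.o β (-1) < β := by nth_rewrite 2 [← hβ0]; exact L.o_lt (by norm_num)
  have o34 : L.o α 3 < L.o α 4 := L.o_lt (by norm_num)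
  have o32 : L.o β (-3) < L.o β (-2) := L.o_lt (by norm_num)
  have inI : ∀ y, y1 ≤ y → y ≤ y2 → α < y ∧ y < β := fun y h1 h2 => ⟨by linarith, by linarith [hy2.2]⟩
  have Pq : ∀ y, y1 ≤ y → y ≤ y2 → ∀ j ≤ L.q, f.P j y * l ≤ Cd * L.ss (f.F^[j] α) := by
    intro y h1 h2 j hj
    rw [hl]
    refine hdb L α hs2 hα j hj y ?_ ?_
    · have : f.T (-((2 : ℤ) • L.w)) α = L.o α 2 := by rw [Level.o, neg_smul]
      rw [this]; linarith
    · linarith [(inI y h1 h2).2]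
  have pLb : ∀ y, y1 ≤ y → y ≤ y2 → f.P L.q y ≤ Cd * S := by
    intro y h1 h2
    have a := Pq y h1 h2 L.q le_rfl
    rw [Fq, L.ss_add_int] at a
    have b : L.ss (f.T L.w α) ≤ S * l := by
      rw [hl]
      refine slow L α _ ?_ ?_
      · have : f.T L.w α = L.o α (-1) := by simp [Level.o]
        rw [this]; exact L.v_le_o (by norm_num) (by norm_num)
      · refine (L.w_lt α).le.trans ((L.o_zero α).ge.trans (L.o_v_le le_rfl (by norm_num)))
    have : f.P L.q y * l ≤ (Cd * S) * l := a.trans (by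
      have := mul_le_mul_of_nonneg_left b (show 0 ≤ Cd by linarith)
      linarith)
    exact le_of_mul_le_mul_right this hl0
  have kapb : ∀ y, y1 ≤ y → y ≤ y2 → -(Q * r3) ≤ l ^ 2 * f.kap L.q y := by
    intro y h1 h2
    have k1 := hkap L.q y (noSpot y (inI y h1 h2).1 (inI y h1 h2).2)
    have k2 : l ^ 2 * ∑ j ∈ Finset.range L.q, (f.P j y) ^ 2 ≤ Cd ^ 2 * (1 + f.N) * r3 := by
      have k3 : ∀ j ∈ Finset.range L.q, l ^ 2 * (f.P j y) ^ 2 ≤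
          Cd ^ 2 * r3 * (f.M (f.F^[j] (f.T L.v α)) - f.M (f.F^[j] α)) := by
        intro j hj
        have a := Pq y h1 h2 j (Finset.mem_range.1 hj).le
        have a0 : 0 ≤ f.P j y * l := mul_nonneg (f.P_nonneg j y) hl0.le
        have b := pow_le_pow_left₀ a0 a 2
        have s0 := L.ss_pos (f.F^[j] α)
        have c1 : L.ss (f.F^[j] α) ^ 2 ≤ r3 * L.ss (f.F^[j] α) := by
          rw [sq]; exact mul_le_mul_of_nonneg_right (hs3 _).le s0.le
        have c2 : L.ss (f.F^[j] α) ≤ f.M (f.F^[j] (f.T L.v α)) - f.M (f.F^[j] α) := by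
          rw [f.iter_T]
          exact f.M_sub_le (L.lt_v _).le
        calc l ^ 2 * (f.P j y) ^ 2 = (f.P j y * l) ^ 2 := by ring
          _ ≤ (Cd * L.ss (f.F^[j] α)) ^ 2 := b
          _ = Cd ^ 2 * L.ss (f.F^[j] α) ^ 2 := by ring
          _ ≤ Cd ^ 2 * (r3 * L.ss (f.F^[j] α)) := mul_le_mul_of_nonneg_left c1 (by positivity)
          _ = Cd ^ 2 * r3 * L.ss (f.F^[j] α) := by ring
          _ ≤ _ := mul_le_mul_of_nonneg_left c2 (by positivity)
      rw [Finset.mul_sum]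
      refine (Finset.sum_le_sum k3).trans ?_
      rw [← Finset.mul_sum]
      have := L.mass_one α
      rw [Nice.mass] at this
      calc _ ≤ Cd ^ 2 * r3 * (1 + f.N) := mul_le_mul_of_nonneg_left this (by positivity)
        _ = _ := by ring
    have k4 := mul_le_mul_of_nonneg_left k1 (sq_nonneg l)
    have k5 := mul_le_mul_of_nonneg_left k2 hCk.le
    rw [hQ]
    linarith
  -- the rescaled data
  have sc : ∀ y : ℝ, α + l * ((y - α) / l) = y := fun y => by field_simp; ring
  have mem : ∀ {a b t : ℝ}, t ∈ Icc ((a - α) / l) ((b - α) / l) → a ≤ α + l * t ∧ α + l * t ≤ b := by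
    intro a b t ht
    have h1 := ht.1
    have h2 := ht.2
    rw [div_le_iff₀ hl0] at h1
    rw [le_div_iff₀ hl0] at h2
    constructor <;> linarith
  have aff : ∀ t, HasDerivAt (fun t : ℝ => α + l * t) l t := fun t =>
    (((hasDerivAt_id t).const_mul l).const_add α).congr_deriv (by ring)
  have divs : ∀ a b : ℝ, (a - α) / l - (b - α) / l = (a - b) / l := fun a b => by field_simp; ring
  have vb : ∀ y, y1 ≤ y → y ≤ y2 → 1 ≤ R * f.P L.q y → f.vv L.q y ≤ Λ := by
    intro y h1 h2 h3
    have a1 := f.P_vv (noSpot y (inI y h1 h2).1 (inI y h1 h2).2)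
    have a2 := f.vv_pos (noSpot y (inI y h1 h2).1 (inI y h1 h2).2)
    have a3 : f.vv L.q y ^ 2 ≤ R := by
      have := mul_le_mul_of_nonneg_right h3 (sq_nonneg (f.vv L.q y))
      rwa [one_mul, mul_assoc, a1, mul_one] at this
    have a4 : f.vv L.q y ≤ R := by
      by_contra hn
      push Not at hn
      nlinarith only [hn, a3, hR]
    rw [hΛ]; linarith
  have parab : Parab ((y1 - α) / l) ((L.o α 4 - α) / l) ((L.o β (-3) - α) / l) ((y2 - α) / l) Λ κ (Q * r3)
      (fun t => L.us (α + l * t) / l) (fun t => f.P L.q (α + l * t)) (fun t => f.vv L.q (α + l * t))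
      (fun t => l * f.vd L.q (α + l * t))
      (fun t => l ^ 2 * (f.kap L.q (α + l * t) * f.vv L.q (α + l * t))) := by
    refine { hAA := ?_, hAB := ?_, hBB := ?_, hlen := ?_, hκ := hκ0, hκ1 := hκ1, hΛ := hΛ1,
             hδ := by positivity, hU := ?_, hv := ?_, hv1 := ?_, hv2 := ?_, vpos := ?_, pv := ?_, pL := ?_,
             vA := ?_, vB := ?_, Upos := ?_, Ule := ?_, UA := ?_, UB := ?_ }
    · rw [divs, le_div_iff₀ hl0]
      have := usα 4 (by norm_num) le_rfl
      rw [L.o_us] at this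
      norm_num at this
      linarith [hy1.2]
    · gcongr
    · rw [divs, le_div_iff₀ hl0]
      have := usβ 2 (by norm_num) (by norm_num)
      rw [L.o_us] at this
      norm_num at this
      linarith [hy2.1]
    · rw [divs, div_le_iff₀ hl0]
      have := hlong L α
      push_cast at this
      rw [← hl] at this
      have : D * l ≤ Λ * l := mul_le_mul_of_nonneg_right (by rw [hΛ]; linarith) hl0.le
      linarith [hy2.2]
    · intro t ht
      exact (((L.hus _).comp t (aff t)).div_const l).congr_deriv (mul_div_cancel_right₀ _ hl0.ne')
    · intro t ht
      obtain ⟨m1, m2⟩ := mem ht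
      have hI := inI _ m1 m2
      exact ((f.hvv L.q (noSpot _ hI.1 hI.2)).comp t (aff t)).congr_deriv (mul_comm _ _)
    · intro t ht
      obtain ⟨m1, m2⟩ := mem ht
      have hI := inI _ m1 m2
      refine (((f.hvd L.q (noSpot _ hI.1 hI.2)).comp t (aff t)).const_mul l).congr_deriv ?_
      ring
    · intro t ht
      obtain ⟨m1, m2⟩ := mem ht
      have hI := inI _ m1 m2
      have := mul_le_mul_of_nonneg_right (kapb _ m1 m2) (f.vv_pos (noSpot _ hI.1 hI.2)).le
      linarith
    · intro t ht
      obtain ⟨m1, m2⟩ := mem ht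
      have hI := inI _ m1 m2
      exact f.vv_pos (noSpot _ hI.1 hI.2)
    · intro t ht
      obtain ⟨m1, m2⟩ := mem ht
      have hI := inI _ m1 m2
      exact f.P_vv (noSpot _ hI.1 hI.2)
    · intro t ht
      obtain ⟨m1, m2⟩ := mem ht
      have := pLb _ m1 m2
      rw [hΛ]; linarith
    · simp only [sc]
      exact vb _ le_rfl (by linarith [hy1.2, hy2.1]) py1
    · simp only [sc]
      exact vb _ (by linarith [hy1.2, hy2.1]) le_rfl py2
    · intro t ht
      exact div_pos (L.us_pos _) hl0
    · intro t ht
      obtain ⟨m1, m2⟩ := mem ht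
      rw [div_le_iff₀ hl0]
      have a1 := husle L (α + l * t)
      have a2 := hT4 (α + l * t) (by linarith) (by linarith)
      have a3 := mul_le_mul_of_nonneg_left a2 (show 0 ≤ U0 by linarith)
      have : (U0 * S) * l ≤ Λ * l := mul_le_mul_of_nonneg_right (by rw [hΛ]; linarith) hl0.le
      linarith
    · simp only [sc]
      rw [le_div_iff₀ hl0]
      exact usα 4 (by norm_num) le_rfl
    · simp only [sc]
      rw [le_div_iff₀ hl0]
      exact usβ 3 (by norm_num) (by norm_num)
  have hδ : Q * r3 * (16 * Λ ^ 5) ≤ κ := by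
    rw [hr3]; apply le_of_eq; field_simp
  obtain ⟨ts, hts, hmain⟩ := parab.main hδ
  obtain ⟨m1, m2⟩ := mem hts
  refine ⟨α + l * ts, ⟨m1, m2⟩, fun x hx => ?_⟩
  have hx' : (x - α) / l ∈ Icc ((L.o α 4 - α) / l) ((L.o β (-3) - α) / l) :=
    ⟨div_le_div_of_nonneg_right (by linarith [hx.1]) hl0.le, div_le_div_of_nonneg_right (by linarith [hx.2]) hl0.le⟩
  obtain ⟨q1, q2⟩ := hmain _ hx'
  simp only [sc] at q1 q2
  rw [← hl]
  have e1 : L.us (α + l * ts) * l + (x - (α + l * ts)) ^ 2 =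
      l ^ 2 * (L.us (α + l * ts) / l + ((x - α) / l - ts) ^ 2) := by field_simp; ring
  have e2 : L.us x * l = l ^ 2 * (L.us x / l) := by field_simp
  have hl2 : 0 ≤ l ^ 2 := sq_nonneg l
  constructor
  · rw [e1, e2]
    have := mul_le_mul_of_nonneg_left q1 hl2
    linarith
  · rw [e1, e2]
    have := mul_le_mul_of_nonneg_left q2 hl2
    linarith

end Nice

theorem seq_ratio {B D D' u u' l : ℝ} (hB : 1 ≤ B) (hl : 0 < l) (hD' : 0 < D') (h1 : D ^ 2 ≤ B * (u * l))
    (h2 : u ≤ B * u') (h3 : u' * l ≤ B * D' ^ 2) : D ≤ B ^ 2 * D' := by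
  have a1 : B * (u * l) ≤ B * (B * u' * l) := by
    apply mul_le_mul_of_nonneg_left _ (by linarith)
    exact mul_le_mul_of_nonneg_right h2 hl.le
  have a2 : B ^ 2 * (u' * l) ≤ B ^ 2 * (B * D' ^ 2) := mul_le_mul_of_nonneg_left h3 (by positivity)
  have a3 : D ^ 2 ≤ B ^ 3 * D' ^ 2 := by linarith
  have a4 : B ^ 3 * D' ^ 2 ≤ B ^ 4 * D' ^ 2 :=
    mul_le_mul_of_nonneg_right (pow_le_pow_right₀ hB (by norm_num)) (sq_nonneg _)
  have a5 : D ^ 2 ≤ (B ^ 2 * D') ^ 2 := by linarith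
  exact le_of_sq_le_sq₀ a5 (by positivity)
where
  le_of_sq_le_sq₀ {a b : ℝ} (h : a ^ 2 ≤ b ^ 2) (hb : 0 ≤ b) : a ≤ b := by
    exact le_of_abs_le ((sq_le_sq.1 h).trans (abs_of_nonneg hb).le)

theorem seq_up {B l : ℝ} {D u : ℕ → ℝ} {a : ℕ} (hB : 1 ≤ B) (hl : 0 < l) (hD : ∀ m ≤ a, 0 < D m)
    (h1 : ∀ m ≤ a, D m ^ 2 ≤ B * (u m * l)) (h2 : ∀ m ≤ a, u m * l ≤ B * D m ^ 2)
    (h3 : ∀ m < a, u m ≤ B * u (m + 1)) (h5 : ∀ m < a, D (m + 1) - D m ≤ B * u m)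
    (he : l ≤ B * u a) : l ≤ B ^ 9 * ((1 + a) ^ 2 * u 0) := by
  have step : ∀ m < a, l / D m ≤ l / D (m + 1) + B ^ 4 := by
    intro m hm
    have p1 := hD m hm.le
    have p2 := hD (m + 1) hm
    have r := seq_ratio hB hl p2 (h1 m hm.le) (h3 m hm) (h2 (m + 1) hm)
    have q := h2 m hm.le
    have e : l / D m - l / D (m + 1) = l * (D (m + 1) - D m) / (D m * D (m + 1)) := by field_simp
    have : l * (D (m + 1) - D m) / (D m * D (m + 1)) ≤ B ^ 4 := by
      rw [div_le_iff₀ (by positivity)]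
      calc l * (D (m + 1) - D m) ≤ l * (B * u m) := mul_le_mul_of_nonneg_left (h5 m hm) hl.le
        _ = B * (u m * l) := by ring
        _ ≤ B * (B * D m ^ 2) := mul_le_mul_of_nonneg_left q (by linarith)
        _ = B ^ 2 * D m * D m := by ring
        _ ≤ B ^ 2 * D m * (B ^ 2 * D (m + 1)) := mul_le_mul_of_nonneg_left r (by positivity)
        _ = _ := by ring
    linarith
  have ind : ∀ m ≤ a, l / D 0 ≤ l / D m + B ^ 4 * m := by
    intro m
    induction m with
    | zero => intro _; simp
    | succ m ih =>
      intro hm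
      have := ih (by omega)
      have := step m (by omega)
      push_cast; linarith
  have p0 := hD 0 (Nat.zero_le _)
  have pa := hD a le_rfl
  have hend : l ≤ B * D a := by
    have : l ^ 2 ≤ (B * D a) ^ 2 := by
      calc l ^ 2 = l * l := sq l
        _ ≤ (B * u a) * l := mul_le_mul_of_nonneg_right he hl.le
        _ = B * (u a * l) := by ring
        _ ≤ B * (B * D a ^ 2) := mul_le_mul_of_nonneg_left (h2 a le_rfl) (by linarith)
        _ = _ := by ring
    exact seq_ratio.le_of_sq_le_sq₀ this (by positivity)
  have h6 : l / D a ≤ B := by rw [div_le_iff₀ pa]; exact hend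
  have h7 : l / D 0 ≤ B ^ 4 * (1 + a) := by
    have := ind a le_rfl
    have : B ≤ B ^ 4 := le_self_pow₀ hB (by norm_num)
    linarith
  rw [div_le_iff₀ p0] at h7
  have h8 : l * l ≤ (B ^ 9 * ((1 + a) ^ 2 * u 0)) * l := by
    calc l * l = l ^ 2 := (sq l).symm
      _ ≤ (B ^ 4 * (1 + a) * D 0) ^ 2 := pow_le_pow_left₀ hl.le h7 2
      _ = B ^ 8 * (1 + a) ^ 2 * D 0 ^ 2 := by ring
      _ ≤ B ^ 8 * (1 + a) ^ 2 * (B * (u 0 * l)) := mul_le_mul_of_nonneg_left (h1 0 (Nat.zero_le _)) (by positivity)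
      _ = _ := by ring
  exact le_of_mul_le_mul_right h8 hl

theorem seq_down {B l : ℝ} {D u : ℕ → ℝ} {a : ℕ} (hB : 1 ≤ B) (hl : 0 < l) (hD : ∀ m ≤ a, 0 < D m)
    (h1 : ∀ m ≤ a, D m ^ 2 ≤ B * (u m * l)) (h2 : ∀ m ≤ a, u m * l ≤ B * D m ^ 2)
    (h4 : ∀ m < a, u (m + 1) ≤ B * u m) (h5 : ∀ m < a, u m ≤ B * (D (m + 1) - D m))
    (he : u 0 ≤ B * l) : (5 + a) ^ 2 * u 0 ≤ 36 * B ^ 9 * l := by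
  have step : ∀ m < a, l / D (m + 1) + (B ^ 4)⁻¹ ≤ l / D m := by
    intro m hm
    have p1 := hD m hm.le
    have p2 := hD (m + 1) hm
    have r := seq_ratio hB hl p1 (h1 (m + 1) hm) (h4 m hm) (h2 m hm.le)
    have q := h1 m hm.le
    have e : l / D m - l / D (m + 1) = l * (D (m + 1) - D m) / (D m * D (m + 1)) := by field_simp
    have : (B ^ 4)⁻¹ ≤ l * (D (m + 1) - D m) / (D m * D (m + 1)) := by
      rw [le_div_iff₀ (by positivity), inv_mul_le_iff₀ (by positivity)]
      calc D m * D (m + 1) ≤ D m * (B ^ 2 * D m) := mul_le_mul_of_nonneg_left r p1.le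
        _ = B ^ 2 * D m ^ 2 := by ring
        _ ≤ B ^ 2 * (B * (u m * l)) := mul_le_mul_of_nonneg_left q (by positivity)
        _ = B ^ 3 * l * u m := by ring
        _ ≤ B ^ 3 * l * (B * (D (m + 1) - D m)) := mul_le_mul_of_nonneg_left (h5 m hm) (by positivity)
        _ = _ := by ring
    linarith
  have ind : ∀ m ≤ a, l / D m + (B ^ 4)⁻¹ * m ≤ l / D 0 := by
    intro m
    induction m with
    | zero => intro _; simp
    | succ m ih =>
      intro hm
      have := ih (by omega)
      have := step m (by omega)
      push_cast; linarith
  have p0 := hD 0 (Nat.zero_le _)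
  have pa := hD a le_rfl
  have hD0 : D 0 ≤ B * l := by
    have : D 0 ^ 2 ≤ (B * l) ^ 2 := by
      calc D 0 ^ 2 ≤ B * (u 0 * l) := h1 0 (Nat.zero_le _)
        _ ≤ B * (B * l * l) := by
          apply mul_le_mul_of_nonneg_left _ (by linarith)
          exact mul_le_mul_of_nonneg_right he hl.le
        _ = _ := by ring
    exact seq_ratio.le_of_sq_le_sq₀ this (by positivity)
  have h6 : a * D 0 ≤ B ^ 4 * l := by
    have h := ind a le_rfl
    have h' : (B ^ 4)⁻¹ * a ≤ l / D 0 := by have := div_pos hl pa; linarith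
    rw [le_div_iff₀ p0, mul_assoc, inv_mul_le_iff₀ (by positivity)] at h'
    exact h'
  have hB4 : B ≤ B ^ 4 := le_self_pow₀ hB (by norm_num)
  have h7 : (5 + a) * D 0 ≤ 6 * B ^ 4 * l := by
    have := mul_le_mul_of_nonneg_right hB4 hl.le
    linarith
  have h8 : ((5 + a) ^ 2 * u 0) * l ≤ (36 * B ^ 9 * l) * l := by
    calc ((5 + a) ^ 2 * u 0) * l = (5 + a) ^ 2 * (u 0 * l) := by ring
      _ ≤ (5 + a) ^ 2 * (B * D 0 ^ 2) := mul_le_mul_of_nonneg_left (h2 0 (Nat.zero_le _)) (by positivity)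
      _ = B * ((5 + a) * D 0) ^ 2 := by ring
      _ ≤ B * (6 * B ^ 4 * l) ^ 2 := by
        apply mul_le_mul_of_nonneg_left _ (by linarith)
        exact pow_le_pow_left₀ (by positivity) h7 2
      _ = _ := by ring
  exact le_of_mul_le_mul_right h8 hl

namespace Level
variable {f : Nice} (L : Level f)

theorem spot_closed : IsClosed {y | L.Spot y} := by
  have : {y | L.Spot y} = ⋃ i ∈ Finset.range L.q, {y | f.d1 (f.F^[i] y) = 0} := by
    ext y; simp [Spot]
  rw [this]
  exact isClosed_biUnion_finset fun i _ => isClosed_eq (f.cont1.comp (f.contF.iterate i)) continuous_const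

theorem spot_below (x : ℝ) : ∃ α, L.Spot α ∧ α ≤ x ∧ ∀ z, L.Spot z → z ≤ x → z ≤ α := by
  obtain ⟨z, hz, z1, z2⟩ := L.exists_spot (f.T (-L.v) (f.T L.w x))
  rw [f.T_T_neg, f.T_neg_T] at z2
  have hb : BddAbove ({y | L.Spot y} ∩ Iic x) := ⟨x, fun y hy => hy.2⟩
  have := (L.spot_closed.inter isClosed_Iic).csSup_mem (s := {y | L.Spot y} ∩ Iic x) ⟨z, hz, z2.le⟩ hb
  exact ⟨_, this.1, this.2, fun y hy h => le_csSup hb ⟨hy, h⟩⟩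

theorem spot_above (x : ℝ) : ∃ α, L.Spot α ∧ x ≤ α ∧ ∀ z, L.Spot z → x ≤ z → α ≤ z := by
  obtain ⟨z, hz, z1, z2⟩ := L.exists_spot x
  have hb : BddBelow ({y | L.Spot y} ∩ Ici x) := ⟨x, fun y hy => hy.2⟩
  have := (L.spot_closed.inter isClosed_Ici).csInf_mem (s := {y | L.Spot y} ∩ Ici x) ⟨z, hz, z1⟩ hb
  exact ⟨_, this.1, this.2, fun y hy h => csInf_le hb ⟨hy, h⟩⟩

/-- there is a spot within `k` small steps -/
def Near (k : ℕ) (x : ℝ) : Prop := ∃ z, L.Spot z ∧ L.o x (-k) ≤ z ∧ z ≤ L.o x k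

theorem o_small (x M : ℝ) : ∃ j : ℕ, L.o x (-j) < M := by
  obtain ⟨j, hj⟩ := L.w_small x M
  exact ⟨j, by simpa [o] using hj⟩
theorem o_big (x M : ℝ) : ∃ j : ℕ, M < L.o x j := by
  obtain ⟨j, hj⟩ := L.w_big x M
  exact ⟨j, by simpa [o] using hj⟩

end Level

set_option maxHeartbeats 2000000 in
/-- the profile of small steps in terms of the combinatorial distance to spots -/
theorem Nice.profile (f : Nice) : ∃ r C : ℝ, 0 < r ∧ 1 ≤ C ∧ ∀ (L : Level f), (∀ x, L.ss x < r) → ∀ x,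
    (∀ k : ℕ, L.Near (k + 1) x → L.ss x ≤ C * ((1 + k) ^ 2 * L.us x)) ∧
    (∃ k : ℕ, L.Near (k + 1) x ∧ (1 + k) ^ 2 * L.us x ≤ C * L.ss x) := by
  obtain ⟨r1, c, hr1, hc, hc1, hnu⟩ := f.near_us 8
  obtain ⟨r2, G, hr2, hG, hgap⟩ := f.gap
  obtain ⟨R, hR, RB⟩ := f.RBo 1
  obtain ⟨S, hS, slow⟩ := f.slowk 4
  obtain ⟨U0, hU0, husle⟩ := f.us_le_ss
  obtain ⟨B, hBe⟩ : ∃ x : ℝ, x = 2 * G + R + U0 * S + S / c := ⟨_, rfl⟩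
  have hUS : 1 ≤ U0 * S := one_le_mul_of_one_le_of_one_le hU0 hS
  have hSc : 0 < S / c := by positivity
  have hB : 1 ≤ B := by linarith
  have hBG : 2 * G ≤ B := by linarith
  have hBR : R ≤ B := by linarith
  have hBU : U0 * S ≤ B := by linarith
  have hBc : S / c ≤ B := by linarith
  have hB9 : 1 ≤ B ^ 9 := one_le_pow₀ hB
  refine ⟨min r1 r2, c⁻¹ + 64 * U0 + 36 * B ^ 9 * S, by positivity, ?_, ?_⟩
  · have : 1 ≤ B ^ 9 * S := one_le_mul_of_one_le_of_one_le hB9 hS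
    have : 0 < c⁻¹ := by positivity
    linarith
  intro L hsm x
  have hs1 : ∀ x, L.ss x < r1 := fun x => (hsm x).trans_le (min_le_left _ _)
  have hs2 : ∀ x, L.ss x < r2 := fun x => (hsm x).trans_le (min_le_right _ _)
  have hci : 0 < c⁻¹ := by positivity
  have hBS : 0 < B ^ 9 * S := by positivity
  by_cases hn : L.Near 8 x
  · constructor
    · intro k _
      obtain ⟨z, hz, z1, z2⟩ := hn
      have h1 := hnu L hs1 z x hz z1 z2
      have h2 : L.ss x ≤ c⁻¹ * L.us x := by rw [le_inv_mul_iff₀ hc]; exact h1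
      have hu := L.us_pos x
      have h3 : L.us x ≤ (1 + k) ^ 2 * L.us x := by
        apply le_mul_of_one_le_left hu.le
        apply one_le_pow₀; linarith [(Nat.cast_nonneg k : (0:ℝ) ≤ k)]
      calc L.ss x ≤ c⁻¹ * L.us x := h2
        _ ≤ c⁻¹ * ((1 + k) ^ 2 * L.us x) := mul_le_mul_of_nonneg_left h3 hci.le
        _ ≤ _ := mul_le_mul_of_nonneg_right (by linarith) (by positivity)
    · refine ⟨7, hn, ?_⟩
      have := husle L x
      have hs := L.ss_pos x
      norm_num
      calc 64 * L.us x ≤ 64 * U0 * L.ss x := by linarith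
        _ ≤ _ := mul_le_mul_of_nonneg_right (by linarith) hs.le
  obtain ⟨α, hα, αx, αmax⟩ := L.spot_below x
  obtain ⟨β, hβ, xβ, βmin⟩ := L.spot_above x
  have ox : L.o x 0 = x := L.o_zero x
  have α8 : α < L.o x (-8) := by
    by_contra h
    push Not at h
    exact hn ⟨α, hα, h, αx.trans (ox.ge.trans (L.o_le (by norm_num)))⟩
  have β8 : L.o x 8 < β := by
    by_contra h
    push Not at h
    exact hn ⟨β, hβ, ((L.o_le (by norm_num)).trans ox.le).trans xβ, h⟩
  have hgp : ∀ z, L.Spot z → α < z → β ≤ z := by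
    intro z hz h
    apply βmin z hz
    by_contra hh
    push Not at hh
    exact absurd (αmax z hz hh.le) (not_le.2 h)
  have αo8 : L.o α 8 < x := by
    have := (L.o_lt_iff 8).2 α8
    rw [L.o_o] at this; rwa [← ox]
  have βo8 : x < L.o β (-8) := by
    have := (L.o_lt_iff (-8)).2 β8
    rw [L.o_o] at this; rwa [← ox]
  have hα0 := L.o_zero α
  have hβ0 := L.o_zero β
  have hαβ : L.o α 8 < β := αo8.trans_le xβ
  have αltβ : α < β := by rw [← hα0]; exact (L.o_lt (by norm_num)).trans hαβ
  obtain ⟨xs, hxs, hpar⟩ := hgap L hs2 α β hα hβ hgp hαβ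
  obtain ⟨l, hl⟩ : ∃ x : ℝ, x = L.ss α := ⟨_, rfl⟩
  have hl0 : 0 < l := by rw [hl]; exact L.ss_pos α
  rw [← hl] at hpar
  have hβv : β ≤ f.T ((3 : ℤ) • L.v) α := by
    obtain ⟨z, hz, z1, z2⟩ := L.exists_spot (f.T (-L.w) α)
    refine (hgp z hz ((L.lt_psi α).trans_le z1)).trans (z2.le.trans ?_)
    rw [← f.T_add, ← f.T_add]
    apply f.T_mono_val_le
    rw [f.val_add, f.val_add, f.val_neg, f.val_zsmul]; push_cast; linarith [L.hlt, L.hv]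
  have hss1 : ∀ y, α ≤ y → y ≤ β → L.ss y ≤ S * l := by
    intro y h1 h2
    rw [hl]
    refine slow L α y ?_ ?_
    · refine le_trans (L.v_le_o (m := 0) le_rfl (by norm_num)) ?_
      simpa [L.o_zero] using h1
    · refine h2.trans (hβv.trans (f.T_mono_val_le ?_ α))
      rw [f.val_zsmul, f.val_zsmul]; push_cast; linarith [L.hv]
  have hss2 : ∀ y, α ≤ y → y ≤ β → l ≤ S * L.ss y := by
    intro y h1 h2
    rw [hl]
    refine slow L y α ?_ (h1.trans ?_)
    · have := (f.T_le_iff (-((3 : ℤ) • L.v))).2 (h2.trans hβv)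
      rw [f.T_neg_T] at this
      refine le_trans (f.T_mono_val_le ?_ y) this
      rw [f.val_neg, f.val_neg, f.val_zsmul, f.val_zsmul]; push_cast; linarith [L.hv]
    · refine (L.o_zero y).ge.trans (L.o_v_le le_rfl (by norm_num))
  have αo4 : α ≤ L.o α 4 := hα0.ge.trans (L.o_le (by norm_num))
  have βo3 : L.o β (-3) ≤ β := (L.o_le (by norm_num)).trans hβ0.le
  -- the distance function
  obtain ⟨s, hse⟩ : ∃ x : ℝ, x = √(L.us xs * l) := ⟨_, rfl⟩
  have husl : 0 < L.us xs * l := mul_pos (L.us_pos _) hl0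
  have hs0 : 0 < s := by rw [hse]; exact Real.sqrt_pos.2 husl
  have hs2' : s ^ 2 = L.us xs * l := by rw [hse]; exact Real.sq_sqrt husl.le
  obtain ⟨D, hDe⟩ : ∃ D : ℝ → ℝ, ∀ y, D y = s + |y - xs| := ⟨_, fun _ => rfl⟩
  have hD0 : ∀ y, 0 < D y := fun y => by rw [hDe]; have := abs_nonneg (y - xs); linarith
  have hD1 : ∀ y ∈ Icc (L.o α 4) (L.o β (-3)), D y ^ 2 ≤ B * (L.us y * l) := by
    intro y hy
    have h1 := (hpar y hy).2
    have hu := mul_pos (L.us_pos y) hl0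
    rw [hDe]
    have h2 : (s + |y - xs|) ^ 2 ≤ 2 * (s ^ 2 + |y - xs| ^ 2) := by nlinarith only [sq_nonneg (s - |y - xs|)]
    rw [sq_abs, hs2'] at h2
    have h3 := mul_le_mul_of_nonneg_right hBG hu.le
    linarith
  have hD2 : ∀ y ∈ Icc (L.o α 4) (L.o β (-3)), L.us y * l ≤ B * D y ^ 2 := by
    intro y hy
    have h1 := (hpar y hy).1
    rw [hDe]
    have h2 : s ^ 2 + |y - xs| ^ 2 ≤ (s + |y - xs|) ^ 2 := by
      have := mul_nonneg hs0.le (abs_nonneg (y - xs)); linarith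
    rw [sq_abs, hs2'] at h2
    calc L.us y * l ≤ G * (L.us xs * l + (y - xs) ^ 2) := h1
      _ ≤ G * (s + |y - xs|) ^ 2 := mul_le_mul_of_nonneg_left h2 (by linarith)
      _ ≤ _ := mul_le_mul_of_nonneg_right (by linarith) (sq_nonneg _)
  have hRu : ∀ m n : ℤ, |m - n| ≤ 1 → L.us (L.o x m) ≤ B * L.us (L.o x n) := by
    intro m n h
    rw [abs_le] at h
    have := RB L (L.o x n) (L.o x m) (by rw [L.o_o]; apply L.o_le; push_cast; omega)
      (by rw [L.o_o]; apply L.o_le; push_cast; omega)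
    exact this.trans (mul_le_mul_of_nonneg_right hBR (L.us_pos _).le)
  have hul : L.us x ≤ B * l := by
    calc L.us x ≤ U0 * L.ss x := husle L x
      _ ≤ U0 * (S * l) := mul_le_mul_of_nonneg_left (hss1 x αx xβ) (by linarith)
      _ = (U0 * S) * l := by ring
      _ ≤ _ := mul_le_mul_of_nonneg_right hBU hl0.le
  have hend : ∀ y, α ≤ y → y ≤ β → ∀ z, L.Spot z → L.o y (-8) ≤ z → z ≤ L.o y 8 → l ≤ B * L.us y := by
    intro y h1 h2 z hz z1 z2
    have a1 := hnu L hs1 z y hz z1 z2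
    have a2 := hss2 y h1 h2
    calc l ≤ S * L.ss y := a2
      _ = S / c * (c * L.ss y) := by field_simp
      _ ≤ S / c * L.us y := mul_le_mul_of_nonneg_left a1 hSc.le
      _ ≤ _ := mul_le_mul_of_nonneg_right hBc (L.us_pos _).le
  have hDd : ∀ y y', D y - D y' ≤ |y - y'| := by
    intro y y'
    rw [hDe, hDe]
    have := abs_sub_abs_le_abs_sub (y - xs) (y' - xs)
    rw [show y - xs - (y' - xs) = y - y' by ring] at this
    linarith
  -- the index a on the left
  obtain ⟨a, ha1, ha2⟩ : ∃ a : ℕ, (∀ m ≤ a, L.o α 4 ≤ L.o x (-m)) ∧ L.o x (-(a : ℤ) - 1) < L.o α 4 := by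
    classical
    have hex := L.o_small x (L.o α 4)
    have h0 : Nat.find hex ≠ 0 := by
      intro h
      have := Nat.find_spec hex
      rw [h] at this
      simp only [Nat.cast_zero, neg_zero, ox] at this
      have : L.o α 4 ≤ L.o α 8 := L.o_le (by norm_num)
      linarith
    obtain ⟨a, ha⟩ := Nat.exists_eq_succ_of_ne_zero h0
    refine ⟨a, fun m hm => ?_, ?_⟩
    · have := Nat.find_min hex (m := m) (by omega)
      exact not_lt.1 this
    · have := Nat.find_spec hex
      rw [ha] at this
      rwa [Nat.succ_eq_add_one, Nat.cast_add, Nat.cast_one, neg_add] at this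
  obtain ⟨b, hb1, hb2⟩ : ∃ b : ℕ, (∀ m ≤ b, L.o x m ≤ L.o β (-3)) ∧ L.o β (-3) < L.o x (b + 1) := by
    classical
    have hex := L.o_big x (L.o β (-3))
    have h0 : Nat.find hex ≠ 0 := by
      intro h
      have := Nat.find_spec hex
      rw [h] at this
      simp only [Nat.cast_zero, ox] at this
      have : L.o β (-8) ≤ L.o β (-3) := L.o_le (by norm_num)
      linarith
    obtain ⟨a, ha⟩ := Nat.exists_eq_succ_of_ne_zero h0
    refine ⟨a, fun m hm => ?_, ?_⟩
    · have := Nat.find_min hex (m := m) (by omega)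
      exact not_lt.1 this
    · have := Nat.find_spec hex
      rw [ha] at this
      rwa [Nat.succ_eq_add_one, Nat.cast_add, Nat.cast_one] at this
  have x1 : x ≤ L.o β (-3) := βo8.le.trans (L.o_le (by norm_num))
  have x2 : L.o α 4 ≤ x := (L.o_le (by norm_num)).trans αo8.le
  have inA : ∀ m ≤ a, L.o x (-(m : ℤ)) ∈ Icc (L.o α 4) (L.o β (-3)) := fun m hm =>
    ⟨ha1 m hm, ((L.o_le (by omega)).trans ox.le).trans x1⟩
  have inB : ∀ m ≤ b, L.o x (m : ℤ) ∈ Icc (L.o α 4) (L.o β (-3)) := fun m hm =>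
    ⟨x2.trans (ox.ge.trans (L.o_le (by omega))), hb1 m hm⟩
  have us0A : L.us (L.o x (-((0 : ℕ) : ℤ))) = L.us x := by simp [ox]
  have us0B : L.us (L.o x (((0 : ℕ) : ℤ))) = L.us x := by simp [ox]
  -- end values
  have endA : l ≤ B * L.us (L.o x (-(a : ℤ))) := by
    have hI := inA a le_rfl
    refine hend _ (αo4.trans hI.1) (hI.2.trans βo3) α hα ?_ ?_
    · have := (L.o_le_iff (-4)).2 ha2.le
      rw [L.o_o, L.o_o] at this
      norm_num at this
      rw [hα0] at this
      rw [L.o_o]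
      exact (L.o_le (by omega)).trans this
    · have : L.o x (-(a:ℤ)) ≤ L.o (L.o x (-(a:ℤ))) 8 := by rw [L.o_o]; exact L.o_le (by omega)
      exact (αo4.trans hI.1).trans this
  have endB : l ≤ B * L.us (L.o x (b : ℤ)) := by
    have hI := inB b le_rfl
    refine hend _ (αo4.trans hI.1) (hI.2.trans βo3) β hβ ?_ ?_
    · have : L.o (L.o x (b:ℤ)) (-8) ≤ L.o x (b:ℤ) := by rw [L.o_o]; exact L.o_le (by omega)
      exact this.trans (hI.2.trans βo3)
    · have := (L.o_le_iff (3)).2 hb2.le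
      rw [L.o_o, L.o_o] at this
      norm_num at this
      rw [hβ0] at this
      rw [L.o_o]
      exact this.trans (L.o_le (by omega))
  have upA : l ≤ B ^ 9 * ((1 + a) ^ 2 * L.us x) := by
    rw [← us0A]
    refine seq_up (D := fun m => D (L.o x (-(m : ℤ)))) (u := fun m => L.us (L.o x (-(m : ℤ)))) hB hl0
      (fun m _ => hD0 _) (fun m hm => hD1 _ (inA m hm)) (fun m hm => hD2 _ (inA m hm)) (fun m hm => ?_)
      (fun m hm => ?_) endA
    · apply hRu; rw [abs_le]; push_cast; omega
    · refine (hDd _ _).trans ?_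
      rw [abs_sub_comm, abs_of_nonneg (sub_nonneg.2 (L.o_le (by push_cast; omega)))]
      have e := L.o_us x (-(m : ℤ))
      have e2 : -(m : ℤ) - 1 = -((m + 1 : ℕ) : ℤ) := by push_cast; ring
      rw [e2] at e
      rw [← e]
      exact le_mul_of_one_le_left (L.us_pos _).le hB
  have upB : l ≤ B ^ 9 * ((1 + b) ^ 2 * L.us x) := by
    rw [← us0B]
    refine seq_up (D := fun m => D (L.o x (m : ℤ))) (u := fun m => L.us (L.o x (m : ℤ))) hB hl0
      (fun m _ => hD0 _) (fun m hm => hD1 _ (inB m hm)) (fun m hm => hD2 _ (inB m hm)) (fun m hm => ?_)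
      (fun m hm => ?_) endB
    · apply hRu; rw [abs_le]; push_cast; omega
    · refine (hDd _ _).trans ?_
      rw [abs_of_nonneg (sub_nonneg.2 (L.o_le (by push_cast; omega)))]
      have e := L.o_us x ((m + 1 : ℕ) : ℤ)
      have e2 : ((m + 1 : ℕ) : ℤ) - 1 = m := by push_cast; ring
      rw [e2] at e
      rw [← e]
      apply hRu; rw [abs_le]; push_cast; omega
  have fin1 : ∀ a k : ℕ, a ≤ k → l ≤ B ^ 9 * ((1 + a) ^ 2 * L.us x) →
      L.ss x ≤ (c⁻¹ + 64 * U0 + 36 * B ^ 9 * S) * ((1 + k) ^ 2 * L.us x) := by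
    intro a k h1 h2
    have hk : ((1 : ℝ) + a) ^ 2 ≤ (1 + k) ^ 2 := by
      apply pow_le_pow_left₀ (by positivity)
      have : (a : ℝ) ≤ k := by exact_mod_cast h1
      linarith
    have hu := L.us_pos x
    have hp : 0 ≤ (1 + (k:ℝ)) ^ 2 * L.us x := by positivity
    calc L.ss x ≤ S * l := hss1 x αx xβ
      _ ≤ S * (B ^ 9 * ((1 + a) ^ 2 * L.us x)) := mul_le_mul_of_nonneg_left h2 (by linarith)
      _ ≤ S * (B ^ 9 * ((1 + k) ^ 2 * L.us x)) := by
        apply mul_le_mul_of_nonneg_left _ (by linarith)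
        apply mul_le_mul_of_nonneg_left _ (by positivity)
        exact mul_le_mul_of_nonneg_right hk hu.le
      _ = (B ^ 9 * S) * ((1 + k) ^ 2 * L.us x) := by ring
      _ ≤ _ := mul_le_mul_of_nonneg_right (by linarith) hp
  have fin2 : ∀ a : ℕ, (5 + a) ^ 2 * L.us x ≤ 36 * B ^ 9 * l →
      (1 + ((a + 4 : ℕ) : ℝ)) ^ 2 * L.us x ≤ (c⁻¹ + 64 * U0 + 36 * B ^ 9 * S) * L.ss x := by
    intro a h
    calc (1 + ((a + 4 : ℕ) : ℝ)) ^ 2 * L.us x = (5 + a) ^ 2 * L.us x := by push_cast; ring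
      _ ≤ 36 * B ^ 9 * l := h
      _ ≤ 36 * B ^ 9 * (S * L.ss x) := mul_le_mul_of_nonneg_left (hss2 x αx xβ) (by positivity)
      _ = (36 * B ^ 9 * S) * L.ss x := by ring
      _ ≤ _ := mul_le_mul_of_nonneg_right (by linarith) (L.ss_pos x).le
  constructor
  · rintro k ⟨z, hz, z1, z2⟩
    by_cases hzα : z ≤ α
    · refine fin1 a k ?_ upA
      by_contra h
      push Not at h
      have h1 := ha1 (k + 1) h
      have : α < L.o α 4 := by nth_rewrite 1 [← hα0]; exact L.o_lt (by norm_num)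
      linarith
    · push Not at hzα
      have hzβ := hgp z hz hzα
      refine fin1 b k ?_ upB
      by_contra h
      push Not at h
      have h1 := hb1 (k + 1) h
      have : L.o β (-3) < β := by nth_rewrite 2 [← hβ0]; exact L.o_lt (by norm_num)
      linarith
  · rcases le_total x xs with hx | hx
    · refine ⟨a + 4, ⟨α, hα, ?_, αx.trans (ox.ge.trans (L.o_le (by omega)))⟩, fin2 a ?_⟩
      · have := (L.o_le_iff (-4)).2 ha2.le
        rw [L.o_o, L.o_o] at this
        norm_num at this
        rw [hα0] at this
        exact (L.o_le (by push_cast; omega)).trans this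
      rw [← us0A]
      refine seq_down (D := fun m => D (L.o x (-(m : ℤ)))) (u := fun m => L.us (L.o x (-(m : ℤ)))) hB hl0
        (fun m _ => hD0 _) (fun m hm => hD1 _ (inA m hm)) (fun m hm => hD2 _ (inA m hm)) (fun m hm => ?_)
        (fun m hm => ?_) (by rw [us0A]; exact hul)
      · apply hRu; rw [abs_le]; push_cast; omega
      · have e := L.o_us x (-(m : ℤ))
        have e2 : -(m : ℤ) - 1 = -((m + 1 : ℕ) : ℤ) := by push_cast; ring
        rw [e2] at e
        have le1 : L.o x (-(m : ℤ)) ≤ xs := ((L.o_le (by omega)).trans ox.le).trans hx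
        have le2 : L.o x (-((m + 1 : ℕ) : ℤ)) ≤ xs := ((L.o_le (by omega)).trans ox.le).trans hx
        have : D (L.o x (-((m + 1 : ℕ) : ℤ))) - D (L.o x (-(m : ℤ))) = L.us (L.o x (-(m : ℤ))) := by
          rw [hDe, hDe, e, abs_of_nonpos (by linarith), abs_of_nonpos (by linarith)]; ring
        rw [this]
        exact le_mul_of_one_le_left (L.us_pos _).le hB
    · refine ⟨b + 4, ⟨β, hβ, ((L.o_le (by omega)).trans ox.le).trans xβ, ?_⟩, fin2 b ?_⟩
      · have := (L.o_le_iff (3)).2 hb2.le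
        rw [L.o_o, L.o_o] at this
        norm_num at this
        rw [hβ0] at this
        exact this.trans (L.o_le (by push_cast; omega))
      rw [← us0B]
      refine seq_down (D := fun m => D (L.o x (m : ℤ))) (u := fun m => L.us (L.o x (m : ℤ))) hB hl0
        (fun m _ => hD0 _) (fun m hm => hD1 _ (inB m hm)) (fun m hm => hD2 _ (inB m hm)) (fun m hm => ?_)
        (fun m hm => ?_) (by rw [us0B]; exact hul)
      · apply hRu; rw [abs_le]; push_cast; omega
      · have e := L.o_us x ((m + 1 : ℕ) : ℤ)
        have e2 : ((m + 1 : ℕ) : ℤ) - 1 = m := by push_cast; ring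
        rw [e2] at e
        have le1 : xs ≤ L.o x (m : ℤ) := hx.trans (ox.ge.trans (L.o_le (by omega)))
        have le2 : xs ≤ L.o x ((m + 1 : ℕ) : ℤ) := hx.trans (ox.ge.trans (L.o_le (by omega)))
        have : D (L.o x ((m + 1 : ℕ) : ℤ)) - D (L.o x (m : ℤ)) = L.us (L.o x ((m + 1 : ℕ) : ℤ)) := by
          rw [hDe, hDe, e, abs_of_nonneg (by linarith), abs_of_nonneg (by linarith)]; ring
        rw [this]
        apply hRu; rw [abs_le]; push_cast; omega

/-- a conjugacy between two maps matching critical points -/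
structure Conj (f g : Nice) where
  H : ℝ → ℝ
  cont : Continuous H
  mono : StrictMono H
  hF : ∀ x, H (f.F x) = g.F (H x)
  hshift : ∀ x (k : ℤ), H (x + k) = H x + k
  crit : ∀ x, f.d1 x = 0 ↔ g.d1 (H x) = 0

namespace Conj

def reflect {f g : Nice} (c : Conj f g) : Conj f.reflect g.reflect where
  H x := -c.H (-x)
  cont := (c.cont.comp continuous_neg).neg
  mono x y h := neg_lt_neg (c.mono (neg_lt_neg h))
  hF x := by simp [Nice.reflect, c.hF]
  hshift x k := by
    have := c.hshift (-x) (-k)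
    push_cast at this
    rw [neg_add, this]; ring
  crit x := by simpa [Nice.reflect] using c.crit (-x)

def rf {f g : Nice} (c : Conj f g) : ∀ n, Conj (f.rf n) (g.rf n)
  | 0 => c
  | n + 1 => (rf c n).reflect

theorem rf_H {f g : Nice} (c : Conj f g) (n : ℕ) : (Even n → ∀ x, (c.rf n).H x = c.H x) ∧
    (Odd n → ∀ x, (c.rf n).H x = - c.H (-x)) := by
  induction n with
  | zero => exact ⟨fun _ _ => rfl, fun h => by simp at h⟩
  | succ n ih =>
    constructor
    · intro h x
      have : Odd n := by simpa [Nat.even_add_one] using h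
      change -(c.rf n).H (-x) = _
      rw [ih.2 this]; simp
    · intro h x
      have : Even n := by
        rw [← Nat.not_even_iff_odd, Nat.even_add_one, not_not] at h; exact h
      change -(c.rf n).H (-x) = _
      rw [ih.1 this]

variable {f g : Nice} (c : Conj f g) (L : Level f) (M : Level g)

theorem T (v : ℤ × ℤ) (x : ℝ) : c.H (f.T v x) = g.T v (c.H x) := Nice.T_conj f g c.H c.hF c.hshift v x

theorem spot (hw : L.w = M.w) (x : ℝ) : L.Spot x ↔ M.Spot (c.H x) := by
  have hq : L.q = M.q := by
    have h1 := L.q_cast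
    have h2 := M.q_cast
    rw [hw] at h1; omega
  have hs : ∀ i : ℕ, c.H (f.F^[i] x) = g.F^[i] (c.H x) := by
    intro i
    induction i with
    | zero => rfl
    | succ i ih => rw [Function.iterate_succ_apply', c.hF, ih, Function.iterate_succ_apply']
  simp only [Level.Spot, hq, c.crit, hs]

theorem o (hw : L.w = M.w) (x : ℝ) (m : ℤ) : c.H (L.o x m) = M.o (c.H x) m := by
  rw [Level.o, Level.o, c.T, hw]

theorem surj (y : ℝ) : ∃ x, c.H x = y := by
  have h1 : c.H (((⌊y - c.H 0⌋ : ℤ) : ℝ)) ≤ y := by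
    have := c.hshift 0 ⌊y - c.H 0⌋
    rw [zero_add] at this
    rw [this]; linarith [Int.floor_le (y - c.H 0)]
  have h2 : y ≤ c.H (((⌈y - c.H 0⌉ : ℤ) : ℝ)) := by
    have := c.hshift 0 ⌈y - c.H 0⌉
    rw [zero_add] at this
    rw [this]; linarith [Int.le_ceil (y - c.H 0)]
  exact mem_range_of_exists_le_of_exists_ge c.cont ⟨_, h1⟩ ⟨_, h2⟩

theorem near (hw : L.w = M.w) (k : ℕ) (x : ℝ) : L.Near k x ↔ M.Near k (c.H x) := by
  constructor
  · rintro ⟨z, hz, h1, h2⟩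
    refine ⟨c.H z, (c.spot L M hw z).1 hz, ?_, ?_⟩
    · rw [← c.o L M hw]; exact c.mono.monotone h1
    · rw [← c.o L M hw]; exact c.mono.monotone h2
  · rintro ⟨z, hz, h1, h2⟩
    obtain ⟨z, rfl⟩ := c.surj z
    rw [← c.o L M hw] at h1 h2
    exact ⟨z, (c.spot L M hw z).2 hz, c.mono.le_iff_le.1 h1, c.mono.le_iff_le.1 h2⟩

/-- the small and big steps are distorted comparably -/
def Cmp (A : ℝ) : Prop := ∀ x, M.us (c.H x) * L.ss x ≤ A * (L.us x * M.ss (c.H x)) ∧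
    L.us x * M.ss (c.H x) ≤ A * (M.us (c.H x) * L.ss x)

theorem Cmp.mono {c : Conj f g} {L : Level f} {M : Level g} {A B : ℝ} (h : c.Cmp L M A) (hAB : A ≤ B) :
    c.Cmp L M B := fun x => by
  have h1 := mul_pos (L.us_pos x) (M.ss_pos (c.H x))
  have h2 := mul_pos (M.us_pos (c.H x)) (L.ss_pos x)
  exact ⟨(h x).1.trans (mul_le_mul_of_nonneg_right hAB h1.le), (h x).2.trans (mul_le_mul_of_nonneg_right hAB h2.le)⟩

end Conj

theorem Nice.compare (f g : Nice) : ∃ r A : ℝ, 0 < r ∧ 1 ≤ A ∧ ∀ (c : Conj f g) (L : Level f) (M : Level g),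
    L.w = M.w → (∀ x, L.ss x < r) → (∀ x, M.ss x < r) → c.Cmp L M A := by
  obtain ⟨r1, C1, hr1, hC1, h1⟩ := f.profile
  obtain ⟨r2, C2, hr2, hC2, h2⟩ := g.profile
  refine ⟨min r1 r2, C1 * C2, by positivity, one_le_mul_of_one_le_of_one_le hC1 hC2, ?_⟩
  intro c L M hw s1 s2 x
  obtain ⟨a1, a2⟩ := h1 L (fun x => (s1 x).trans_le (min_le_left _ _)) x
  obtain ⟨b1, b2⟩ := h2 M (fun x => (s2 x).trans_le (min_le_right _ _)) (c.H x)
  have key : ∀ {C C' u s u' s' k : ℝ}, 1 ≤ C → 1 ≤ C' → 0 < u → 0 < s → 0 < u' → 0 < s' →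
      k * u ≤ C * s → s' ≤ C' * (k * u') → u * s' ≤ C * C' * (u' * s) := by
    intro C C' u s u' s' k hC hC' hu hs hu' hs' h h'
    calc u * s' ≤ u * (C' * (k * u')) := mul_le_mul_of_nonneg_left h' hu.le
      _ = (C' * u') * (k * u) := by ring
      _ ≤ (C' * u') * (C * s) := mul_le_mul_of_nonneg_left h (by positivity)
      _ = _ := by ring
  constructor
  · obtain ⟨k, n, hk⟩ := b2
    have := key hC2 hC1 (M.us_pos _) (M.ss_pos _) (L.us_pos _) (L.ss_pos _) hk (a1 k ((c.near L M hw _ _).2 n))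
    rwa [mul_comm C2] at this
  · obtain ⟨k, n, hk⟩ := a2
    exact key hC1 hC2 (L.us_pos _) (L.ss_pos _) (M.us_pos _) (M.ss_pos _) hk (b1 k ((c.near L M hw _ _).1 n))

theorem seq_cmp {p P : ℕ → ℝ} {j : ℕ} {Q R l m d D : ℝ} (hQ : 1 ≤ Q) (hR : 1 ≤ R) (hl : 0 < l) (hm : 0 < m)
    (hp : p 0 = 0) (hP : P 0 = 0)
    (h1 : ∀ i ≤ j, (P (i + 1) - P i) * l ≤ Q * ((p (i + 1) - p i) * m))
    (h2 : ∀ i ≤ j, (p (i + 1) - p i) * m ≤ Q * ((P (i + 1) - P i) * l))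
    (hr : p (j + 1) ≤ R * p j) (d1 : p j ≤ d) (d2 : d ≤ p (j + 1)) (D1 : P j ≤ D) (D2 : D ≤ P (j + 1)) :
    D * l ≤ Q * R * (d * m) ∧ d * m ≤ Q * R * (D * l) := by
  have a1 : ∀ i ≤ j + 1, P i * l ≤ Q * (p i * m) := by
    intro i
    induction i with
    | zero => intro _; rw [hp, hP]; simp
    | succ i ih =>
      intro h
      have := ih (by omega)
      have := h1 i (by omega)
      linarith
  have a2 : ∀ i ≤ j + 1, p i * m ≤ Q * (P i * l) := by
    intro i
    induction i with
    | zero => intro _; rw [hp, hP]; simp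
    | succ i ih =>
      intro h
      have := ih (by omega)
      have := h2 i (by omega)
      linarith
  have hdR : p (j + 1) ≤ R * d := hr.trans (mul_le_mul_of_nonneg_left d1 (by linarith))
  constructor
  · calc D * l ≤ P (j + 1) * l := mul_le_mul_of_nonneg_right D2 hl.le
      _ ≤ Q * (p (j + 1) * m) := a1 _ le_rfl
      _ ≤ Q * (R * d * m) := by
        apply mul_le_mul_of_nonneg_left _ (by linarith)
        exact mul_le_mul_of_nonneg_right hdR hm.le
      _ = _ := by ring
  · calc d * m ≤ R * p j * m := mul_le_mul_of_nonneg_right (d2.trans hr) hm.le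
      _ = R * (p j * m) := by ring
      _ ≤ R * (Q * (P j * l)) := mul_le_mul_of_nonneg_left (a2 j (by omega)) (by linarith)
      _ ≤ R * (Q * (D * l)) := by
        apply mul_le_mul_of_nonneg_left _ (by linarith)
        apply mul_le_mul_of_nonneg_left _ (by linarith)
        exact mul_le_mul_of_nonneg_right D1 hl.le
      _ = _ := by ring

set_option maxHeartbeats 1000000 in
theorem Nice.level_est (f g : Nice) (A : ℝ) (hA : 1 ≤ A) : ∃ C : ℝ, 1 ≤ C ∧ ∀ (c : Conj f g) (L : Level f) (M : Level g),
    L.v = M.v → L.w = M.w → c.Cmp L M A → ∀ x,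
    (∀ y, f.T (-L.w) x ≤ y → y ≤ f.T L.v x →
      (c.H y - c.H x) * L.ss x ≤ C * ((y - x) * M.ss (c.H x)) ∧
      (y - x) * M.ss (c.H x) ≤ C * ((c.H y - c.H x) * L.ss x)) ∧
    (∀ y, f.T (-L.v) x ≤ y → y ≤ f.T L.w x →
      (c.H x - c.H y) * L.ss x ≤ C * ((x - y) * M.ss (c.H x)) ∧
      (x - y) * M.ss (c.H x) ≤ C * ((c.H x - c.H y) * L.ss x)) := by
  obtain ⟨S1, hS1, slow1⟩ := f.slowk 2
  obtain ⟨S2, hS2, slow2⟩ := g.slowk 2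
  obtain ⟨R, hR, RB⟩ := f.RBo 1
  have hSS := one_le_mul_of_one_le_of_one_le hS1 hS2
  have hQ := one_le_mul_of_one_le_of_one_le hSS hA
  refine ⟨S1 * S2 * A * (1 + R), one_le_mul_of_one_le_of_one_le hQ (by linarith), ?_⟩
  intro c L M hv hw hcmp x
  have lx := L.ss_pos x
  have mx := M.ss_pos (c.H x)
  have tw : ∀ x, f.T ((2 : ℤ) • L.v) x = f.T L.v (f.T L.v x) := fun x => by rw [← f.T_add, two_smul]
  have tw' : ∀ x, f.T (-((2 : ℤ) • L.v)) x = f.T (-L.v) (f.T (-L.v) x) := fun x => by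
    rw [← f.T_add, two_smul, neg_add]
  -- comparison of steps at nearby points
  have key : ∀ z, f.T (-((2 : ℤ) • L.v)) x ≤ z → z ≤ f.T ((2 : ℤ) • L.v) x →
      M.us (c.H z) * L.ss x ≤ S1 * S2 * A * (L.us z * M.ss (c.H x)) ∧
      L.us z * M.ss (c.H x) ≤ S1 * S2 * A * (M.us (c.H z) * L.ss x) := by
    intro z h1 h2
    have h1' : x ≤ f.T ((2 : ℤ) • L.v) z := by
      have := (f.T_le_iff ((2 : ℤ) • L.v)).2 h1
      rwa [f.T_T_neg] at this
    have h2' : f.T (-((2 : ℤ) • L.v)) z ≤ x := by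
      have := (f.T_le_iff (-((2 : ℤ) • L.v))).2 h2
      rwa [f.T_neg_T] at this
    have G : ∀ {a b : ℝ} (u : ℤ × ℤ), f.T u a ≤ b → g.T u (c.H a) ≤ c.H b := fun u h => by
      rw [← c.T]; exact c.mono.monotone h
    have G' : ∀ {a b : ℝ} (u : ℤ × ℤ), b ≤ f.T u a → c.H b ≤ g.T u (c.H a) := fun u h => by
      rw [← c.T]; exact c.mono.monotone h
    have s1 := slow1 L x z h1 h2
    have s2 := slow1 L z x h2' h1'
    have s3 := slow2 M (c.H x) (c.H z) (by rw [← hv]; exact G _ h1) (by rw [← hv]; exact G' _ h2)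
    have s4 := slow2 M (c.H z) (c.H x) (by rw [← hv]; exact G _ h2') (by rw [← hv]; exact G' _ h1')
    obtain ⟨q1, q2⟩ := hcmp z
    have u1 := L.us_pos z
    have u2 := M.us_pos (c.H z)
    constructor
    · calc M.us (c.H z) * L.ss x ≤ M.us (c.H z) * (S1 * L.ss z) := mul_le_mul_of_nonneg_left s2 u2.le
        _ = S1 * (M.us (c.H z) * L.ss z) := by ring
        _ ≤ S1 * (A * (L.us z * M.ss (c.H z))) := mul_le_mul_of_nonneg_left q1 (by linarith)
        _ = S1 * A * L.us z * M.ss (c.H z) := by ring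
        _ ≤ S1 * A * L.us z * (S2 * M.ss (c.H x)) := mul_le_mul_of_nonneg_left s3 (by positivity)
        _ = _ := by ring
    · calc L.us z * M.ss (c.H x) ≤ L.us z * (S2 * M.ss (c.H z)) := mul_le_mul_of_nonneg_left s4 u1.le
        _ = S2 * (L.us z * M.ss (c.H z)) := by ring
        _ ≤ S2 * (A * (M.us (c.H z) * L.ss z)) := mul_le_mul_of_nonneg_left q2 (by linarith)
        _ = S2 * A * M.us (c.H z) * L.ss z := by ring
        _ ≤ S2 * A * M.us (c.H z) * (S1 * L.ss x) := mul_le_mul_of_nonneg_left s1 (by positivity)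
        _ = _ := by ring
  have ox : L.o x 0 = x := L.o_zero x
  have oH : ∀ m, c.H (L.o x m) - c.H (L.o x (m - 1)) = M.us (c.H (L.o x m)) := by
    intro m
    rw [c.o L M hw, c.o L M hw, M.o_us]
  have oL : ∀ m, L.o x m - L.o x (m - 1) = L.us (L.o x m) := fun m => (L.o_us x m).symm
  have RB1 : ∀ m n : ℤ, |m - n| ≤ 1 → L.us (L.o x m) ≤ R * L.us (L.o x n) := by
    intro m n h
    rw [abs_le] at h
    exact RB L (L.o x n) (L.o x m) (by rw [L.o_o]; apply L.o_le; push_cast; omega)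
      (by rw [L.o_o]; apply L.o_le; push_cast; omega)
  have o1 : L.o x 1 = f.T (-L.w) x := by simp [Level.o]
  have om1 : L.o x (-1) = f.T L.w x := by simp [Level.o]
  have low : ∀ m : ℤ, 0 ≤ m → f.T (-((2 : ℤ) • L.v)) x ≤ L.o x m := by
    intro m hm
    refine le_trans ?_ (ox.ge.trans (L.o_le hm))
    exact (L.v_le_o (x := x) (m := 0) le_rfl (by norm_num)).trans (by simp [ox])
  have high : ∀ m : ℤ, m ≤ 0 → L.o x m ≤ f.T ((2 : ℤ) • L.v) x := by
    intro m hm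
    refine ((L.o_le hm).trans ox.le).trans ?_
    exact ox.ge.trans (L.o_v_le le_rfl (by norm_num))
  constructor
  · intro y h1 h2
    obtain ⟨j, hj1, hj2, hj3⟩ : ∃ j : ℕ, 1 ≤ j ∧ L.o x j ≤ y ∧ y < L.o x (j + 1) := by
      classical
      have hex := L.o_big x y
      have h0 : 2 ≤ Nat.find hex := by
        by_contra h
        have := Nat.find_spec hex
        have h' : L.o x (Nat.find hex) ≤ L.o x 1 := L.o_le (by omega)
        rw [o1] at h'
        linarith
      obtain ⟨j, hj⟩ := Nat.exists_eq_add_of_le h0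
      refine ⟨j + 1, by omega, not_lt.1 (Nat.find_min hex (by omega)), ?_⟩
      have := Nat.find_spec hex
      rw [hj] at this
      refine this.trans_le (L.o_le ?_)
      push_cast; omega
    have inr : ∀ i ≤ j, L.o x ((i : ℤ) + 1) ≤ f.T ((2 : ℤ) • L.v) x := by
      intro i hi
      rw [tw]
      have a1 : L.o x (j : ℤ) ≤ f.T L.v x := hj2.trans h2
      have a2 : L.o x ((i : ℤ) + 1) ≤ L.o (L.o x j) 1 := by rw [L.o_o]; exact L.o_le (by omega)
      refine a2.trans (((L.o_le_iff 1).2 a1).trans ?_)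
      have := L.psi_lt_v (f.T L.v x)
      simpa [Level.o] using this.le
    refine seq_cmp (p := fun i => L.o x (i : ℤ) - x) (P := fun i => c.H (L.o x (i : ℤ)) - c.H x) (j := j)
      hQ (by linarith) lx mx (by simp [ox]) (by simp [ox]) ?_ ?_ ?_ ?_ ?_ ?_ ?_
    · intro i hi
      have e1 := oH ((i : ℤ) + 1)
      have e2 := oL ((i : ℤ) + 1)
      rw [add_sub_cancel_right] at e1 e2
      push_cast
      rw [sub_sub_sub_cancel_right, sub_sub_sub_cancel_right, e1, e2]
      exact (key _ (low _ (by omega)) (inr i hi)).1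
    · intro i hi
      have e1 := oH ((i : ℤ) + 1)
      have e2 := oL ((i : ℤ) + 1)
      rw [add_sub_cancel_right] at e1 e2
      push_cast
      rw [sub_sub_sub_cancel_right, sub_sub_sub_cancel_right, e1, e2]
      exact (key _ (low _ (by omega)) (inr i hi)).2
    · have e2 := oL ((j : ℤ) + 1)
      rw [add_sub_cancel_right] at e2
      have e3 := oL (j : ℤ)
      have e4 := RB1 ((j : ℤ) + 1) j (by rw [abs_le]; omega)
      have e5 : x ≤ L.o x ((j : ℤ) - 1) := ox.ge.trans (L.o_le (by omega))
      have e6 : R * L.us (L.o x j) ≤ R * (L.o x j - x) := mul_le_mul_of_nonneg_left (by linarith) (by linarith)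
      push_cast
      linarith
    · exact sub_le_sub_right hj2 _
    · push_cast; exact sub_le_sub_right hj3.le _
    · exact sub_le_sub_right (c.mono.monotone hj2) _
    · push_cast; exact sub_le_sub_right (c.mono.monotone hj3.le) _
  · intro y h1 h2
    obtain ⟨j, hj1, hj2, hj3⟩ : ∃ j : ℕ, 1 ≤ j ∧ y ≤ L.o x (-(j : ℤ)) ∧ L.o x (-((j : ℤ) + 1)) < y := by
      classical
      have hex := L.o_small x y
      have h0 : 2 ≤ Nat.find hex := by
        by_contra h
        have := Nat.find_spec hex
        have h' : L.o x (-1) ≤ L.o x (-(Nat.find hex : ℤ)) := L.o_le (by omega)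
        rw [om1] at h'
        linarith
      obtain ⟨j, hj⟩ := Nat.exists_eq_add_of_le h0
      refine ⟨j + 1, by omega, not_lt.1 (Nat.find_min hex (by omega)), ?_⟩
      have := Nat.find_spec hex
      rw [hj] at this
      refine lt_of_le_of_lt (L.o_le ?_) this
      push_cast; omega
    have inr : ∀ i ≤ j, f.T (-((2 : ℤ) • L.v)) x ≤ L.o x (-(i : ℤ)) := by
      intro i hi
      rw [tw']
      have a1 : f.T (-L.v) x ≤ L.o x (-(j : ℤ)) := h1.trans hj2
      refine le_trans ?_ (a1.trans (L.o_le (by omega)))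
      exact f.T_neg (by rw [f.val_neg]; linarith [L.hv]) _ |>.le
    refine seq_cmp (p := fun i => x - L.o x (-(i : ℤ))) (P := fun i => c.H x - c.H (L.o x (-(i : ℤ)))) (j := j)
      hQ (by linarith) lx mx (by simp [ox]) (by simp [ox]) ?_ ?_ ?_ ?_ ?_ ?_ ?_
    · intro i hi
      have e1 := oH (-(i : ℤ))
      have e2 := oL (-(i : ℤ))
      rw [show -(i : ℤ) - 1 = -((i : ℤ) + 1) by ring] at e1 e2
      push_cast
      rw [sub_sub_sub_cancel_left, sub_sub_sub_cancel_left, e1, e2]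
      exact (key _ (inr i hi) (high _ (by omega))).1
    · intro i hi
      have e1 := oH (-(i : ℤ))
      have e2 := oL (-(i : ℤ))
      rw [show -(i : ℤ) - 1 = -((i : ℤ) + 1) by ring] at e1 e2
      push_cast
      rw [sub_sub_sub_cancel_left, sub_sub_sub_cancel_left, e1, e2]
      exact (key _ (inr i hi) (high _ (by omega))).2
    · have e2 := oL (-(j : ℤ))
      rw [show -(j : ℤ) - 1 = -((j : ℤ) + 1) by ring] at e2
      have e3 := oL (-(j : ℤ) + 1)
      rw [add_sub_cancel_right] at e3
      have e4 := RB1 (-(j : ℤ)) (-(j : ℤ) + 1) (by rw [abs_le]; omega)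
      have e5 : L.o x (-(j : ℤ) + 1) ≤ x := (L.o_le (by omega)).trans ox.le
      have e6 : R * L.us (L.o x (-(j : ℤ) + 1)) ≤ R * (x - L.o x (-(j : ℤ))) :=
        mul_le_mul_of_nonneg_left (by linarith) (by linarith)
      push_cast
      linarith
    · exact sub_le_sub_left hj2 _
    · push_cast; exact sub_le_sub_left hj3.le _
    · exact sub_le_sub_left (c.mono.monotone hj2) _
    · push_cast; exact sub_le_sub_left (c.mono.monotone hj3.le) _

theorem Nice.rf_unif2 (f g : Nice) (P : Nice → Nice → ℝ → Prop) (hmono : ∀ f g C C', C ≤ C' → P f g C → P f g C')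
    (h : ∀ f g, ∃ C, P f g C) : ∃ C, 1 ≤ C ∧ ∀ n, P (f.rf n) (g.rf n) C := by
  obtain ⟨C1, h1⟩ := h f g
  obtain ⟨C2, h2⟩ := h f.reflect g.reflect
  refine ⟨max 1 (max C1 C2), le_max_left _ _, fun n => ?_⟩
  rcases Nice.rf_cases f g n with ⟨h3, h4⟩ | ⟨h3, h4⟩
  · rw [h3, h4]; exact hmono _ _ _ _ ((le_max_left _ _).trans (le_max_right _ _)) h1
  · rw [h3, h4]; exact hmono _ _ _ _ ((le_max_right _ _).trans (le_max_right _ _)) h2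

/-- the point `x` with sign adapted to level `n` -/
def sx (n : ℕ) (x : ℝ) : ℝ := (-1) ^ n * x
theorem sx_zero (x : ℝ) : sx 0 x = x := by simp [sx]
theorem sx_succ (n : ℕ) (x : ℝ) : sx (n + 1) x = - sx n x := by simp [sx, pow_succ]
theorem sx_even {n : ℕ} (h : Even n) (x : ℝ) : sx n x = x := by simp [sx, h.neg_one_pow]
theorem sx_odd {n : ℕ} (h : Odd n) (x : ℝ) : sx n x = -x := by simp [sx, h.neg_one_pow]
theorem sx_sx (n : ℕ) (x : ℝ) : sx n (sx n x) = x := by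
  rcases Nat.even_or_odd n with h | h
  · rw [sx_even h, sx_even h]
  · rw [sx_odd h, sx_odd h, neg_neg]

theorem Level.next_next_ss {f : Nice} (L : Level f) (x : ℝ) :
    L.next.next.ss x = f.T (L.v + L.nextK • L.w) x - x := by
  have := L.next.us_next (-x)
  rw [neg_neg] at this
  rw [← this, Level.us, L.next_w, f.T_reflect, sg_sg]; ring

theorem Level.next_back {f : Nice} (L : Level f) (x : ℝ) :
    -x - f.reflect.T (-L.next.v) (-x) = f.T (-L.w) x - x := by
  rw [L.next_v, f.T_reflect, ← sg_neg, sg_sg]; ring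

namespace Nice
variable (f : Nice)

def sig (n : ℕ) (x : ℝ) : ℝ := (f.lev n).ss (sx n x)
def bk (n : ℕ) (x : ℝ) : ℝ := sx n x - (f.rf n).T (-(f.lev n).v) (sx n x)

theorem sig_pos (n : ℕ) (x : ℝ) : 0 < f.sig n x := (f.lev n).ss_pos _
theorem sig_succ (n : ℕ) (x : ℝ) : f.sig (n + 1) x = (f.lev n).us (sx n x) := by
  rw [(f.lev n).us_next, sig, sx_succ]; rfl
theorem bk_succ (n : ℕ) (x : ℝ) : f.bk (n + 1) x = (f.rf n).T (-(f.lev n).w) (sx n x) - sx n x := by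
  rw [← (f.lev n).next_back, bk, sx_succ]; rfl
theorem sig_zero (x : ℝ) : f.sig 0 x = 1 := by
  have : (f.lev 0).v = (0, -1) := rfl
  rw [sig, Level.ss, this]
  change f.T (0, -1) _ - _ = 1
  rw [f.T_int]; push_cast; ring
theorem bk_zero (x : ℝ) : f.bk 0 x = 1 := by
  have : (f.lev 0).v = (0, -1) := rfl
  rw [bk, this, show -((0 : ℤ), (-1 : ℤ)) = (0, 1) by simp]
  change _ - f.T (0, 1) _ = 1
  rw [f.T_int]; push_cast; ring

theorem sig_two : ∃ θ : ℝ, 0 < θ ∧ θ < 1 ∧ ∀ n x, f.sig (n + 2) x ≤ θ * f.sig n x := by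
  obtain ⟨t1, p1, q1, h1⟩ := f.decay
  obtain ⟨t2, p2, q2, h2⟩ := f.reflect.decay
  refine ⟨max t1 t2, lt_max_of_lt_left p1, max_lt q1 q2, fun n x => ?_⟩
  have e : f.sig (n + 2) x = (f.rf n).T ((f.lev n).v + (f.lev n).nextK • (f.lev n).w) (sx n x) - sx n x := by
    rw [← Level.next_next_ss, sig, sx_succ, sx_succ, neg_neg]; rfl
  have key : ∀ (L : Level (f.rf n)) x, (f.rf n).T (L.v + L.nextK • L.w) x - x ≤ max t1 t2 * L.ss x := by
    rcases rf_cases f f n with ⟨h3, -⟩ | ⟨h3, -⟩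
    · rw [h3]; exact fun L x => (h1 L x).trans (mul_le_mul_of_nonneg_right (le_max_left _ _) (L.ss_pos x).le)
    · rw [h3]; exact fun L x => (h2 L x).trans (mul_le_mul_of_nonneg_right (le_max_right _ _) (L.ss_pos x).le)
  rw [e]
  exact key _ _

theorem sig_facts : ∃ C : ℝ, 1 ≤ C ∧ ∀ n x, f.sig (n + 1) x ≤ C * f.sig n x ∧ f.bk n x ≤ C * f.sig n x ∧
    f.sig n x ≤ C * f.bk n x := by
  obtain ⟨U, hU, h1⟩ := f.rf_unif (fun g C => ∀ (L : Level g) x, L.us x ≤ C * L.ss x)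
    (fun g C C' h H L x => (H L x).trans (mul_le_mul_of_nonneg_right h (L.ss_pos x).le))
    (fun g => by obtain ⟨C, -, h⟩ := g.us_le_ss; exact ⟨C, h⟩)
  obtain ⟨S, hS, h2⟩ := f.rf_unif (fun g C => ∀ (L : Level g) x y, g.T (-L.v) x ≤ y → y ≤ g.T L.v x →
    L.ss y ≤ C * L.ss x)
    (fun g C C' h H L x y a b => (H L x y a b).trans (mul_le_mul_of_nonneg_right h (L.ss_pos x).le))
    (fun g => by obtain ⟨C, -, h⟩ := g.slow; exact ⟨C, h⟩)
  refine ⟨max U S, le_max_of_le_left hU, fun n x => ?_⟩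
  obtain ⟨L, hL⟩ : ∃ L, L = f.lev n := ⟨_, rfl⟩
  have e1 : f.sig n x = L.ss (sx n x) := by rw [sig, hL]
  have e2 : f.bk n x = L.ss ((f.rf n).T (-L.v) (sx n x)) := by rw [bk, Level.ss, (f.rf n).T_T_neg, hL]
  have e3 : f.sig (n + 1) x = L.us (sx n x) := by rw [sig_succ, hL]
  rw [e1, e2, e3]
  have a1 : (f.rf n).T (-L.v) (sx n x) < sx n x := (f.rf n).T_neg (by rw [(f.rf n).val_neg]; linarith [L.hv]) _
  have a2 := L.lt_v (sx n x)
  have a3 : (f.rf n).T (-L.v) ((f.rf n).T (-L.v) (sx n x)) < (f.rf n).T (-L.v) (sx n x) :=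
    (f.rf n).T_neg (by rw [(f.rf n).val_neg]; linarith [L.hv]) _
  refine ⟨(h1 n L _).trans (mul_le_mul_of_nonneg_right (le_max_left _ _) (L.ss_pos _).le),
    (h2 n L _ _ le_rfl (a1.trans a2).le).trans (mul_le_mul_of_nonneg_right (le_max_right _ _) (L.ss_pos _).le),
    (h2 n L _ _ (a3.trans a1).le ?_).trans (mul_le_mul_of_nonneg_right (le_max_right _ _) (L.ss_pos _).le)⟩
  rw [(f.rf n).T_T_neg]

theorem sig_decay : ∃ C θ : ℝ, 1 ≤ C ∧ 0 < θ ∧ θ < 1 ∧ ∀ n k x, f.sig (n + k) x ≤ C * θ ^ (k / 2) * f.sig n x := by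
  obtain ⟨θ, h0, h1, h⟩ := f.sig_two
  obtain ⟨C, hC, h2⟩ := f.sig_facts
  refine ⟨C, θ, hC, h0, h1, fun n k x => ?_⟩
  have key : ∀ m k, f.sig (m + 2 * k) x ≤ θ ^ k * f.sig m x := by
    intro m k
    induction k with
    | zero => simp
    | succ k ih =>
      calc f.sig (m + 2 * (k + 1)) x = f.sig (m + 2 * k + 2) x := by ring_nf
        _ ≤ θ * f.sig (m + 2 * k) x := h _ _
        _ ≤ θ * (θ ^ k * f.sig m x) := mul_le_mul_of_nonneg_left ih h0.le
        _ = _ := by ring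
  have hp := f.sig_pos n x
  rcases Nat.even_or_odd' k with ⟨j, rfl | rfl⟩
  · rw [show 2 * j / 2 = j by omega]
    refine (key n j).trans (mul_le_mul_of_nonneg_right ?_ hp.le)
    exact le_mul_of_one_le_left (by positivity) hC
  · rw [show (2 * j + 1) / 2 = j by omega]
    calc f.sig (n + (2 * j + 1)) x = f.sig (n + 1 + 2 * j) x := by ring_nf
      _ ≤ θ ^ j * f.sig (n + 1) x := key _ _
      _ ≤ θ ^ j * (C * f.sig n x) := mul_le_mul_of_nonneg_left (h2 n x).1 (by positivity)
      _ = _ := by ring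

theorem sig_small (r : ℝ) (hr : 0 < r) : ∃ n0, ∀ n ≥ n0, ∀ x, (f.lev n).ss x < r := by
  obtain ⟨C, θ, hC, h0, h1, h⟩ := f.sig_decay
  obtain ⟨m, hm⟩ := exists_pow_lt_of_lt_one (show 0 < r / C by positivity) h1
  refine ⟨2 * m, fun n hn x => ?_⟩
  have a := h 0 n (sx n x)
  rw [zero_add, sig_zero, mul_one, sig, sx_sx] at a
  refine a.trans_lt ?_
  have : θ ^ (n / 2) ≤ θ ^ m := pow_le_pow_of_le_one h0.le h1.le (by omega)
  have h3 : C * θ ^ (n / 2) < C * (r / C) := mul_lt_mul_of_pos_left (this.trans_lt hm) (by linarith)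
  rwa [mul_div_cancel₀ _ (by linarith)] at h3

end Nice

namespace Conj
variable {f g : Nice}

theorem cmp_one (c : Conj f g) (L : Level f) (M : Level g) : ∃ A, 1 ≤ A ∧ c.Cmp L M A := by
  have us_c : ∀ {f : Nice} (L : Level f), Continuous L.us := fun {f} L => continuous_id.sub (f.T_cont _)
  have ss_c : ∀ {f : Nice} (L : Level f), Continuous L.ss := fun {f} L => (f.T_cont _).sub continuous_id
  have us_p : ∀ {f : Nice} (L : Level f) x, L.us (x + 1) = L.us x := fun {f} L x => by
    rw [Level.us, Level.us, f.T_add_one]; ring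
  have ss_p : ∀ {f : Nice} (L : Level f) x, L.ss (x + 1) = L.ss x := fun {f} L x => by
    rw [Level.ss, Level.ss, f.T_add_one]; ring
  have Hp : ∀ x, c.H (x + 1) = c.H x + 1 := fun x => by simpa using c.hshift x 1
  obtain ⟨u, hu⟩ : ∃ u : ℝ → ℝ, ∀ x, u x = M.us (c.H x) * L.ss x := ⟨_, fun _ => rfl⟩
  obtain ⟨v, hv⟩ : ∃ u : ℝ → ℝ, ∀ x, u x = L.us x * M.ss (c.H x) := ⟨_, fun _ => rfl⟩
  have uc : Continuous u := by
    rw [show u = fun x => M.us (c.H x) * L.ss x from funext hu]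
    exact ((us_c M).comp c.cont).mul (ss_c L)
  have vc : Continuous v := by
    rw [show v = fun x => L.us x * M.ss (c.H x) from funext hv]
    exact (us_c L).mul ((ss_c M).comp c.cont)
  have u0 : ∀ x, 0 < u x := fun x => by rw [hu]; exact mul_pos (M.us_pos _) (L.ss_pos _)
  have v0 : ∀ x, 0 < v x := fun x => by rw [hv]; exact mul_pos (L.us_pos _) (M.ss_pos _)
  obtain ⟨A, hA, h1⟩ := periodic_bdd (u := fun x => u x / v x) (uc.div₀ vc fun x => (v0 x).ne')
    (fun x => by simp only [hu, hv, us_p, ss_p, Hp])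
  obtain ⟨B, hB, h2⟩ := periodic_bdd (u := fun x => v x / u x) (vc.div₀ uc fun x => (u0 x).ne')
    (fun x => by simp only [hu, hv, us_p, ss_p, Hp])
  refine ⟨1 + A + B, by linarith, fun x => ?_⟩
  rw [← hu, ← hv]
  have a1 := (le_abs_self _).trans (h1 x)
  have a2 := (le_abs_self _).trans (h2 x)
  rw [div_le_iff₀ (v0 x)] at a1
  rw [div_le_iff₀ (u0 x)] at a2
  exact ⟨a1.trans (mul_le_mul_of_nonneg_right (by linarith) (v0 x).le),
    a2.trans (mul_le_mul_of_nonneg_right (by linarith) (u0 x).le)⟩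

theorem cmp_all (c : Conj f g) (hρ : f.ρ = g.ρ) : ∃ A, 1 ≤ A ∧ ∀ n, (c.rf n).Cmp (f.lev n) (g.lev n) A := by
  obtain ⟨A, hA, h⟩ := Nice.rf_unif2 f g (fun f g C => 1 ≤ C ∧ ∀ (c : Conj f g) (L : Level f) (M : Level g),
    L.w = M.w → (∀ x, L.ss x < 1 / C) → (∀ x, M.ss x < 1 / C) → c.Cmp L M C)
    (fun f g C C' h H => ⟨H.1.trans h, fun c L M hw h1 h2 => by
      have : 1 / C' ≤ 1 / C := one_div_le_one_div_of_le (by linarith [H.1]) h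
      exact (H.2 c L M hw (fun x => (h1 x).trans_le this) (fun x => (h2 x).trans_le this)).mono h⟩)
    (fun f g => by
      obtain ⟨r, A, hr, hA, h⟩ := Nice.compare f g
      refine ⟨max A (1 / r), le_max_of_le_left hA, fun c L M hw h1 h2 => ?_⟩
      have : 1 / max A (1 / r) ≤ r := by
        rw [div_le_iff₀ (by positivity)]
        have := mul_le_mul_of_nonneg_left (le_max_right A (1 / r)) hr.le
        rwa [mul_one_div_cancel hr.ne'] at this
      exact (h c L M hw (fun x => (h1 x).trans_le this) (fun x => (h2 x).trans_le this)).mono (le_max_left _ _))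
  obtain ⟨n1, hn1⟩ := f.sig_small (1 / A) (by positivity)
  obtain ⟨n2, hn2⟩ := g.sig_small (1 / A) (by positivity)
  choose B hB1 hB using fun n => (c.rf n).cmp_one (f.lev n) (g.lev n)
  have hB0 : ∀ n, 0 ≤ B n := fun n => by linarith [hB1 n]
  refine ⟨A + ∑ n ∈ Finset.range (max n1 n2), B n, ?_, fun n => ?_⟩
  · have := Finset.sum_nonneg (fun n (_ : n ∈ Finset.range (max n1 n2)) => hB0 n); linarith
  by_cases hn : n < max n1 n2
  · refine (hB n).mono ?_
    have := Finset.single_le_sum (fun n (_ : n ∈ Finset.range (max n1 n2)) => hB0 n) (Finset.mem_range.2 hn)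
    linarith
  · push Not at hn
    refine ((h n).2 (c.rf n) _ _ (Nice.lev_same f g hρ n).2.2 (hn1 n ((le_max_left _ _).trans hn))
      (hn2 n ((le_max_right _ _).trans hn))).mono ?_
    have := Finset.sum_nonneg (fun n (_ : n ∈ Finset.range (max n1 n2)) => hB0 n); linarith

theorem est_all (c : Conj f g) (hρ : f.ρ = g.ρ) : ∃ C, 1 ≤ C ∧ ∀ n, ∃ L : Level (f.rf n), ∃ M : Level (g.rf n),
    L = f.lev n ∧ M = g.lev n ∧ (c.rf n).Cmp L M C ∧ ∀ x,
    (∀ y, (f.rf n).T (-L.w) x ≤ y → y ≤ (f.rf n).T L.v x →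
      ((c.rf n).H y - (c.rf n).H x) * L.ss x ≤ C * ((y - x) * M.ss ((c.rf n).H x)) ∧
      (y - x) * M.ss ((c.rf n).H x) ≤ C * (((c.rf n).H y - (c.rf n).H x) * L.ss x)) ∧
    (∀ y, (f.rf n).T (-L.v) x ≤ y → y ≤ (f.rf n).T L.w x →
      ((c.rf n).H x - (c.rf n).H y) * L.ss x ≤ C * ((x - y) * M.ss ((c.rf n).H x)) ∧
      (x - y) * M.ss ((c.rf n).H x) ≤ C * (((c.rf n).H x - (c.rf n).H y) * L.ss x)) := by
  obtain ⟨A, hA, hcmp⟩ := c.cmp_all hρ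
  obtain ⟨C1, h1⟩ := Nice.level_est f g A hA
  obtain ⟨C2, h2⟩ := Nice.level_est f.reflect g.reflect A hA
  refine ⟨A + C1 + C2, by linarith [h1.1, h2.1], fun n => ⟨_, _, rfl, rfl, (hcmp n).mono (by linarith [h1.1, h2.1]), ?_⟩⟩
  have key : ∃ C, C ≤ A + C1 + C2 ∧ ∀ (c : Conj (f.rf n) (g.rf n)) (L : Level (f.rf n)) (M : Level (g.rf n)),
    L.v = M.v → L.w = M.w → c.Cmp L M A → ∀ x,
    (∀ y, (f.rf n).T (-L.w) x ≤ y → y ≤ (f.rf n).T L.v x →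
      (c.H y - c.H x) * L.ss x ≤ C * ((y - x) * M.ss (c.H x)) ∧
      (y - x) * M.ss (c.H x) ≤ C * ((c.H y - c.H x) * L.ss x)) ∧
    (∀ y, (f.rf n).T (-L.v) x ≤ y → y ≤ (f.rf n).T L.w x →
      (c.H x - c.H y) * L.ss x ≤ C * ((x - y) * M.ss (c.H x)) ∧
      (x - y) * M.ss (c.H x) ≤ C * ((c.H x - c.H y) * L.ss x)) := by
    rcases Nice.rf_cases f g n with ⟨h3, h4⟩ | ⟨h3, h4⟩
    · rw [h3, h4]; exact ⟨C1, by linarith [h2.1], h1.2⟩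
    · rw [h3, h4]; exact ⟨C2, by linarith [h1.1], h2.2⟩
  obtain ⟨C, hC, h⟩ := key
  obtain ⟨-, hv, hw⟩ := Nice.lev_same f g hρ n
  intro x
  obtain ⟨a, b⟩ := h (c.rf n) (f.lev n) (g.lev n) hv hw (hcmp n) x
  have lx := (f.lev n).ss_pos x
  have mx := (g.lev n).ss_pos ((c.rf n).H x)
  constructor
  · intro y y1 y2
    obtain ⟨a1, a2⟩ := a y y1 y2
    have xy : x ≤ y := ((f.lev n).lt_psi x).le.trans y1
    have Hxy := sub_nonneg.2 ((c.rf n).mono.monotone xy)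
    have xy' := sub_nonneg.2 xy
    exact ⟨a1.trans (mul_le_mul_of_nonneg_right hC (by positivity)),
      a2.trans (mul_le_mul_of_nonneg_right hC (by positivity))⟩
  · intro y y1 y2
    obtain ⟨a1, a2⟩ := b y y1 y2
    have xy : y ≤ x := y2.trans ((f.lev n).w_lt x).le
    have Hxy := sub_nonneg.2 ((c.rf n).mono.monotone xy)
    have xy' := sub_nonneg.2 xy
    exact ⟨a1.trans (mul_le_mul_of_nonneg_right hC (by positivity)),
      a2.trans (mul_le_mul_of_nonneg_right hC (by positivity))⟩

end Conj

theorem find_scale (C θ : ℝ) (hC : 1 ≤ C) (h0 : 0 < θ) (h1 : θ < 1) (σ r : ℕ → ℝ)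
    (r0 : r 0 = 1) (hr : ∀ n, r n ≤ C * σ n) (hd : ∀ n k, σ (n + k) ≤ C * θ ^ (k / 2) * σ n)
    (hp : ∀ n, 0 < σ n) (t : ℝ) (t0 : 0 < t) (t1 : t < 1) : ∃ n, r (n + 1) ≤ t ∧ t ≤ r n := by
  classical
  have ex : ∃ n, r n ≤ t := by
    have hs := hp 0
    obtain ⟨m, hm⟩ := exists_pow_lt_of_lt_one (show 0 < t / (C * C * σ 0) by positivity) h1
    refine ⟨2 * m, ?_⟩
    have a := hd 0 (2 * m)
    rw [zero_add, show 2 * m / 2 = m by omega] at a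
    have b : θ ^ m * (C * C * σ 0) < t := by rwa [lt_div_iff₀ (by positivity)] at hm
    have c := mul_le_mul_of_nonneg_left a (by linarith : (0:ℝ) ≤ C)
    have d := hr (2 * m)
    nlinarith
  obtain ⟨n, hn⟩ : ∃ n, n = Nat.find ex := ⟨_, rfl⟩
  have a : r n ≤ t := by rw [hn]; exact Nat.find_spec ex
  rcases n with _ | n
  · rw [r0] at a; linarith
  · refine ⟨n, a, ?_⟩
    have := Nat.find_min ex (m := n) (by omega)
    push Not at this
    exact this.le

theorem scale_close (C θ : ℝ) (hC : 1 ≤ C) (h0 : 0 < θ) (h1 : θ < 1) (p : ℕ) (hpp : C ^ 3 * θ ^ p < 1)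
    (σ r l : ℕ → ℝ)
    (hr : ∀ n, σ n ≤ C * r n) (hl : ∀ n, l n ≤ C * σ n) (hd : ∀ n k, σ (n + k) ≤ C * θ ^ (k / 2) * σ n)
    (hp : ∀ n, 0 < σ n) (t : ℝ) (a b : ℕ) (ha : r (a + 1) ≤ t) (hb : t ≤ l b) : b ≤ a + 2 * p := by
  by_contra hcon
  obtain ⟨k, hk⟩ : ∃ k, b = a + 1 + k := ⟨b - (a + 1), by omega⟩
  have hk2 : p ≤ k / 2 := by omega
  have e1 := hd (a + 1) k
  rw [← hk] at e1
  have e2 : θ ^ (k / 2) ≤ θ ^ p := pow_le_pow_of_le_one h0.le h1.le hk2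
  have s := hp (a + 1)
  have e3 : σ b ≤ C * θ ^ p * σ (a + 1) := e1.trans (by gcongr)
  have e4 : σ (a + 1) ≤ C * (C * (C * θ ^ p * σ (a + 1))) := by
    refine (hr (a + 1)).trans (mul_le_mul_of_nonneg_left ?_ (by linarith))
    exact (ha.trans (hb.trans (hl b))).trans (mul_le_mul_of_nonneg_left e3 (by linarith))
  nlinarith

theorem combine_scales (C θ : ℝ) (hC : 1 ≤ C) (h0 : 0 < θ) (h1 : θ < 1) : ∃ K : ℝ, 1 ≤ K ∧
    ∀ (σ κ r l : ℕ → ℝ) (HR HL : ℝ → ℝ), (∀ n, 0 < σ n) → (∀ n, 0 < κ n) → r 0 = 1 → l 0 = 1 →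
    (∀ n, r n ≤ C * σ n ∧ σ n ≤ C * r n) → (∀ n, l n ≤ C * σ n ∧ σ n ≤ C * l n) →
    (∀ n k, σ (n + k) ≤ C * θ ^ (k / 2) * σ n) → (∀ n, κ (n + 1) ≤ C * κ n ∧ κ n ≤ C * κ (n + 1)) →
    (∀ n d, r (n + 1) ≤ d → d ≤ r n → HR d ≤ C * (κ n * d) ∧ κ n * d ≤ C * HR d) →
    (∀ n d, l (n + 1) ≤ d → d ≤ l n → HL d ≤ C * (κ n * d) ∧ κ n * d ≤ C * HL d) →
    ∀ t, 0 < t → t < 1 → HR t ≤ K * HL t ∧ HL t ≤ K * HR t := by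
  obtain ⟨p, hp⟩ := exists_pow_lt_of_lt_one (show 0 < 1 / C ^ 3 by positivity) h1
  rw [lt_div_iff₀ (by positivity), mul_comm] at hp
  refine ⟨C * C ^ (2 * p) * C, ?_, ?_⟩
  · exact one_le_mul_of_one_le_of_one_le (one_le_mul_of_one_le_of_one_le hC (one_le_pow₀ hC)) hC
  intro σ κ r l HR HL sp kp r0 l0 hr hl hd hk eR eL t t0 t1
  obtain ⟨n, n1, n2⟩ := find_scale C θ hC h0 h1 σ r r0 (fun n => (hr n).1) hd sp t t0 t1
  obtain ⟨m, m1, m2⟩ := find_scale C θ hC h0 h1 σ l l0 (fun n => (hl n).1) hd sp t t0 t1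
  have c1 := scale_close C θ hC h0 h1 p hp σ r l (fun n => (hr n).2) (fun n => (hl n).1) hd sp t n m n1 m2
  have c2 := scale_close C θ hC h0 h1 p hp σ l r (fun n => (hl n).2) (fun n => (hr n).1) hd sp t m n m1 n2
  have hC0 : 0 ≤ C := by linarith
  have kk : ∀ a k, κ (a + k) ≤ C ^ k * κ a ∧ κ a ≤ C ^ k * κ (a + k) := by
    intro a k
    induction k with
    | zero => simp
    | succ k ih =>
      have := hk (a + k)
      rw [← add_assoc, pow_succ]
      constructor
      · calc κ (a + k + 1) ≤ C * κ (a + k) := this.1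
          _ ≤ C * (C ^ k * κ a) := mul_le_mul_of_nonneg_left ih.1 hC0
          _ = _ := by ring
      · calc κ a ≤ C ^ k * κ (a + k) := ih.2
          _ ≤ C ^ k * (C * κ (a + k + 1)) := mul_le_mul_of_nonneg_left this.2 (by positivity)
          _ = _ := by ring
  have km : ∀ a k, k ≤ 2 * p → κ (a + k) ≤ C ^ (2 * p) * κ a ∧ κ a ≤ C ^ (2 * p) * κ (a + k) := by
    intro a k h
    have : C ^ k ≤ C ^ (2 * p) := pow_le_pow_right₀ hC h
    exact ⟨(kk a k).1.trans (mul_le_mul_of_nonneg_right this (kp _).le),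
      (kk a k).2.trans (mul_le_mul_of_nonneg_right this (kp _).le)⟩
  have kn : κ n ≤ C ^ (2 * p) * κ m ∧ κ m ≤ C ^ (2 * p) * κ n := by
    rcases le_total n m with h | h
    · have := km n (m - n) (by omega)
      rw [show n + (m - n) = m by omega] at this
      exact ⟨this.2, this.1⟩
    · have := km m (n - m) (by omega)
      rw [show m + (n - m) = n by omega] at this
      exact this
  obtain ⟨a1, a2⟩ := eR n t n1 n2
  obtain ⟨b1, b2⟩ := eL m t m1 m2
  constructor
  · calc HR t ≤ C * (κ n * t) := a1
      _ ≤ C * (C ^ (2 * p) * κ m * t) := by gcongr; exact kn.1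
      _ = C * C ^ (2 * p) * (κ m * t) := by ring
      _ ≤ C * C ^ (2 * p) * (C * HL t) := by gcongr
      _ = _ := by ring
  · calc HL t ≤ C * (κ m * t) := b1
      _ ≤ C * (C ^ (2 * p) * κ n * t) := by gcongr; exact kn.2
      _ = C * C ^ (2 * p) * (κ n * t) := by ring
      _ ≤ C * C ^ (2 * p) * (C * HR t) := by gcongr
      _ = _ := by ring

theorem Conj.small_scale {f g : Nice} (c : Conj f g) (hρ : f.ρ = g.ρ) : ∃ K : ℝ, 1 ≤ K ∧ ∀ x t, 0 < t → t < 1 →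
    c.H (x + t) - c.H x ≤ K * (c.H x - c.H (x - t)) ∧ c.H x - c.H (x - t) ≤ K * (c.H (x + t) - c.H x) := by
  obtain ⟨C1, hC1, h1⟩ := f.sig_facts
  obtain ⟨C2, θ, hC2, t0, t1, h2⟩ := f.sig_decay
  obtain ⟨C3, hC3, h3⟩ := c.est_all hρ
  obtain ⟨C, hC⟩ : ∃ C : ℝ, C = C1 + C2 + C3 := ⟨_, rfl⟩
  obtain ⟨K, hK, h⟩ := combine_scales C θ (by linarith) t0 t1
  refine ⟨K, hK, fun x => ?_⟩
  have sp := fun n => f.sig_pos n x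
  have bp : ∀ n, 0 < f.bk n x := fun n => by
    have := (h1 n x).2.2
    have := sp n
    by_contra hh
    push Not at hh
    nlinarith
  obtain ⟨κ, hκ⟩ : ∃ κ : ℕ → ℝ, ∀ n, κ n = (g.lev n).ss ((c.rf n).H (sx n x)) / f.sig n x := ⟨_, fun _ => rfl⟩
  have mp : ∀ n, 0 < (g.lev n).ss ((c.rf n).H (sx n x)) := fun n => (g.lev n).ss_pos _
  have kp : ∀ n, 0 < κ n := fun n => by rw [hκ]; exact div_pos (mp n) (sp n)
  have knext : ∀ n, κ (n + 1) = (g.lev n).us ((c.rf n).H (sx n x)) / (f.lev n).us (sx n x) := by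
    intro n
    rw [hκ, f.sig_succ, (g.lev n).us_next, sx_succ]
    congr 1
    change (g.lev n).next.ss (-(c.rf n).H (- -sx n x)) = _
    rw [neg_neg]
  have kk : ∀ n, κ (n + 1) ≤ C * κ n ∧ κ n ≤ C * κ (n + 1) := by
    intro n
    obtain ⟨L, M, hL, hM, hc, -⟩ := h3 n
    obtain ⟨c1, c2⟩ := hc (sx n x)
    have e : κ n = M.ss ((c.rf n).H (sx n x)) / L.ss (sx n x) := by rw [hκ, hL, hM]; rfl
    rw [knext, e, ← hL, ← hM]
    have p1 := L.us_pos (sx n x)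
    have p2 := L.ss_pos (sx n x)
    have p3 := M.us_pos ((c.rf n).H (sx n x))
    have p4 := M.ss_pos ((c.rf n).H (sx n x))
    rw [← mul_div_assoc, ← mul_div_assoc, div_le_div_iff₀ p1 p2, div_le_div_iff₀ p2 p1]
    constructor
    · refine c1.trans ?_
      rw [show C * M.ss ((c.rf n).H (sx n x)) * L.us (sx n x) = C * (L.us (sx n x) * M.ss ((c.rf n).H (sx n x))) by ring]
      exact mul_le_mul_of_nonneg_right (by linarith) (by positivity)
    · rw [mul_comm]
      refine c2.trans ?_
      rw [mul_assoc C]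
      exact mul_le_mul_of_nonneg_right (by linarith) (by positivity)
  have est : ∀ n d, (f.bk (n + 1) x ≤ d → d ≤ f.sig n x →
      (c.rf n).H (sx n x + d) - (c.rf n).H (sx n x) ≤ C * (κ n * d) ∧
      κ n * d ≤ C * ((c.rf n).H (sx n x + d) - (c.rf n).H (sx n x))) ∧
      (f.sig (n + 1) x ≤ d → d ≤ f.bk n x →
      (c.rf n).H (sx n x) - (c.rf n).H (sx n x - d) ≤ C * (κ n * d) ∧
      κ n * d ≤ C * ((c.rf n).H (sx n x) - (c.rf n).H (sx n x - d))) := by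
    intro n d
    obtain ⟨L, M, hL, hM, -, he⟩ := h3 n
    obtain ⟨eR, eL⟩ := he (sx n x)
    have e : κ n = M.ss ((c.rf n).H (sx n x)) / L.ss (sx n x) := by rw [hκ, hL, hM]; rfl
    have p2 := L.ss_pos (sx n x)
    have p4 := M.ss_pos ((c.rf n).H (sx n x))
    have fin : ∀ D, 0 ≤ D → 0 ≤ d → D * L.ss (sx n x) ≤ C3 * (d * M.ss ((c.rf n).H (sx n x))) →
        d * M.ss ((c.rf n).H (sx n x)) ≤ C3 * (D * L.ss (sx n x)) → D ≤ C * (κ n * d) ∧ κ n * d ≤ C * D := by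
      intro D D0 d0 q1 q2
      rw [e]
      constructor
      · rw [div_mul_eq_mul_div, ← mul_div_assoc, le_div_iff₀ p2, mul_comm (M.ss _) d]
        exact q1.trans (mul_le_mul_of_nonneg_right (by linarith) (by positivity))
      · rw [div_mul_eq_mul_div, div_le_iff₀ p2, mul_comm (M.ss _) d, mul_assoc]
        exact q2.trans (mul_le_mul_of_nonneg_right (by linarith) (by positivity))
    constructor
    · intro d1 d2
      have d0 : 0 ≤ d := (bp (n + 1)).le.trans d1
      rw [f.bk_succ, ← hL] at d1
      rw [Nice.sig, ← hL, Level.ss] at d2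
      have := eR (sx n x + d) (by linarith) (by linarith)
      rw [add_sub_cancel_left] at this
      exact fin _ (sub_nonneg.2 ((c.rf n).mono.monotone (by linarith))) d0 this.1 this.2
    · intro d1 d2
      have d0 : 0 ≤ d := (sp (n + 1)).le.trans d1
      rw [f.sig_succ, ← hL, Level.us] at d1
      rw [Nice.bk, ← hL] at d2
      have := eL (sx n x - d) (by linarith) (by linarith)
      rw [sub_sub_cancel] at this
      exact fin _ (sub_nonneg.2 ((c.rf n).mono.monotone (by linarith))) d0 this.1 this.2
  have wk : ∀ n, f.bk n x ≤ C * f.sig n x ∧ f.sig n x ≤ C * f.bk n x ∧ f.sig n x ≤ C * f.sig n x := by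
    intro n
    have s := sp n
    have b := bp n
    exact ⟨(h1 n x).2.1.trans (mul_le_mul_of_nonneg_right (by linarith) s.le),
      (h1 n x).2.2.trans (mul_le_mul_of_nonneg_right (by linarith) b.le), by nlinarith⟩
  have nE : ∀ n, ¬ Even n → Odd n := fun n h => Nat.not_even_iff_odd.1 h
  refine h (fun n => f.sig n x) κ (fun n => if Even n then f.sig n x else f.bk n x)
    (fun n => if Even n then f.bk n x else f.sig n x) (fun d => c.H (x + d) - c.H x) (fun d => c.H x - c.H (x - d))
    sp kp ?_ ?_ ?_ ?_ ?_ kk ?_ ?_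
  · simp [f.sig_zero]
  · simp [f.bk_zero]
  · intro n
    obtain ⟨a, b, c⟩ := wk n
    split_ifs
    exacts [⟨c, c⟩, ⟨a, b⟩]
  · intro n
    obtain ⟨a, b, c⟩ := wk n
    split_ifs
    exacts [⟨a, b⟩, ⟨c, c⟩]
  · intro n k
    have s := sp n
    exact (h2 n k x).trans (mul_le_mul_of_nonneg_right (mul_le_mul_of_nonneg_right (by linarith) (by positivity)) s.le)
  · intro n d d1 d2
    by_cases hn : Even n
    · have hn1 : ¬ Even (n + 1) := by simpa [Nat.even_add_one] using hn
      rw [if_neg hn1] at d1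
      rw [if_pos hn] at d2
      have := (est n d).1 d1 d2
      simpa only [(c.rf_H n).1 hn, sx_even hn] using this
    · have hn1 : Even (n + 1) := by simpa [Nat.even_add_one] using hn
      rw [if_pos hn1] at d1
      rw [if_neg hn] at d2
      have := (est n d).2 d1 d2
      simp only [(c.rf_H n).2 (nE n hn), sx_odd (nE n hn)] at this
      rw [show -(-x - d) = x + d by ring, neg_neg, show -c.H x - -c.H (x + d) = c.H (x + d) - c.H x by ring] at this
      exact this
  · intro n d d1 d2
    by_cases hn : Even n
    · have hn1 : ¬ Even (n + 1) := by simpa [Nat.even_add_one] using hn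
      rw [if_neg hn1] at d1
      rw [if_pos hn] at d2
      have := (est n d).2 d1 d2
      simpa only [(c.rf_H n).1 hn, sx_even hn] using this
    · have hn1 : Even (n + 1) := by simpa [Nat.even_add_one] using hn
      rw [if_pos hn1] at d1
      rw [if_neg hn] at d2
      have := (est n d).1 d1 d2
      simp only [(c.rf_H n).2 (nE n hn), sx_odd (nE n hn)] at this
      rw [show -(-x + d) = x - d by ring, neg_neg, show -c.H (x - d) - -c.H x = c.H x - c.H (x - d) by ring] at this
      exact this

theorem Conj.all_scale {f g : Nice} (c : Conj f g) (hρ : f.ρ = g.ρ) : ∃ K : ℝ, 1 ≤ K ∧ ∀ x t, 0 < t →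
    c.H (x + t) - c.H x ≤ K * (c.H x - c.H (x - t)) ∧ c.H x - c.H (x - t) ≤ K * (c.H (x + t) - c.H x) := by
  obtain ⟨K, hK, h⟩ := c.small_scale hρ
  refine ⟨K + 1, by linarith, fun x t t0 => ?_⟩
  have p1 : 0 < c.H (x + t) - c.H x := sub_pos.2 (c.mono (by linarith))
  have p2 : 0 < c.H x - c.H (x - t) := sub_pos.2 (c.mono (by linarith))
  rcases lt_or_ge t 1 with t1 | t1
  · obtain ⟨a, b⟩ := h x t t0 t1
    exact ⟨by linarith, by linarith⟩
  · have m1 : (1 : ℝ) ≤ ⌊t⌋ := by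
      have : (1 : ℤ) ≤ ⌊t⌋ := Int.le_floor.2 (by exact_mod_cast t1)
      exact_mod_cast this
    have f1 := Int.floor_le t
    have f2 := (Int.lt_floor_add_one t).le
    have a1 := c.hshift x ⌊t⌋
    have a2 := c.hshift x (⌊t⌋ + 1)
    have a3 := c.hshift x (-⌊t⌋)
    have a4 := c.hshift x (-(⌊t⌋ + 1))
    push_cast at a2 a3 a4
    have b1 := c.mono.monotone (show x + (⌊t⌋ : ℝ) ≤ x + t by linarith)
    have b2 := c.mono.monotone (show x + t ≤ x + ((⌊t⌋ : ℝ) + 1) by linarith)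
    have b3 := c.mono.monotone (show x - t ≤ x + -(⌊t⌋ : ℝ) by linarith)
    have b4 := c.mono.monotone (show x + (-1 + -(⌊t⌋ : ℝ)) ≤ x - t by linarith)
    have a4' : c.H (x + (-1 + -(⌊t⌋ : ℝ))) = c.H x - 1 - ⌊t⌋ := by
      have : x + (-1 + -(⌊t⌋ : ℝ)) = x + ((-(⌊t⌋ + 1) : ℤ) : ℝ) := by push_cast; ring
      rw [this, c.hshift]; push_cast; ring
    constructor <;> nlinarith

/-- the conjugacy data of the theorem packaged as a `Conj` -/
def MCM.conj (f g : MCM) (ρ : ℝ) (hirr : Irrational ρ)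
    (hfρ : HasRotationNumber f.F ρ) (hgρ : HasRotationNumber g.F ρ)
    (hN : f.N = g.N)
    (H : ℝ → ℝ) (Hcont : Continuous H) (Hmono : StrictMono H)
    (Hdeg1 : ∀ x, H (x + 1) = H x + 1)
    (Hconj : ∀ x, H (f.F x) = g.F (H x))
    (Hcrit : ∀ i : Fin f.N, ∃ (j : Fin g.N) (k : ℤ), H (f.c i) = g.c j + (k : ℝ)) :
    Conj (f.nice ρ hirr hfρ) (g.nice ρ hirr hgρ) := by
  have hshift : ∀ x (k : ℤ), H (x + k) = H x + k := by
    intro x k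
    induction k using Int.induction_on with
    | zero => simp
    | succ n ih => push_cast at ih ⊢; rw [← add_assoc, Hdeg1, ih]; ring
    | pred n ih =>
      have := Hdeg1 (x + (-(n : ℝ) - 1))
      push_cast at ih ⊢
      rw [show x + (-(n : ℝ) - 1) + 1 = x + -(n : ℝ) by ring, ih] at this
      linarith
  refine ⟨H, Hcont, Hmono, Hconj, hshift, fun x => ?_⟩
  rw [(f.nice ρ hirr hfρ).crit, (g.nice ρ hirr hgρ).crit]
  change (∃ (i : Fin f.N) (k : ℤ), x = f.c i + k) ↔ ∃ (i : Fin g.N) (k : ℤ), H x = g.c i + k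
  constructor
  · rintro ⟨i, k, rfl⟩
    obtain ⟨j, m, h⟩ := Hcrit i
    exact ⟨j, m + k, by rw [hshift, h]; push_cast; ring⟩
  · choose φ κ hφ using Hcrit
    have inj : Function.Injective φ := by
      intro i i' h
      have e : H (f.c i) = H (f.c i' + ((κ i - κ i' : ℤ) : ℝ)) := by
        rw [hshift, hφ, hφ, h]; push_cast; ring
      have e2 := Hmono.injective e
      have m1 := f.c_mem i
      have m2 := f.c_mem i'
      have : κ i - κ i' = 0 := by
        have u1 : ((κ i - κ i' : ℤ) : ℝ) < 1 := by linarith [m1.2, m2.1]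
        have u2 : (-1 : ℝ) < ((κ i - κ i' : ℤ) : ℝ) := by linarith [m1.1, m2.2]
        have v1 : κ i - κ i' < 1 := by exact_mod_cast u1
        have v2 : -1 < κ i - κ i' := by exact_mod_cast u2
        omega
      rw [this] at e2
      exact f.c_inj (by simpa using e2)
    have bij : Function.Bijective φ := (Fintype.bijective_iff_injective_and_card φ).2 ⟨inj, by simpa using hN⟩
    rintro ⟨j, m, h⟩
    obtain ⟨i, rfl⟩ := bij.2 j
    refine ⟨i, m - κ i, Hmono.injective ?_⟩
    rw [h, hshift, hφ]; push_cast; ring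

/-- **Theorem A.** If `f` and `g` are two `C³` multicritical circle maps with
the same irrational rotation number and the same number of critical points, and if the
lift `H` of a conjugacy `h` between them maps each critical point of `f` to a critical
point of `g`, then `h` is quasisymmetric. -/
theorem conjugacy_quasisymmetric
    (f g : MCM) (ρ : ℝ) (hirr : Irrational ρ)
    (hfρ : HasRotationNumber f.F ρ) (hgρ : HasRotationNumber g.F ρ)
    (hN : f.N = g.N)
    (H : ℝ → ℝ) (Hcont : Continuous H) (Hmono : StrictMono H)
    (Hdeg1 : ∀ x, H (x + 1) = H x + 1)
    (Hconj : ∀ x, H (f.F x) = g.F (H x))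
    (Hcrit : ∀ i : Fin f.N, ∃ (j : Fin g.N) (k : ℤ), H (f.c i) = g.c j + (k : ℝ)) :
    ∃ K : ℝ, 1 ≤ K ∧ ∀ x t : ℝ, 0 < t →
      K⁻¹ ≤ |H (x + t) - H x| / |H x - H (x - t)| ∧
        |H (x + t) - H x| / |H x - H (x - t)| ≤ K := by
  obtain ⟨K, hK, h⟩ := (MCM.conj f g ρ hirr hfρ hgρ hN H Hcont Hmono Hdeg1 Hconj Hcrit).all_scale rfl
  refine ⟨K, hK, fun x t t0 => ?_⟩
  obtain ⟨a, b⟩ := h x t t0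
  change H (x + t) - H x ≤ K * (H x - H (x - t)) at a
  change H x - H (x - t) ≤ K * (H (x + t) - H x) at b
  have p1 : 0 < H (x + t) - H x := sub_pos.2 (Hmono (by linarith))
  have p2 : 0 < H x - H (x - t) := sub_pos.2 (Hmono (by linarith))
  rw [abs_of_pos p1, abs_of_pos p2, div_le_iff₀ p2, le_div_iff₀ p2]
  refine ⟨?_, a⟩
  rw [inv_mul_le_iff₀ (by linarith)]
  exact b
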